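/- Let Ω ⊆ ℂᴺ be an open Stein set, let g : Ω → ℂʳ be holomorphic, and let V = {z ∈ Ω : g(z) = 0} (a closed complex subvariety of Ω). Let S ⊆ Ω be a compact O(Ω)-convex set, and let K ⊆ V be a compact set that is O(V)-convex in the sense that K equals the intersection of the O(Ω)-hull of K with V. If S ∩ V ⊆ K, then K ∪ S is O(Ω)-convex. -/

import Mathlib

open Set Topology

noncomputable section

/-- The `𝒪(Ω)`-hull of a set `K` inside `Ω`: points of `Ω` where every function
holomorphic on `Ω` is bounded by its sup over `K`. -/
def hullO {E : Type*} [NormedAddCommGroup E] [NormedSpace ℂ E] (Ω K : Set E) : Set E :=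
  {z ∈ Ω | ∀ f : E → ℂ, DifferentiableOn ℂ f Ω → ‖f z‖ ≤ ⨆ w ∈ K, ‖f w‖}

/-- An open set is Stein if the `𝒪(Ω)`-hull of every compact subset is compact. -/
def IsSteinOpen {E : Type*} [NormedAddCommGroup E] [NormedSpace ℂ E] (Ω : Set E) : Prop :=
  IsOpen Ω ∧ ∀ K : Set E, K ⊆ Ω → IsCompact K → IsCompact (hullO Ω K)

/-- A compact set is a Stein compactum if every open neighborhood contains a
Stein open neighborhood. -/
def IsSteinCompactum {E : Type*} [NormedAddCommGroup E] [NormedSpace ℂ E] (S : Set E) : Prop :=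
  ∀ U : Set E, IsOpen U → S ⊆ U → ∃ Ω : Set E, IsSteinOpen Ω ∧ S ⊆ Ω ∧ Ω ⊆ U

/-- `ℝⁿ` viewed as the real subspace of `ℂⁿ`. -/
def realSlice (n : ℕ) : Set (EuclideanSpace ℂ (Fin n)) := {x | ∀ i, (x i).im = 0}

/-- The fiber of a subset of a product over a point of the first factor. -/
def fiberOf {α β : Type*} (S : Set (α × β)) (u : α) : Set β := {z | (u, z) ∈ S}

/-- A subset of `ℝⁿ × ℂᵐ` that is open in the subspace topology of `ℝⁿ × ℂᵐ ⊆ ℂⁿ × ℂᵐ`. -/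
def OpenInSlice {n m : ℕ}
    (U : Set (EuclideanSpace ℂ (Fin n) × EuclideanSpace ℂ (Fin m))) : Prop :=
  ∃ W, IsOpen W ∧ U = W ∩ (realSlice n ×ˢ (univ : Set (EuclideanSpace ℂ (Fin m))))

section Part1
theorem cauchy_fderiv_est {X F : Type*} [NormedAddCommGroup X] [NormedSpace ℂ X]
    [NormedAddCommGroup F] [NormedSpace ℂ F]
    {f : X → F} {x : X} {r M : ℝ} (hr : 0 < r) (hM : 0 ≤ M)
    (hf : ∀ y ∈ Metric.closedBall x r, DifferentiableAt ℂ f y)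
    (hb : ∀ y ∈ Metric.closedBall x r, ‖f y‖ ≤ M) : ‖fderiv ℂ f x‖ ≤ M / r := by
  refine ContinuousLinearMap.opNorm_le_bound _ (by positivity) fun v => ?_
  rcases eq_or_ne v 0 with rfl | hv
  · simp
  have hv' : 0 < ‖v‖ := norm_pos_iff.2 hv
  have hmem : ∀ ζ ∈ Metric.closedBall (0:ℂ) (r / ‖v‖), x + ζ • v ∈ Metric.closedBall x r := by
    intro ζ hζ
    rw [mem_closedBall_zero_iff] at hζ
    rw [mem_closedBall_iff_norm, add_sub_cancel_left, norm_smul]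
    rwa [le_div_iff₀ hv'] at hζ
  have hd : ∀ ζ ∈ Metric.closedBall (0:ℂ) (r / ‖v‖),
      HasDerivAt (fun ζ : ℂ => f (x + ζ • v)) (fderiv ℂ f (x + ζ • v) v) ζ := by
    intro ζ hζ
    have h1 : HasDerivAt (fun ζ : ℂ => x + ζ • v) v ζ := by
      simpa using ((hasDerivAt_id ζ).smul_const v).const_add x
    exact (hf _ (hmem ζ hζ)).hasFDerivAt.comp_hasDerivAt ζ h1
  have h0 := (hd 0 (by simp; positivity)).deriv
  have := Complex.norm_deriv_le_of_forall_mem_sphere_norm_le (c := 0) (R := r / ‖v‖) (C := M)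
    (f := fun ζ : ℂ => f (x + ζ • v)) (by positivity) ?_ ?_
  · rw [h0] at this
    simp only [zero_smul, add_zero] at this
    refine this.trans (le_of_eq ?_)
    field_simp
  · refine ⟨fun ζ hζ => (hd ζ (Metric.ball_subset_closedBall hζ)).differentiableAt.differentiableWithinAt, ?_⟩
    intro ζ hζ
    exact (hd ζ (Metric.closure_ball_subset_closedBall hζ)).continuousAt.continuousWithinAt
  · intro ζ hζ
    exact hb _ (hmem ζ (Metric.sphere_subset_closedBall hζ))

theorem continuousOn_fderiv_holo {X F : Type*} [NormedAddCommGroup X] [NormedSpace ℂ X]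
    [FiniteDimensional ℂ X]
    [NormedAddCommGroup F] [NormedSpace ℂ F] {U : Set X} (hU : IsOpen U) {f : X → F}
    (hf : DifferentiableOn ℂ f U) : ContinuousOn (fderiv ℂ f) U := by
  have : ProperSpace X := FiniteDimensional.proper ℂ X
  intro x hx
  apply ContinuousAt.continuousWithinAt
  obtain ⟨r, hr, hrU⟩ := Metric.isOpen_iff.1 hU x hx
  have hr4 : 0 < r / 4 := by positivity
  have huc : UniformContinuousOn f (Metric.closedBall x (r/2)) :=
    (isCompact_closedBall x (r/2)).uniformContinuousOn_of_continuous
      (hf.continuousOn.mono ((Metric.closedBall_subset_ball (by linarith)).trans hrU))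
  rw [Metric.continuousAt_iff]
  intro ε hε
  rw [Metric.uniformContinuousOn_iff] at huc
  obtain ⟨δ, hδ, H⟩ := huc (ε / 2 * (r/4)) (by positivity)
  refine ⟨min δ (r/4), by positivity, fun {y} hy => ?_⟩
  have hy1 : dist y x < δ := lt_of_lt_of_le hy (min_le_left _ _)
  have hy2 : dist y x < r/4 := lt_of_lt_of_le hy (min_le_right _ _)
  have hin : ∀ w ∈ Metric.closedBall x (r/4), w ∈ U ∧ w + (y - x) ∈ U ∧
      w ∈ Metric.closedBall x (r/2) ∧ w + (y-x) ∈ Metric.closedBall x (r/2) := by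
    intro w hw
    rw [Metric.mem_closedBall] at hw
    have h2 : dist (w + (y-x)) x ≤ r/2 := by
      calc dist (w + (y-x)) x = ‖(w - x) + (y - x)‖ := by rw [dist_eq_norm]; congr 1; abel
        _ ≤ ‖w - x‖ + ‖y - x‖ := norm_add_le _ _
        _ ≤ r/2 := by rw [← dist_eq_norm, ← dist_eq_norm]; linarith
    exact ⟨hrU (by rw [Metric.mem_ball]; linarith), hrU (by rw [Metric.mem_ball]; linarith),
      by rw [Metric.mem_closedBall]; linarith, by rw [Metric.mem_closedBall]; linarith⟩
  have hdx : ∀ w ∈ U, DifferentiableAt ℂ f w := fun w hw => hf.differentiableAt (hU.mem_nhds hw)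
  have hsh : ∀ w, w + (y - x) ∈ U → HasFDerivAt (fun w => f (w + (y-x))) (fderiv ℂ f (w + (y-x))) w := by
    intro w hw
    have := (hdx _ hw).hasFDerivAt.comp w ((hasFDerivAt_id w).add_const (y-x))
    simpa [Function.comp_def] using this
  have key := cauchy_fderiv_est (f := fun w => f (w + (y-x)) - f w) (x := x) (r := r/4)
    (M := ε/2 * (r/4)) hr4 (by positivity)
    (fun w hw => (hsh w (hin w hw).2.1).differentiableAt.sub (hdx w (hin w hw).1))
    (fun w hw => by
      rw [← dist_eq_norm]
      refine (H _ (hin w hw).2.2.2 _ (hin w hw).2.2.1 ?_).le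
      rw [dist_eq_norm, add_sub_cancel_left, ← dist_eq_norm]; exact hy1)
  have hxx : x ∈ Metric.closedBall x (r/4) := by simp; positivity
  have h2 : fderiv ℂ (fun w => f (w + (y-x)) - f w) x = fderiv ℂ f y - fderiv ℂ f x := by
    have := ((hsh x (hin x hxx).2.1).sub (hdx x hx).hasFDerivAt).fderiv
    rw [show x + (y - x) = y by abel] at this
    exact this
  rw [h2] at key
  rw [dist_eq_norm]
  refine lt_of_le_of_lt key ?_
  rw [mul_div_assoc, div_self hr4.ne']
  linarith

theorem differentiableOn_fderiv_apply_holo {X F : Type*} [NormedAddCommGroup X] [NormedSpace ℂ X]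
    [FiniteDimensional ℂ X]
    [NormedAddCommGroup F] [NormedSpace ℂ F] [CompleteSpace F] {U : Set X} (hU : IsOpen U) {f : X → F}
    (hf : DifferentiableOn ℂ f U) (v : X) : DifferentiableOn ℂ (fun x => fderiv ℂ f x v) U := by
  have : ProperSpace X := FiniteDimensional.proper ℂ X
  intro x hx
  apply DifferentiableAt.differentiableWithinAt
  obtain ⟨r, hr, hrU⟩ := Metric.isOpen_iff.1 hU x hx
  set s : ℝ := r / (4 * (‖v‖ + 1)) with hs
  have hs0 : 0 < s := by positivity
  have hsv : s * ‖v‖ ≤ r / 4 := by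
    rw [hs, div_mul_eq_mul_div, div_le_div_iff₀ (by positivity) (by positivity)]
    nlinarith [norm_nonneg v]
  have hdx : ∀ w ∈ U, DifferentiableAt ℂ f w := fun w hw => hf.differentiableAt (hU.mem_nhds hw)
  have hmem : ∀ y ∈ Metric.ball x (r/4), ∀ ζ ∈ Metric.closedBall (0:ℂ) s,
      y + ζ • v ∈ Metric.closedBall x (r/2) := by
    intro y hy ζ hζ
    rw [mem_closedBall_zero_iff] at hζ
    rw [mem_ball_iff_norm] at hy
    rw [mem_closedBall_iff_norm]
    calc ‖y + ζ • v - x‖ = ‖(y - x) + ζ • v‖ := by congr 1; abel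
      _ ≤ ‖y - x‖ + ‖ζ • v‖ := norm_add_le _ _
      _ ≤ r/4 + s * ‖v‖ := by rw [norm_smul]; gcongr
      _ ≤ r/2 := by linarith
  have hsub : Metric.closedBall x (r/2) ⊆ U := (Metric.closedBall_subset_ball (by linarith)).trans hrU
  -- Cauchy formula
  have hform : ∀ y ∈ Metric.ball x (r/4), fderiv ℂ f y v =
      (2 * Real.pi * Complex.I : ℂ)⁻¹ • ∮ ζ in C(0, s), (ζ ^ 2)⁻¹ • f (y + ζ • v) := by
    intro y hy
    have hd : ∀ ζ ∈ Metric.closedBall (0:ℂ) s,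
        HasDerivAt (fun ζ : ℂ => f (y + ζ • v)) (fderiv ℂ f (y + ζ • v) v) ζ := by
      intro ζ hζ
      have h1 : HasDerivAt (fun ζ : ℂ => y + ζ • v) v ζ := by
        simpa using ((hasDerivAt_id ζ).smul_const v).const_add y
      exact (hdx _ (hsub (hmem y hy ζ hζ))).hasFDerivAt.comp_hasDerivAt ζ h1
    have h0 := (hd 0 (by simp; positivity)).deriv
    have hdc : DiffContOnCl ℂ (fun ζ : ℂ => f (y + ζ • v)) (Metric.ball 0 s) := by
      refine ⟨fun ζ hζ => (hd ζ (Metric.ball_subset_closedBall hζ)).differentiableAt.differentiableWithinAt, ?_⟩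
      intro ζ hζ
      exact (hd ζ (Metric.closure_ball_subset_closedBall hζ)).continuousAt.continuousWithinAt
    have := hdc.deriv_eq_smul_circleIntegral (c := 0) hs0
    rw [h0] at this
    simp only [zero_smul, add_zero, sub_zero] at this
    simp only [one_div] at this
    rw [this, smul_smul, inv_mul_cancel₀ Complex.two_pi_I_ne_zero, one_smul]
  have hcf := continuousOn_fderiv_holo hU hf
  obtain ⟨C, hC⟩ := (isCompact_closedBall x (r/2)).exists_bound_of_continuousOn (hcf.mono hsub)
  have hIntg : DifferentiableAt ℂ (fun y => ∮ ζ in C(0, s), (ζ ^ 2)⁻¹ • f (y + ζ • v)) x := by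
    unfold circleIntegral
    have hcm : ∀ θ : ℝ, circleMap 0 s θ ∈ Metric.closedBall (0:ℂ) s := fun θ =>
      circleMap_mem_closedBall 0 hs0.le θ
    have hcont : ∀ y ∈ Metric.ball x (r/4), Continuous fun θ : ℝ =>
        deriv (circleMap 0 s) θ • ((circleMap 0 s θ) ^ 2)⁻¹ • f (y + circleMap 0 s θ • v) := by
      intro y hy
      have h1 : Continuous fun θ : ℝ => f (y + circleMap 0 s θ • v) := by
        refine ContinuousOn.comp_continuous (s := Metric.closedBall x (r/2)) (hf.continuousOn.mono hsub) (by fun_prop) ?_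
        intro θ; exact hmem y hy _ (hcm θ)
      have h2 : Continuous fun θ : ℝ => ((circleMap 0 s θ) ^ 2)⁻¹ := by
        refine Continuous.inv₀ (by fun_prop) fun θ => ?_
        exact pow_ne_zero 2 (circleMap_ne_center hs0.ne')
      simp only [deriv_circleMap]
      exact (by fun_prop : Continuous fun θ : ℝ => circleMap 0 s θ * Complex.I).smul (h2.smul h1)
    have hcont' : Continuous fun θ : ℝ =>
        deriv (circleMap 0 s) θ • ((circleMap 0 s θ) ^ 2)⁻¹ • fderiv ℂ f (x + circleMap 0 s θ • v) := by
      have h1 : Continuous fun θ : ℝ => fderiv ℂ f (x + circleMap 0 s θ • v) := by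
        refine ContinuousOn.comp_continuous (s := Metric.closedBall x (r/2)) (hcf.mono hsub) (by fun_prop) ?_
        intro θ; exact hmem x (by simp; positivity) _ (hcm θ)
      have h2 : Continuous fun θ : ℝ => ((circleMap 0 s θ) ^ 2)⁻¹ := by
        refine Continuous.inv₀ (by fun_prop) fun θ => ?_
        exact pow_ne_zero 2 (circleMap_ne_center hs0.ne')
      simp only [deriv_circleMap]
      exact (by fun_prop : Continuous fun θ : ℝ => circleMap 0 s θ * Complex.I).smul (h2.smul h1)
    have hx0 : x ∈ Metric.ball x (r/4) := by simp; positivity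
    refine (intervalIntegral.hasFDerivAt_integral_of_dominated_of_fderiv_le (𝕜 := ℂ)
      (F := fun y θ => deriv (circleMap 0 s) θ • ((circleMap 0 s θ) ^ 2)⁻¹ • f (y + circleMap 0 s θ • v))
      (F' := fun y θ => deriv (circleMap 0 s) θ • ((circleMap 0 s θ) ^ 2)⁻¹ • fderiv ℂ f (y + circleMap 0 s θ • v))
      (s := Metric.ball x (r/4)) (bound := fun _ => s * (s^2)⁻¹ * C) (x₀ := x)
      (Metric.ball_mem_nhds x (by positivity)) ?_ ?_ ?_ ?_ ?_ ?_).differentiableAt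
    · filter_upwards [Metric.ball_mem_nhds x (show 0 < r/4 by positivity)] with y hy
      exact (hcont y hy).aestronglyMeasurable
    · exact (hcont x hx0).intervalIntegrable _ _
    · exact hcont'.aestronglyMeasurable
    · refine Filter.Eventually.of_forall fun θ _ y hy => ?_
      rw [norm_smul, norm_smul, norm_inv, norm_pow, deriv_circleMap, norm_mul, Complex.norm_I, mul_one,
        norm_circleMap_zero, abs_of_pos hs0, mul_assoc]
      gcongr
      exact hC _ (hmem y hy _ (hcm θ))
    · exact intervalIntegrable_const
    · refine Filter.Eventually.of_forall fun θ _ y hy => ?_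
      have h1 : HasFDerivAt (fun y => f (y + circleMap 0 s θ • v)) (fderiv ℂ f (y + circleMap 0 s θ • v)) y := by
        have := (hdx _ (hsub (hmem y hy _ (hcm θ)))).hasFDerivAt.comp y
          ((hasFDerivAt_id y).add_const (circleMap 0 s θ • v))
        simpa [Function.comp_def] using this
      exact (h1.const_smul _).const_smul _
  refine (hIntg.const_smul ((2 * Real.pi * Complex.I : ℂ)⁻¹)).congr_of_eventuallyEq ?_
  filter_upwards [Metric.ball_mem_nhds x (show 0 < r/4 by positivity)] with y hy
  exact hform y hy

theorem differentiableOn_fderiv_holo {N : ℕ} {F : Type*}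
    [NormedAddCommGroup F] [NormedSpace ℂ F] [CompleteSpace F] {U : Set (Fin N → ℂ)} (hU : IsOpen U)
    {f : (Fin N → ℂ) → F}
    (hf : DifferentiableOn ℂ f U) : DifferentiableOn ℂ (fderiv ℂ f) U := by
  have : fderiv ℂ f = fun x => ∑ i : Fin N,
      (ContinuousLinearMap.smulRightL ℂ (Fin N → ℂ) F (ContinuousLinearMap.proj i))
        (fderiv ℂ f x (Pi.single i 1)) := by
    funext x
    ext v
    have hv : v = ∑ i, v i • (Pi.single i (1:ℂ) : Fin N → ℂ) := by
      ext j; simp [Finset.sum_apply, Pi.single_apply]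
    conv_lhs => rw [hv, map_sum]
    simp
  rw [this]
  refine DifferentiableOn.fun_sum fun i _ => ?_
  exact (ContinuousLinearMap.differentiable _).comp_differentiableOn
    (differentiableOn_fderiv_apply_holo hU hf _)

theorem contDiffOn_holo {N : ℕ} {F : Type*}
    [NormedAddCommGroup F] [NormedSpace ℂ F] [CompleteSpace F] {U : Set (Fin N → ℂ)} (hU : IsOpen U)
    {f : (Fin N → ℂ) → F}
    (hf : DifferentiableOn ℂ f U) (n : ℕ) : ContDiffOn ℂ n f U := by
  induction n generalizing F with
  | zero => exact contDiffOn_zero.2 hf.continuousOn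
  | succ n ih =>
    rw [show ((n + 1 : ℕ) : WithTop ℕ∞) = (n : WithTop ℕ∞) + 1 by norm_cast,
      contDiffOn_succ_iff_fderiv_of_isOpen hU]
    exact ⟨hf, by simp, ih (differentiableOn_fderiv_holo hU hf)⟩

end Part1

section Part2
/-- Complex Jacobian matrix. -/
def jacM {N : ℕ} (f : (Fin N → ℂ) → (Fin N → ℂ)) (x : Fin N → ℂ) : Matrix (Fin N) (Fin N) ℂ :=
  Matrix.of fun a b => fderiv ℂ f x (Pi.single b 1) a

theorem det_updateRow_adj {N : ℕ} (A : Matrix (Fin N) (Fin N) ℂ) (i : Fin N) (u : Fin N → ℂ) :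
    (A.updateRow i u).det = ∑ j, A.adjugate j i * u j := by
  rw [← Matrix.cramer_transpose_apply, Matrix.cramer_eq_adjugate_mulVec, ← Matrix.adjugate_transpose]
  rfl

theorem jacobi_formula {N : ℕ} {E : Type*} [NormedAddCommGroup E] [NormedSpace ℂ E]
    {A : E → Matrix (Fin N) (Fin N) ℂ} {A' : Fin N → Fin N → (E →L[ℂ] ℂ)} {x : E}
    (hA : ∀ i j, HasFDerivAt (fun y => A y i j) (A' i j) x) :
    HasFDerivAt (fun y => (A y).det) (∑ i, ∑ j, (A x).adjugate j i • A' i j) x := by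
  let D : ContinuousMultilinearMap ℂ (fun _ : Fin N => Fin N → ℂ) ℂ :=
    ⟨(Matrix.detRowAlternating (n := Fin N) (R := ℂ)).toMultilinearMap, by
      exact Continuous.matrix_det (A := fun M : Fin N → Fin N → ℂ => Matrix.of M) continuous_id⟩
  have h1 := HasFDerivAt.multilinear_comp D (g := fun i y => A y i)
    (g' := fun i => ContinuousLinearMap.pi (A' i)) (x := x)
    (fun i => hasFDerivAt_pi.2 (hA i))
  have h2 : (∑ i, ∑ j, (A x).adjugate j i • A' i j) =
      ∑ i : Fin N, (D.toContinuousLinearMap (fun j ↦ A x j) i) ∘L (ContinuousLinearMap.pi (A' i)) := by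
    refine Finset.sum_congr rfl fun i _ => ?_
    refine ContinuousLinearMap.ext fun v => ?_
    have h3 : (∑ j, (A x).adjugate j i • A' i j) v = ∑ j, (A x).adjugate j i * A' i j v := by simp
    rw [h3, ← det_updateRow_adj (A x) i (fun j => A' i j v)]
    rfl
  rw [h2]
  exact h1

theorem differentiableAt_det {N : ℕ} {E : Type*} [NormedAddCommGroup E] [NormedSpace ℂ E]
    {A : E → Matrix (Fin N) (Fin N) ℂ} {x : E}
    (hA : ∀ i j, DifferentiableAt ℂ (fun y => A y i j) x) :
    DifferentiableAt ℂ (fun y => (A y).det) x :=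
  (jacobi_formula (fun i j => (hA i j).hasFDerivAt)).differentiableAt

theorem differentiableAt_adj {N : ℕ} {E : Type*} [NormedAddCommGroup E] [NormedSpace ℂ E]
    {A : E → Matrix (Fin N) (Fin N) ℂ} {x : E}
    (hA : ∀ i j, DifferentiableAt ℂ (fun y => A y i j) x) (i j : Fin N) :
    DifferentiableAt ℂ (fun y => (A y).adjugate i j) x := by
  simp only [Matrix.adjugate_apply]
  refine differentiableAt_det fun a b => ?_
  by_cases h : a = j
  · subst h; simp
  · simp [Matrix.updateRow_ne h]; exact hA a b

theorem jacM_differentiableAt {N : ℕ} {P : Set (Fin N → ℂ)} (hP : IsOpen P)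
    {f : (Fin N → ℂ) → (Fin N → ℂ)} (hf : DifferentiableOn ℂ f P) {x} (hx : x ∈ P) (a b : Fin N) :
    DifferentiableAt ℂ (fun y => jacM f y a b) x := by
  have := (differentiableOn_fderiv_apply_holo hP hf (Pi.single b 1)).differentiableAt (hP.mem_nhds hx)
  exact differentiableAt_pi.1 this a

theorem fderiv_jacM_symm {N : ℕ} {P : Set (Fin N → ℂ)} (hP : IsOpen P)
    {f : (Fin N → ℂ) → (Fin N → ℂ)} (hf : DifferentiableOn ℂ f P) {x} (hx : x ∈ P) (a b k : Fin N) :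
    fderiv ℂ (fun y => jacM f y a b) x (Pi.single k 1) =
      fderiv ℂ (fun y => jacM f y a k) x (Pi.single b 1) := by
  have h1 : ContDiffAt ℂ 2 f x := (contDiffOn_holo hP hf 2).contDiffAt (hP.mem_nhds hx)
  have h2 := h1.isSymmSndFDerivAt (by simp)
  have h3 := (differentiableOn_fderiv_holo hP hf).differentiableAt (hP.mem_nhds hx)
  have h4 : ∀ b k : Fin N, fderiv ℂ (fun y => jacM f y a b) x (Pi.single k 1) =
      fderiv ℂ (fderiv ℂ f) x (Pi.single k 1) (Pi.single b 1) a := by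
    intro b k
    have : HasFDerivAt (fun y => jacM f y a b)
      ((((ContinuousLinearMap.proj (R := ℂ) (φ := fun _ : Fin N => ℂ) a) ∘L
        (ContinuousLinearMap.apply ℂ (Fin N → ℂ) (Pi.single b (1:ℂ) : Fin N → ℂ))) :
          ((Fin N → ℂ) →L[ℂ] (Fin N → ℂ)) →L[ℂ] ℂ) ∘L
        (fderiv ℂ (fderiv ℂ f) x)) x := by
      exact (ContinuousLinearMap.hasFDerivAt ((ContinuousLinearMap.proj (R := ℂ) (φ := fun _ : Fin N => ℂ) a) ∘L
        (ContinuousLinearMap.apply ℂ (Fin N → ℂ) (Pi.single b (1:ℂ) : Fin N → ℂ)))).comp x h3.hasFDerivAt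
    rw [this.fderiv]; rfl
  rw [h4, h4, h2.eq]

theorem piola {N : ℕ} {P : Set (Fin N → ℂ)} (hP : IsOpen P)
    {f : (Fin N → ℂ) → (Fin N → ℂ)} (hf : DifferentiableOn ℂ f P)
    (hJ : P ⊆ closure {x ∈ P | (jacM f x).det ≠ 0}) (l : Fin N) {x} (hx : x ∈ P) :
    ∑ k, fderiv ℂ (fun y => (jacM f y).adjugate k l) x (Pi.single k 1) = 0 := by
  have hM : ∀ y ∈ P, ∀ a b, DifferentiableAt ℂ (fun y => jacM f y a b) y :=
    fun y hy a b => jacM_differentiableAt hP hf hy a b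
  have hB : ∀ y ∈ P, ∀ a b, DifferentiableAt ℂ (fun y => (jacM f y).adjugate a b) y :=
    fun y hy a b => differentiableAt_adj (hM y hy) a b
  set Q : (Fin N → ℂ) → ℂ :=
    fun x => ∑ k, fderiv ℂ (fun y => (jacM f y).adjugate k l) x (Pi.single k 1) with hQ
  have hQc : ContinuousOn Q P := by
    refine continuousOn_finsetSum _ fun k _ => ?_
    exact (continuousOn_fderiv_holo hP
      (fun y hy => (hB y hy k l).differentiableWithinAt)).clm_apply continuousOn_const
  have hQ0 : ∀ y ∈ P, (jacM f y).det ≠ 0 → Q y = 0 := by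
    intro y hy hJy
    set M := jacM f y with hMdef
    set B := M.adjugate with hBdef
    -- derivatives
    set dM : Fin N → Matrix (Fin N) (Fin N) ℂ :=
      fun k => Matrix.of fun a b => fderiv ℂ (fun y => jacM f y a b) y (Pi.single k 1) with hdM
    set dB : Fin N → Matrix (Fin N) (Fin N) ℂ :=
      fun k => Matrix.of fun a b => fderiv ℂ (fun y => (jacM f y).adjugate a b) y (Pi.single k 1) with hdB
    set dJ : Fin N → ℂ := fun k => fderiv ℂ (fun y => (jacM f y).det) y (Pi.single k 1) with hdJ
    have hjac : ∀ k, dJ k = ∑ a, ∑ b, B b a * dM k a b := by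
      intro k
      rw [hdJ]
      simp only
      rw [(jacobi_formula (fun i j => (hM y hy i j).hasFDerivAt)).fderiv]
      simp [ContinuousLinearMap.sum_apply, hdM, hBdef, hMdef]
    have hprod : ∀ k, dB k * M + B * dM k = dJ k • (1 : Matrix (Fin N) (Fin N) ℂ) := by
      intro k
      ext a c
      have e1 : (fun y => ∑ b, (jacM f y).adjugate a b * jacM f y b c) =
          fun y => (jacM f y).det * (1 : Matrix (Fin N) (Fin N) ℂ) a c := by
        funext y
        have := congrFun (congrFun (Matrix.adjugate_mul (jacM f y)) a) c
        simpa [Matrix.mul_apply] using this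
      have e2 : HasFDerivAt (fun y => ∑ b, (jacM f y).adjugate a b * jacM f y b c) _ y :=
        HasFDerivAt.fun_sum fun b _ => (hB y hy a b).hasFDerivAt.mul (hM y hy b c).hasFDerivAt
      have e3 : HasFDerivAt (fun y => (jacM f y).det * (1 : Matrix (Fin N) (Fin N) ℂ) a c) _ y :=
        (differentiableAt_det (hM y hy)).hasFDerivAt.mul_const _
      rw [e1] at e2
      have e4 := congrArg (fun T => T (Pi.single k 1)) (e2.unique e3)
      simp only [ContinuousLinearMap.sum_apply, ContinuousLinearMap.add_apply,
        ContinuousLinearMap.smul_apply, smul_eq_mul] at e4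
      rw [Matrix.add_apply, Matrix.mul_apply, Matrix.mul_apply, Matrix.smul_apply, smul_eq_mul,
        ← Finset.sum_add_distrib]
      rw [mul_comm, ← show _ = _ from e4]
      refine Finset.sum_congr rfl fun b _ => ?_
      simp only [hdB, hdM, Matrix.of_apply, hMdef, hBdef]
      ring
    have hkey : ∀ k, M.det • dB k = dJ k • B - B * dM k * B := by
      intro k
      have := congrArg (fun T => T * B) (hprod k)
      simp only [Matrix.add_mul, Matrix.mul_assoc, hBdef, Matrix.mul_adjugate, Matrix.mul_smul,
        Matrix.mul_one, Matrix.smul_mul, Matrix.one_mul] at this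
      rw [← this, hBdef]; simp [Matrix.mul_assoc]
    have : M.det * Q y = 0 := by
      have h1 : M.det * Q y = ∑ k, (M.det • dB k) k l := by
        rw [hQ, Finset.mul_sum]; rfl
      rw [h1]
      simp_rw [hkey]
      simp only [Matrix.sub_apply, Matrix.smul_apply, smul_eq_mul, Finset.sum_sub_distrib, hjac]
      rw [sub_eq_zero]
      simp only [Matrix.mul_apply, Finset.sum_mul]
      have hs : ∀ a b k, dM k a b = dM b a k := fun a b k => fderiv_jacM_symm hP hf hy a b k
      calc _ = ∑ k, ∑ b, ∑ a, B b a * dM k a b * B k l := by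
            refine Finset.sum_congr rfl fun k _ => Finset.sum_comm
        _ = ∑ b, ∑ k, ∑ a, B b a * dM k a b * B k l := Finset.sum_comm
        _ = _ := by
            refine Finset.sum_congr rfl fun b _ => Finset.sum_congr rfl fun k _ =>
              Finset.sum_congr rfl fun a _ => by rw [hs a b k]
    exact (mul_eq_zero.1 this).resolve_left hJy
  have hmem := hJ hx
  have : closure {x ∈ P | (jacM f x).det ≠ 0} ∩ P ⊆ {x ∈ P| Q x = 0} := by
    rintro z ⟨hz, hzP⟩
    refine ⟨hzP, ?_⟩
    have h1 : Q z ∈ closure (Q '' {x ∈ P | (jacM f x).det ≠ 0}) :=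
      (hQc.continuousAt (hP.mem_nhds hzP)).continuousWithinAt.mem_closure_image hz
    have h2 : closure (Q '' {x ∈ P | (jacM f x).det ≠ 0}) ⊆ {0} := by
      refine closure_minimal ?_ isClosed_singleton
      rintro _ ⟨y, ⟨hy, hy2⟩, rfl⟩
      exact hQ0 y hy hy2
    exact h2 h1
  exact (this ⟨hmem, hx⟩).2

end Part2

section Part3
open MeasureTheory ComplexConjugate

/-- twice the dbar derivative in direction k -/
def dbar {N : ℕ} (g : (Fin N → ℂ) → ℂ) (k : Fin N) (x : Fin N → ℂ) : ℂ :=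
  fderiv ℝ g x (Pi.single k 1) + Complex.I * fderiv ℝ g x (Pi.single k Complex.I)

theorem dbar_linear {N : ℕ} (L : (Fin N → ℂ) →L[ℝ] ℂ) (v : Fin N → ℂ) :
    L v + Complex.I * L (Complex.I • v) =
      ∑ j, conj (v j) * (L (Pi.single j 1) + Complex.I * L (Pi.single j Complex.I)) := by
  have hv : v = ∑ j, ((v j).re • (Pi.single j (1:ℂ) : Fin N → ℂ) +
      (v j).im • (Pi.single j Complex.I : Fin N → ℂ)) := by
    ext i
    rw [Finset.sum_apply, Finset.sum_eq_single i]
    · simp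
    · intro b _ hb; simp [Pi.single_apply, hb.symm]
    · simp
  have hv2 : Complex.I • v = ∑ j, ((v j).re • (Pi.single j Complex.I : Fin N → ℂ) -
      (v j).im • (Pi.single j (1:ℂ) : Fin N → ℂ)) := by
    ext i
    rw [Finset.sum_apply, Finset.sum_eq_single i]
    · simp only [Pi.smul_apply, Pi.sub_apply, Pi.single_eq_same, smul_eq_mul, Complex.real_smul, mul_one]
      conv_lhs => rw [← Complex.re_add_im (v i)]
      linear_combination (v i).im * Complex.I_mul_I
    · intro b _ hb; simp [Pi.single_apply, hb.symm]
    · simp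
  have hLv := congrArg L hv
  rw [hv2, hLv]
  simp only [map_sum, map_add, map_sub, map_smul, Finset.mul_sum, ← Finset.sum_add_distrib]
  refine Finset.sum_congr rfl fun j _ => ?_
  have hc : conj (v j) = (v j).re - (v j).im * Complex.I := by
    apply Complex.ext <;> simp
  rw [hc]
  simp only [Complex.real_smul]
  linear_combination ((v j).im : ℂ) * L (Pi.single j Complex.I) * Complex.I_mul_I

theorem integral_fderiv_zero {N : ℕ} {g : (Fin N → ℂ) → ℂ} (hg : ContDiff ℝ 1 g)
    (hc : HasCompactSupport g) (v : Fin N → ℂ) : ∫ x, fderiv ℝ g x v = 0 := by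
  have h1 : Integrable g := hg.continuous.integrable_of_hasCompactSupport hc
  have h2 : Integrable (fun x => fderiv ℝ g x v) := by
    refine Continuous.integrable_of_hasCompactSupport ?_ ?_
    · exact (hg.continuous_fderiv (by simp)).clm_apply continuous_const
    · exact hc.fderiv_apply ℝ v
  have := integral_mul_fderiv_eq_neg_fderiv_mul_of_integrable (μ := volume) (f := fun _ => (1:ℂ)) (g := g) (v := v)
    (by simp) (by simpa using h2) (by simpa using h1) (by simp)
    (fun x _ => (hg.differentiable (by simp)) x)
  simpa using this

theorem contDiff_indicator {N : ℕ} {P C : Set (Fin N → ℂ)} (hP : IsOpen P) (hC : IsClosed C) (hCP : C ⊆ P)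
    {F : (Fin N → ℂ) → ℂ} {n : WithTop ℕ∞} (hF : ContDiffOn ℝ n F P) (h0 : ∀ x ∈ P, x ∉ C → F x = 0) :
    ContDiff ℝ n (P.indicator F) := by
  rw [contDiff_iff_contDiffAt]
  intro x
  by_cases hx : x ∈ P
  · refine (hF.contDiffAt (hP.mem_nhds hx)).congr_of_eventuallyEq ?_
    filter_upwards [hP.mem_nhds hx] with y hy using indicator_of_mem hy F
  · have : P.indicator F =ᶠ[𝓝 x] fun _ => 0 := by
      filter_upwards [hC.isOpen_compl.mem_nhds (fun h => hx (hCP h))] with y hy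
      by_cases hyP : y ∈ P
      · rw [indicator_of_mem hyP]; exact h0 y hyP hy
      · exact indicator_of_notMem hyP F
    exact contDiffAt_const.congr_of_eventuallyEq this

theorem hasCompactSupport_indicator {N : ℕ} {P C : Set (Fin N → ℂ)} (hC : IsCompact C)
    {F : (Fin N → ℂ) → ℂ} (h0 : ∀ x ∈ P, x ∉ C → F x = 0) :
    HasCompactSupport (P.indicator F) := by
  refine HasCompactSupport.intro hC fun x hx => ?_
  by_cases hyP : x ∈ P
  · rw [indicator_of_mem hyP]; exact h0 x hyP hx
  · exact indicator_of_notMem hyP F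

/-- A branched covering of the unit polydisc. -/
structure BrCov {N : ℕ} (P : Set (Fin N → ℂ)) (f : (Fin N → ℂ) → (Fin N → ℂ)) : Prop where
  isOpen : IsOpen P
  holo : DifferentiableOn ℂ f P
  proper : ∀ r < 1, IsCompact {x ∈ P | ‖f x‖ ≤ r}
  dense : P ⊆ closure {x ∈ P | (jacM f x).det ≠ 0}
  lt_one : ∀ x ∈ P, ‖f x‖ < 1

theorem contDiffOn_real_holo {N : ℕ} {F : Type*}
    [NormedAddCommGroup F] [NormedSpace ℂ F] [CompleteSpace F] {U : Set (Fin N → ℂ)} (hU : IsOpen U)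
    {f : (Fin N → ℂ) → F} (hf : DifferentiableOn ℂ f U) : ContDiffOn ℝ 1 f U :=
  (contDiffOn_holo hU hf 1).restrict_scalars ℝ

theorem dbar_holo_mul {N : ℕ} {a b : (Fin N → ℂ) → ℂ} {x : Fin N → ℂ} (ha : DifferentiableAt ℂ a x)
    (hb : DifferentiableAt ℝ b x) (k : Fin N) :
    dbar (fun y => a y * b y) k x = a x * dbar b k x := by
  have h1 := ((ha.hasFDerivAt.restrictScalars ℝ).mul hb.hasFDerivAt).fderiv
  unfold dbar
  rw [show (fun y => a y * b y) = a * b from rfl, h1]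
  have h2 : (Pi.single k Complex.I : Fin N → ℂ) = Complex.I • Pi.single k 1 := by
    rw [← Pi.single_smul]; simp
  have h3 : fderiv ℂ a x (Pi.single k Complex.I) = Complex.I * fderiv ℂ a x (Pi.single k 1) := by
    rw [h2, map_smul, smul_eq_mul]
  simp only [add_apply, smul_apply, ContinuousLinearMap.coe_restrictScalars', smul_eq_mul, h3]
  linear_combination b x * fderiv ℂ a x (Pi.single k 1) * Complex.I_mul_I

theorem dbar_conj_mul {N : ℕ} {a b : (Fin N → ℂ) → ℂ} {x : Fin N → ℂ} (ha : DifferentiableAt ℂ a x)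
    (hb : DifferentiableAt ℝ b x) (k : Fin N) :
    dbar (fun y => conj (a y) * b y) k x =
      conj (a x) * dbar b k x + b x * (2 * conj (fderiv ℂ a x (Pi.single k 1))) := by
  have h0 : HasFDerivAt (fun y => conj (a y))
      ((Complex.conjCLE : ℂ →L[ℝ] ℂ) ∘L ((fderiv ℂ a x).restrictScalars ℝ)) x := by
    exact (Complex.conjCLE : ℂ →L[ℝ] ℂ).hasFDerivAt.comp x (ha.hasFDerivAt.restrictScalars ℝ)
  have h1 := (h0.mul hb.hasFDerivAt).fderiv
  unfold dbar
  rw [show (fun y => conj (a y) * b y) = (fun y => conj (a y)) * b from rfl, h1]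
  have h2 : (Pi.single k Complex.I : Fin N → ℂ) = Complex.I • Pi.single k 1 := by
    rw [← Pi.single_smul]; simp
  have h3 : fderiv ℂ a x (Pi.single k Complex.I) = Complex.I * fderiv ℂ a x (Pi.single k 1) := by
    rw [h2, map_smul, smul_eq_mul]
  simp only [add_apply, smul_apply, ContinuousLinearMap.comp_apply,
    ContinuousLinearMap.coe_restrictScalars', smul_eq_mul, h3]
  simp only [ContinuousLinearEquiv.coe_coe, Complex.conjCLE_apply, map_mul, Complex.conj_I]
  linear_combination -b x * conj (fderiv ℂ a x (Pi.single k 1)) * Complex.I_mul_I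

theorem dbar_comp {N : ℕ} {η : (Fin N → ℂ) → ℂ} {f : (Fin N → ℂ) → (Fin N → ℂ)} {x : Fin N → ℂ}
    (hf : DifferentiableAt ℂ f x) (hη : DifferentiableAt ℝ η (f x)) (k : Fin N) :
    dbar (fun y => η (f y)) k x = ∑ j, conj (jacM f x j k) * dbar η j (f x) := by
  have h1 := (hη.hasFDerivAt.comp x (hf.hasFDerivAt.restrictScalars ℝ)).fderiv
  have h2 : (Pi.single k Complex.I : Fin N → ℂ) = Complex.I • Pi.single k 1 := by
    rw [← Pi.single_smul]; simp
  unfold dbar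
  rw [show (fun y => η (f y)) = η ∘ f from rfl, h1, h2]
  simp only [ContinuousLinearMap.comp_apply, ContinuousLinearMap.coe_restrictScalars', map_smul]
  exact dbar_linear (fderiv ℝ η (f x)) (fderiv ℂ f x (Pi.single k 1))

theorem BrCov.integral_dbar {N : ℕ} {P : Set (Fin N → ℂ)} {f : (Fin N → ℂ) → (Fin N → ℂ)} (H : BrCov P f)
    {h : (Fin N → ℂ) → ℂ} (hh : DifferentiableOn ℂ h P) {η : (Fin N → ℂ) → ℂ} (hη : ContDiff ℝ 1 η)
    {r : ℝ} (hr : r < 1) (hsupp : ∀ u, r < ‖u‖ → η u = 0) (l : Fin N) :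
    ∫ x in P, h x * ((‖(jacM f x).det‖ ^ 2 : ℝ) : ℂ) * dbar η l (f x) = 0 := by
  set J : (Fin N → ℂ) → ℂ := fun x => (jacM f x).det with hJ
  set B : (Fin N → ℂ) → Matrix (Fin N) (Fin N) ℂ := fun x => (jacM f x).adjugate with hB
  have hP := H.isOpen
  set C := {x ∈ P | ‖f x‖ ≤ r} with hCdef
  have hC : IsCompact C := H.proper r hr
  have hCP : C ⊆ P := fun x hx => hx.1
  have dJ : ∀ x ∈ P, DifferentiableAt ℂ J x := fun x hx =>
    differentiableAt_det (jacM_differentiableAt hP H.holo hx)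
  have dB : ∀ x ∈ P, ∀ i j, DifferentiableAt ℂ (fun y => B y i j) x := fun x hx =>
    differentiableAt_adj (jacM_differentiableAt hP H.holo hx)
  have dh : ∀ x ∈ P, DifferentiableAt ℂ h x := fun x hx => hh.differentiableAt (hP.mem_nhds hx)
  have df : ∀ x ∈ P, DifferentiableAt ℂ f x := fun x hx => H.holo.differentiableAt (hP.mem_nhds hx)
  set F : Fin N → (Fin N → ℂ) → ℂ := fun k x => (h x * J x) * (conj (B x k l) * η (f x)) with hF
  have hF0 : ∀ k, ∀ x ∈ P, x ∉ C → F k x = 0 := by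
    intro k x hx hxC
    have : r < ‖f x‖ := by by_contra hcon; exact hxC ⟨hx, not_lt.1 hcon⟩
    simp [hF, hsupp _ this]
  have hηf : ContDiffOn ℝ 1 (fun x => η (f x)) P := hη.comp_contDiffOn (contDiffOn_real_holo hP H.holo)
  have hFc : ∀ k, ContDiffOn ℝ 1 (F k) P := by
    intro k
    have h1 : ContDiffOn ℝ 1 (fun x => h x * J x) P := contDiffOn_real_holo hP
      (fun x hx => ((dh x hx).mul (dJ x hx)).differentiableWithinAt)
    have h2 : ContDiffOn ℝ 1 (fun x => B x k l) P := contDiffOn_real_holo hP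
      (fun x hx => (dB x hx k l).differentiableWithinAt)
    have h3 : ContDiffOn ℝ 1 (fun x => conj (B x k l)) P :=
      (Complex.conjCLE : ℂ →L[ℝ] ℂ).contDiff.comp_contDiffOn h2
    exact h1.mul (h3.mul hηf)
  have hQ : ∀ k, ContDiff ℝ 1 (P.indicator (F k)) := fun k =>
    contDiff_indicator hP hC.isClosed hCP (hFc k) (hF0 k)
  have hQs : ∀ k, HasCompactSupport (P.indicator (F k)) := fun k => hasCompactSupport_indicator hC (hF0 k)
  have hIntg : ∀ k v, Integrable (fun x => fderiv ℝ (P.indicator (F k)) x v) := by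
    intro k v
    refine Continuous.integrable_of_hasCompactSupport ?_ ?_
    · exact ((hQ k).continuous_fderiv (by simp)).clm_apply continuous_const
    · exact (hQs k).fderiv_apply ℝ v
  have hzero : ∫ x, ∑ k, dbar (P.indicator (F k)) k x = 0 := by
    rw [integral_finsetSum]
    · refine Finset.sum_eq_zero fun k _ => ?_
      unfold dbar
      rw [integral_add (hIntg k _) ((hIntg k _).const_mul _), integral_const_mul,
        integral_fderiv_zero (hQ k) (hQs k), integral_fderiv_zero (hQ k) (hQs k)]
      simp
    · intro k _
      exact (hIntg k _).add ((hIntg k _).const_mul _)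
  rw [← integral_indicator hP.measurableSet, ← hzero]
  congr 1
  funext x
  by_cases hx : x ∈ P
  · rw [indicator_of_mem hx]
    have e1 : ∀ k, dbar (P.indicator (F k)) k x = dbar (F k) k x := by
      intro k
      have : P.indicator (F k) =ᶠ[𝓝 x] F k := by
        filter_upwards [hP.mem_nhds hx] with y hy using indicator_of_mem hy _
      unfold dbar
      rw [this.fderiv_eq]
    have dη : DifferentiableAt ℝ η (f x) := hη.differentiable (by simp) _
    have dηf : DifferentiableAt ℝ (fun y => η (f y)) x :=
      (hηf.differentiableOn (by simp)).differentiableAt (hP.mem_nhds hx)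
    have dcB : ∀ k, DifferentiableAt ℝ (fun y => conj (B y k l)) x := fun k =>
      (Complex.conjCLE : ℂ →L[ℝ] ℂ).differentiableAt.comp x ((dB x hx k l).restrictScalars ℝ)
    have e2 : ∀ k, dbar (F k) k x = (h x * J x) * (conj (B x k l) * (∑ j, conj (jacM f x j k) * dbar η j (f x))
        + η (f x) * (2 * conj (fderiv ℂ (fun y => B y k l) x (Pi.single k 1)))) := by
      intro k
      have i1 := dbar_holo_mul (a := fun y => h y * J y) (b := fun y => conj (B y k l) * η (f y))
        ((dh x hx).mul (dJ x hx)) ((dcB k).mul dηf) k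
      have i2 := dbar_conj_mul (dB x hx k l) dηf k
      rw [dbar_comp (df x hx) dη] at i2
      rw [i2] at i1
      exact i1
    simp only [e1, e2]
    rw [← Finset.mul_sum, Finset.sum_add_distrib, ← Finset.mul_sum, ← Finset.mul_sum, ← map_sum,
      piola hP H.holo H.dense l hx]
    have e3 : ∑ k, conj (B x k l) * (∑ j, conj (jacM f x j k) * dbar η j (f x)) =
        conj (J x) * dbar η l (f x) := by
      simp only [Finset.mul_sum]
      rw [Finset.sum_comm]
      have e4 : ∀ j, ∑ k, conj (B x k l) * (conj (jacM f x j k) * dbar η j (f x)) =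
          conj (J x * (1 : Matrix (Fin N) (Fin N) ℂ) j l) * dbar η j (f x) := by
        intro j
        have := congrFun (congrFun (Matrix.mul_adjugate (jacM f x)) j) l
        rw [Matrix.mul_apply, Matrix.smul_apply, smul_eq_mul] at this
        rw [hJ, ← this, map_sum, Finset.sum_mul]
        refine Finset.sum_congr rfl fun k _ => ?_
        rw [map_mul]; ring
      simp only [e4]
      rw [Finset.sum_eq_single l]
      · simp
      · intro b _ hb; simp [Matrix.one_apply_ne hb]
      · simp
    rw [e3]
    have e5 : ((‖(jacM f x).det‖ ^ 2 : ℝ) : ℂ) = J x * conj (J x) := by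
      rw [Complex.mul_conj, Complex.normSq_eq_norm_sq]
    rw [e5, map_zero]; ring
  · rw [indicator_of_notMem hx]
    symm
    refine Finset.sum_eq_zero fun k _ => ?_
    have : P.indicator (F k) =ᶠ[𝓝 x] fun _ => 0 := by
      filter_upwards [hC.isClosed.isOpen_compl.mem_nhds (fun h => hx (hCP h))] with y hy
      by_cases hyP : y ∈ P
      · rw [indicator_of_mem hyP]; exact hF0 k y hyP hy
      · exact indicator_of_notMem hyP _
    unfold dbar
    rw [this.fderiv_eq]
    simp

end Part3

section Part4
open MeasureTheory ComplexConjugate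

theorem BrCov.hasFDerivAt_integral {N : ℕ} {P : Set (Fin N → ℂ)} {f : (Fin N → ℂ) → (Fin N → ℂ)}
    (H : BrCov P f) {k : (Fin N → ℂ) → ℂ} (hk : ContinuousOn k P)
    {E : Type*} [NormedAddCommGroup E] [NormedSpace ℝ E] [ProperSpace E]
    {Ψ : E × (Fin N → ℂ) → ℂ} (hΨ : ContDiff ℝ 1 Ψ) {p₀ : E} {r : ℝ} (hr : r < 1)
    (hsupp : ∀ᶠ p in 𝓝 p₀, ∀ u, r < ‖u‖ → Ψ (p, u) = 0) :
    ∃ L : E →L[ℝ] ℂ, HasFDerivAt (fun p => ∫ x in P, k x * Ψ (p, f x)) L p₀ ∧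
      (∀ v, L v = ∫ x in P, k x * fderiv ℝ (fun p => Ψ (p, f x)) p₀ v) ∧
      ∀ v, IntegrableOn (fun x => k x * fderiv ℝ (fun p => Ψ (p, f x)) p₀ v) P := by
  obtain ⟨δ, hδ, hball⟩ := Metric.eventually_nhds_iff_ball.1 hsupp
  set C := {x ∈ P | ‖f x‖ ≤ r} with hCdef
  have hC : IsCompact C := H.proper r hr
  have hCP : C ⊆ P := fun x hx => hx.1
  have hout : ∀ x ∈ P \ C, r < ‖f x‖ := by
    rintro x ⟨hx, hxC⟩
    by_contra hcon; exact hxC ⟨hx, not_lt.1 hcon⟩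
  set A : E × (Fin N → ℂ) → (E →L[ℝ] ℂ) :=
    fun q => (fderiv ℝ Ψ q).comp (ContinuousLinearMap.inl ℝ E (Fin N → ℂ)) with hA
  have hAc : Continuous A := (hΨ.continuous_fderiv (by simp)).clm_comp continuous_const
  have hAd : ∀ p u, HasFDerivAt (fun p => Ψ (p, u)) (A (p, u)) p := by
    intro p u
    have h1 : HasFDerivAt Ψ (fderiv ℝ Ψ (p, u)) (p, u) := (hΨ.differentiable (by simp) _).hasFDerivAt
    have h2 : HasFDerivAt (fun p : E => (p, u)) (ContinuousLinearMap.inl ℝ E (Fin N → ℂ)) p :=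
      hasFDerivAt_prodMk_left p u
    exact h1.comp p h2
  have hfc : ContinuousOn f C := H.holo.continuousOn.mono hCP
  have hkc : ContinuousOn k C := hk.mono hCP
  have hcomp : IsCompact (Metric.closedBall p₀ (δ/2) ×ˢ (f '' C)) :=
    (isCompact_closedBall _ _).prod (hC.image_of_continuousOn hfc)
  obtain ⟨M, hM⟩ := hcomp.exists_bound_of_continuousOn hAc.continuousOn
  obtain ⟨K, hK⟩ := hC.exists_bound_of_continuousOn hkc
  have hcmeas := hC.isClosed.measurableSet
  have hconC : ∀ p, ContinuousOn (fun x => k x * Ψ (p, f x)) C := fun p =>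
    hkc.mul (hΨ.continuous.comp_continuousOn (continuousOn_const.prodMk hfc))
  have hconA : ∀ p, ContinuousOn (fun x => k x • A (p, f x)) C := fun p =>
    hkc.smul (hAc.comp_continuousOn (continuousOn_const.prodMk hfc))
  have main := hasFDerivAt_integral_of_dominated_of_fderiv_le (𝕜 := ℝ) (μ := volume.restrict C)
    (F := fun p x => k x * Ψ (p, f x)) (F' := fun p x => k x • A (p, f x)) (x₀ := p₀)
    (s := Metric.ball p₀ (δ/2)) (bound := fun _ => K * M) (Metric.ball_mem_nhds _ (by positivity))
    (Filter.Eventually.of_forall fun p => (hconC p).aestronglyMeasurable hcmeas)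
    ((hconC p₀).integrableOn_compact hC)
    ((hconA p₀).aestronglyMeasurable hcmeas)
    (by
      refine (ae_restrict_mem hcmeas).mono fun x hx p hp => ?_
      rw [norm_smul]
      have h1 := hK x hx
      have h2 := hM (p, f x) ⟨Metric.ball_subset_closedBall hp, x, hx, rfl⟩
      exact mul_le_mul h1 h2 (norm_nonneg _) ((norm_nonneg _).trans h1))
    (by
      exact (integrableOn_const (μ := volume) (s := C) (C := K * M) hC.measure_lt_top.ne))
    (by
      refine (ae_restrict_mem hcmeas).mono fun x hx p hp => ?_
      exact (hAd p (f x)).const_mul (k x))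
  have hIntg : Integrable (fun x => k x • A (p₀, f x)) (volume.restrict C) :=
    (hconA p₀).integrableOn_compact hC
  have hkA : ∀ v, ∀ x, k x * fderiv ℝ (fun p => Ψ (p, f x)) p₀ v = (k x • A (p₀, f x)) v := by
    intro v x; rw [(hAd p₀ (f x)).fderiv]; rfl
  have hoff : ∀ v, ∀ x ∈ P \ C, k x * fderiv ℝ (fun p => Ψ (p, f x)) p₀ v = 0 := by
    intro v x hx
    have h0 : (fun p => Ψ (p, f x)) =ᶠ[𝓝 p₀] fun _ => 0 := by
      filter_upwards [Metric.ball_mem_nhds p₀ hδ] with p hp using hball p hp _ (hout x hx)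
    rw [h0.fderiv_eq]; simp
  refine ⟨_, main.congr_of_eventuallyEq ?_, ?_, ?_⟩
  · filter_upwards [Metric.ball_mem_nhds p₀ hδ] with p hp
    refine setIntegral_eq_of_subset_of_forall_diff_eq_zero H.isOpen.measurableSet hCP ?_
    intro x hx
    rw [hball p hp _ (hout x hx), mul_zero]
  · intro v
    rw [ContinuousLinearMap.integral_apply hIntg]
    symm
    simp only [← hkA]
    exact setIntegral_eq_of_subset_of_forall_diff_eq_zero H.isOpen.measurableSet hCP (hoff v)
  · intro v
    refine IntegrableOn.of_forall_diff_eq_zero (s := C) ?_ H.isOpen.measurableSet (hoff v)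
    simp only [hkA]
    exact ((ContinuousLinearMap.apply ℝ ℂ v).integrable_comp hIntg)

/-- squared Euclidean norm -/
def sqn {N : ℕ} (v : Fin N → ℂ) : ℝ := ∑ j, Complex.normSq (v j)

theorem sqn_contDiff {N : ℕ} {n : WithTop ℕ∞} : ContDiff ℝ n (sqn (N := N)) := by
  unfold sqn
  simp only [Complex.normSq_apply]
  refine ContDiff.sum fun j _ => ?_
  have h1 : ContDiff ℝ n (fun v : Fin N → ℂ => (v j).re) :=
    (Complex.reCLM.comp (ContinuousLinearMap.proj (R := ℝ) (φ := fun _ : Fin N => ℂ) j)).contDiff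
  have h2 : ContDiff ℝ n (fun v : Fin N → ℂ => (v j).im) :=
    (Complex.imCLM.comp (ContinuousLinearMap.proj (R := ℝ) (φ := fun _ : Fin N => ℂ) j)).contDiff
  exact (h1.mul h1).add (h2.mul h2)

theorem norm_sq_le_sqn {N : ℕ} (v : Fin N → ℂ) : ‖v‖ ^ 2 ≤ sqn v := by
  have h0 : 0 ≤ sqn v := Finset.sum_nonneg fun j _ => Complex.normSq_nonneg _
  have : ‖v‖ ≤ Real.sqrt (sqn v) := by
    refine (pi_norm_le_iff_of_nonneg (Real.sqrt_nonneg _)).2 fun j => ?_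
    refine Real.le_sqrt_of_sq_le ?_
    rw [← Complex.normSq_eq_norm_sq]
    exact Finset.single_le_sum (f := fun j => Complex.normSq (v j)) (fun j _ => Complex.normSq_nonneg _) (Finset.mem_univ j)
  calc ‖v‖^2 ≤ (Real.sqrt (sqn v))^2 := by gcongr
    _ = sqn v := Real.sq_sqrt h0

theorem hasFDerivAt_sqn {N : ℕ} (v z : Fin N → ℂ) :
    fderiv ℝ (sqn (N := N)) v z = ∑ j, (2 * ((v j).re * (z j).re + (v j).im * (z j).im)) := by
  have h : HasFDerivAt (sqn (N := N)) (∑ j, (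
      ((v j).re • (Complex.reCLM.comp (ContinuousLinearMap.proj (R := ℝ) (φ := fun _ : Fin N => ℂ) j)) +
       (v j).re • (Complex.reCLM.comp (ContinuousLinearMap.proj (R := ℝ) (φ := fun _ : Fin N => ℂ) j))) +
      ((v j).im • (Complex.imCLM.comp (ContinuousLinearMap.proj (R := ℝ) (φ := fun _ : Fin N => ℂ) j)) +
       (v j).im • (Complex.imCLM.comp (ContinuousLinearMap.proj (R := ℝ) (φ := fun _ : Fin N => ℂ) j))))) v := by
    unfold sqn
    simp only [Complex.normSq_apply]
    refine HasFDerivAt.fun_sum fun j _ => ?_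
    have h1 : HasFDerivAt (fun v : Fin N → ℂ => (v j).re)
      (Complex.reCLM.comp (ContinuousLinearMap.proj (R := ℝ) (φ := fun _ : Fin N => ℂ) j)) v :=
      (Complex.reCLM.comp (ContinuousLinearMap.proj (R := ℝ) (φ := fun _ : Fin N => ℂ) j)).hasFDerivAt
    have h2 : HasFDerivAt (fun v : Fin N → ℂ => (v j).im)
      (Complex.imCLM.comp (ContinuousLinearMap.proj (R := ℝ) (φ := fun _ : Fin N => ℂ) j)) v :=
      (Complex.imCLM.comp (ContinuousLinearMap.proj (R := ℝ) (φ := fun _ : Fin N => ℂ) j)).hasFDerivAt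
    exact (h1.mul h1).add (h2.mul h2)
  rw [h.fderiv]
  simp only [sum_apply, add_apply, smul_apply, ContinuousLinearMap.comp_apply, ContinuousLinearMap.proj_apply,
    Complex.reCLM_apply, Complex.imCLM_apply, smul_eq_mul]
  refine Finset.sum_congr rfl fun j _ => by ring

/-- smooth cutoff, positive below one and zero above one -/
def bmp (t : ℝ) : ℝ := Real.smoothTransition (1 - t)

theorem bmp_contDiff {n : ℕ∞} : ContDiff ℝ n bmp :=
  Real.smoothTransition.contDiff.comp (contDiff_const.sub contDiff_id)

theorem bmp_zero {t : ℝ} (ht : 1 ≤ t) : bmp t = 0 := Real.smoothTransition.zero_of_nonpos (by linarith)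

/-- the mollifier -/
def moll {N : ℕ} (τ : ℝ) (v : Fin N → ℂ) : ℂ := ((τ ^ N * bmp (τ * sqn v) : ℝ) : ℂ)

theorem moll_zero {N : ℕ} {τ : ℝ} (hτ : 0 < τ) {v : Fin N → ℂ} (hv : 1 ≤ τ * ‖v‖ ^ 2) : moll τ v = 0 := by
  have : 1 ≤ τ * sqn v := hv.trans (by gcongr; exact norm_sq_le_sqn v)
  simp [moll, bmp_zero this]

theorem moll_contDiff {N : ℕ} : ContDiff ℝ 1 (fun q : ℝ × (Fin N → ℂ) => moll q.1 q.2) := by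
  unfold moll
  refine Complex.ofRealCLM.contDiff.comp ?_
  refine (contDiff_fst.pow N).mul ?_
  exact (bmp_contDiff (n := 1)).comp (contDiff_fst.mul (sqn_contDiff.comp contDiff_snd))

/-- mollified trace -/
def trc {N : ℕ} (P : Set (Fin N → ℂ)) (f : (Fin N → ℂ) → (Fin N → ℂ)) (h : (Fin N → ℂ) → ℂ)
    (τ : ℝ) (w : Fin N → ℂ) : ℂ :=
  ∫ x in P, h x * ((‖(jacM f x).det‖ ^ 2 : ℝ) : ℂ) * moll τ (f x - w)

theorem BrCov.continuousOn_weight {N : ℕ} {P : Set (Fin N → ℂ)} {f : (Fin N → ℂ) → (Fin N → ℂ)}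
    (H : BrCov P f) {h : (Fin N → ℂ) → ℂ} (hh : DifferentiableOn ℂ h P) :
    ContinuousOn (fun x => h x * ((‖(jacM f x).det‖ ^ 2 : ℝ) : ℂ)) P := by
  have hJ : ContinuousOn (fun x => (jacM f x).det) P := fun x hx =>
    (differentiableAt_det (jacM_differentiableAt H.isOpen H.holo hx)).continuousAt.continuousWithinAt
  exact hh.continuousOn.mul (Complex.continuous_ofReal.comp_continuousOn (hJ.norm.pow 2))

theorem moll_supp {N : ℕ} {τ : ℝ} (hτ : 0 < τ) {w u : Fin N → ℂ} {s : ℝ} (hs : 0 ≤ s) (hτs : 1 ≤ τ * s ^ 2)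
    (hu : ‖w‖ + s < ‖u‖) : moll τ (u - w) = 0 := by
  refine moll_zero hτ (hτs.trans ?_)
  have : s ≤ ‖u - w‖ := by
    have := norm_sub_norm_le u w
    linarith
  gcongr

/-- real differentiable with derivative commuting with I -/
theorem differentiableAt_of_real {N : ℕ} {F : (Fin N → ℂ) → ℂ} {L : (Fin N → ℂ) →L[ℝ] ℂ} {w : Fin N → ℂ}
    (hF : HasFDerivAt F L w) (hL : ∀ v, L v + Complex.I * L (Complex.I • v) = 0) :
    DifferentiableAt ℂ F w := by
  have hI : ∀ v, L (Complex.I • v) = Complex.I * L v := fun v => by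
    have := hL v
    linear_combination (-Complex.I) * this - L (Complex.I • v) * (-Complex.I_mul_I)
  let L' : (Fin N → ℂ) →ₗ[ℂ] ℂ :=
    { toFun := L
      map_add' := fun x y => map_add L x y
      map_smul' := by
        intro c v
        have : c • v = c.re • v + c.im • (Complex.I • v) := by
          ext i
          simp only [Pi.smul_apply, Pi.add_apply, smul_eq_mul, Complex.real_smul]
          conv_lhs => rw [← Complex.re_add_im c]
          ring
        rw [this, map_add, map_smul, map_smul, hI]
        simp only [Complex.real_smul, RingHom.id_apply, smul_eq_mul]
        conv_rhs => rw [← Complex.re_add_im c]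
        ring }
  let L'' : (Fin N → ℂ) →L[ℂ] ℂ := ⟨L', L.continuous⟩
  exact (hasFDerivAt_of_restrictScalars (𝕜 := ℝ) (f' := L'') hF (by ext v; rfl)).differentiableAt

theorem trc_holo {N : ℕ} {P : Set (Fin N → ℂ)} {f : (Fin N → ℂ) → (Fin N → ℂ)}
    (H : BrCov P f) {h : (Fin N → ℂ) → ℂ} (hh : DifferentiableOn ℂ h P) {τ s : ℝ} (hτ : 0 < τ)
    (hs : 0 ≤ s) (hτs : 1 ≤ τ * s ^ 2) {w : Fin N → ℂ} (hw : ‖w‖ + s < 1) :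
    DifferentiableAt ℂ (trc P f h τ) w := by
  have hk := H.continuousOn_weight hh
  have hm : ContDiff ℝ 1 (moll (N := N) τ) := moll_contDiff.comp (contDiff_const.prodMk contDiff_id)
  set r := (‖w‖ + s + 1) / 2 with hr
  have hr1 : r < 1 := by linarith
  obtain ⟨L, hL, hL2, hL3⟩ := H.hasFDerivAt_integral hk (E := Fin N → ℂ)
    (Ψ := fun q => moll τ (q.2 - q.1)) (hm.comp (contDiff_snd.sub contDiff_fst)) (p₀ := w) hr1
    (by
      have : ∀ᶠ p in 𝓝 w, ‖p‖ + s < r := by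
        refine (continuous_norm.add continuous_const).continuousAt.eventually_lt continuousAt_const ?_
        show ‖w‖ + s < r
        linarith
      filter_upwards [this] with p hp u hu
      exact moll_supp hτ hs hτs (hp.trans hu))
  refine differentiableAt_of_real hL fun v => ?_
  rw [dbar_linear L v]
  refine Finset.sum_eq_zero fun j _ => ?_
  have hd : ∀ u z, fderiv ℝ (fun p => moll τ (u - p)) w z = - fderiv ℝ (fun y => moll τ (y - w)) u z := by
    intro u z
    have h1 : HasFDerivAt (moll τ) (fderiv ℝ (moll τ) (u - w)) (u - w) :=
      (hm.differentiable (by simp) _).hasFDerivAt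
    have h2 := HasFDerivAt.comp (g := moll τ) w h1 ((hasFDerivAt_id w).const_sub u)
    have h3 := HasFDerivAt.comp (g := moll τ) u h1 ((hasFDerivAt_id u).sub_const w)
    have h2' : fderiv ℝ (fun p => moll τ (u - p)) w = _ := h2.fderiv
    have h3' : fderiv ℝ (fun y => moll τ (y - w)) u = _ := h3.fderiv
    rw [h2', h3']
    simp
  have hz := H.integral_dbar hh (η := fun y => moll τ (y - w)) (hm.comp (contDiff_id.sub contDiff_const)) (r := ‖w‖ + s)
    hw (fun u hu => moll_supp hτ hs hτs hu) j
  -- integrability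
  have key : L (Pi.single j 1) + Complex.I * L (Pi.single j Complex.I) = 0 := by
    rw [hL2, hL2, ← integral_const_mul, ← integral_add, ← neg_eq_zero, ← integral_neg]
    · rw [← hz]
      congr 1
      funext x
      simp only [hd]
      unfold dbar
      ring
    · exact hL3 _
    · exact (hL3 _).const_mul _
  rw [key, mul_zero]

end Part4

section Part5
open MeasureTheory ComplexConjugate

theorem moll_deriv_tau {N : ℕ} (τ : ℝ) (v : Fin N → ℂ) :
    HasDerivAt (fun τ : ℝ => moll τ v)
      ((N * τ ^ (N - 1) * bmp (τ * sqn v) + τ ^ N * (deriv bmp (τ * sqn v) * sqn v) : ℝ) : ℂ) τ := by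
  have hb : HasDerivAt bmp (deriv bmp (τ * sqn v)) (τ * sqn v) :=
    ((bmp_contDiff (n := 1)).differentiable (by simp) _).hasDerivAt
  have h1 : HasDerivAt (fun τ : ℝ => τ * sqn v) (sqn v) τ := by
    simpa using (hasDerivAt_id τ).mul_const (sqn v)
  have h2 := (hasDerivAt_pow N τ).mul (HasDerivAt.comp τ hb h1)
  exact h2.ofReal_comp

theorem dbar_bmp {N : ℕ} (τ : ℝ) (w u : Fin N → ℂ) (j : Fin N) :
    dbar (fun y => ((bmp (τ * sqn (y - w)) : ℝ) : ℂ)) j u =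
      2 * (τ * deriv bmp (τ * sqn (u - w)) : ℝ) * (u j - w j) := by
  have hb : HasDerivAt bmp (deriv bmp (τ * sqn (u - w))) (τ * sqn (u - w)) :=
    ((bmp_contDiff (n := 1)).differentiable (by simp) _).hasDerivAt
  have h1 : HasFDerivAt (sqn (N := N)) (fderiv ℝ sqn (u - w)) (u - w) :=
    ((sqn_contDiff (n := 1)).differentiable (by simp) _).hasFDerivAt
  have h2 : HasFDerivAt (fun y => sqn (y - w)) (fderiv ℝ sqn (u - w)) u := by
    have := HasFDerivAt.comp (g := sqn) u h1 ((hasFDerivAt_id u).sub_const w)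
    rw [ContinuousLinearMap.comp_id] at this
    exact this
  have h3 := hb.comp_hasFDerivAt u (h2.const_mul τ)
  have h4 : HasFDerivAt (fun y => ((bmp (τ * sqn (y - w)) : ℝ) : ℂ)) _ u :=
    Complex.ofRealCLM.hasFDerivAt.comp u h3
  unfold dbar
  rw [h4.fderiv]
  simp only [ContinuousLinearMap.comp_apply, smul_apply, smul_eq_mul, Complex.ofRealCLM_apply, hasFDerivAt_sqn]
  rw [Finset.sum_eq_single j, Finset.sum_eq_single j]
  · simp only [Pi.single_eq_same, Complex.one_re, Complex.one_im, Complex.I_re, Complex.I_im, mul_one, mul_zero,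
      add_zero, zero_add, Pi.sub_apply]
    conv_rhs => rw [← Complex.re_add_im (u j - w j)]
    push_cast
    ring
  · intro b _ hb; simp [Pi.single_apply, hb]
  · simp
  · intro b _ hb; simp [Pi.single_apply, hb]
  · simp

theorem dbar_eta {N : ℕ} (τ : ℝ) (w u : Fin N → ℂ) :
    ∑ j, dbar (fun y => conj (y j - w j) * ((bmp (τ * sqn (y - w)) : ℝ) : ℂ)) j u =
      ((2 * N * bmp (τ * sqn (u - w)) + 2 * τ * sqn (u - w) * deriv bmp (τ * sqn (u - w)) : ℝ) : ℂ) := by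
  have hd : DifferentiableAt ℝ (fun y => ((bmp (τ * sqn (y - w)) : ℝ) : ℂ)) u := by
    have : ContDiff ℝ 1 (fun y => ((bmp (τ * sqn (y - w)) : ℝ) : ℂ)) :=
      Complex.ofRealCLM.contDiff.comp ((bmp_contDiff (n := 1)).comp
        (contDiff_const.mul (sqn_contDiff.comp (contDiff_id.sub contDiff_const))))
    exact this.differentiable (by simp) u
  have h1 : ∀ j, dbar (fun y => conj (y j - w j) * ((bmp (τ * sqn (y - w)) : ℝ) : ℂ)) j u =
      ((2 * τ * deriv bmp (τ * sqn (u - w)) * Complex.normSq (u j - w j)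
        + 2 * bmp (τ * sqn (u - w)) : ℝ) : ℂ) := by
    intro j
    have ha : HasFDerivAt (fun y : Fin N → ℂ => y j - w j)
        (ContinuousLinearMap.proj (R := ℂ) (φ := fun _ : Fin N => ℂ) j) u :=
      (ContinuousLinearMap.proj (R := ℂ) (φ := fun _ : Fin N => ℂ) j).hasFDerivAt.sub_const _
    rw [dbar_conj_mul (a := fun y => y j - w j) ha.differentiableAt hd, dbar_bmp, ha.fderiv]
    simp only [ContinuousLinearMap.proj_apply, Pi.single_eq_same, map_one]
    push_cast
    rw [Complex.normSq_eq_conj_mul_self]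
    ring
  simp only [h1]
  rw [← Complex.ofReal_sum]
  congr 1
  rw [Finset.sum_add_distrib, ← Finset.mul_sum]
  simp only [sqn, Pi.sub_apply, Finset.sum_const, Finset.card_univ, Fintype.card_fin, nsmul_eq_mul]
  ring

theorem trc_deriv_tau {N : ℕ} {P : Set (Fin N → ℂ)} {f : (Fin N → ℂ) → (Fin N → ℂ)}
    (H : BrCov P f) {h : (Fin N → ℂ) → ℂ} (hh : DifferentiableOn ℂ h P) {τ s : ℝ} (hτ : 0 < τ)
    (hs : 0 ≤ s) (hτs : 1 < τ * s ^ 2) {w : Fin N → ℂ} (hw : ‖w‖ + s < 1) :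
    HasDerivAt (fun τ => trc P f h τ w) 0 τ := by
  have hk := H.continuousOn_weight hh
  obtain ⟨L, hL, hL2, hL3⟩ := H.hasFDerivAt_integral hk (E := ℝ)
    (Ψ := fun q => moll q.1 (q.2 - w)) (moll_contDiff.comp (contDiff_fst.prodMk (contDiff_snd.sub contDiff_const)))
    (p₀ := τ) hw
    (by
      have h1 : ∀ᶠ p in 𝓝 τ, 1 < p * s ^ 2 := by
        refine continuousAt_const.eventually_lt (continuous_id.mul continuous_const).continuousAt ?_
        exact hτs
      filter_upwards [h1, lt_mem_nhds hτ] with p hp hp0 u hu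
      exact moll_supp hp0 hs hp.le hu)
  have hη : ∀ j : Fin N, ContDiff ℝ 1 (fun y : Fin N → ℂ => conj (y j - w j) * ((bmp (τ * sqn (y - w)) : ℝ) : ℂ)) := by
    intro j
    have h1 : ContDiff ℝ 1 (fun y : Fin N → ℂ => ((bmp (τ * sqn (y - w)) : ℝ) : ℂ)) :=
      Complex.ofRealCLM.contDiff.comp ((bmp_contDiff (n := 1)).comp
        (contDiff_const.mul (sqn_contDiff.comp (contDiff_id.sub contDiff_const))))
    have h2 : ContDiff ℝ 1 (fun y : Fin N → ℂ => y j - w j) :=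
      (ContinuousLinearMap.proj (R := ℝ) (φ := fun _ : Fin N => ℂ) j).contDiff.sub contDiff_const
    exact ((Complex.conjCLE : ℂ →L[ℝ] ℂ).contDiff.comp h2).mul h1
  have hη0 : ∀ j : Fin N, ∀ u, ‖w‖ + s < ‖u‖ → conj (u j - w j) * ((bmp (τ * sqn (u - w)) : ℝ) : ℂ) = 0 := by
    intro j u hu
    have h1 := moll_supp hτ hs hτs.le hu
    unfold moll at h1
    have h2 : τ ^ N * bmp (τ * sqn (u - w)) = 0 := by exact_mod_cast h1
    rcases mul_eq_zero.1 h2 with h3 | h3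
    · exact absurd h3 (pow_pos hτ N).ne'
    · rw [h3]; simp
  have hL1 : L 1 = 0 := by
    have hz : ∀ j, ∫ x in P, h x * ((‖(jacM f x).det‖ ^ 2 : ℝ) : ℂ) *
        dbar (fun y => conj (y j - w j) * ((bmp (τ * sqn (y - w)) : ℝ) : ℂ)) j (f x) = 0 :=
      fun j => H.integral_dbar hh (hη j) hw (hη0 j) j
    have hi : ∀ j, IntegrableOn (fun x => h x * ((‖(jacM f x).det‖ ^ 2 : ℝ) : ℂ) *
        dbar (fun y => conj (y j - w j) * ((bmp (τ * sqn (y - w)) : ℝ) : ℂ)) j (f x)) P := by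
      intro j
      refine IntegrableOn.of_forall_diff_eq_zero (s := {x ∈ P | ‖f x‖ ≤ ‖w‖ + s}) ?_ H.isOpen.measurableSet ?_
      · refine ContinuousOn.integrableOn_compact (H.proper _ hw) ?_
        refine (hk.mono fun x hx => hx.1).mul ?_
        have hc : Continuous (dbar (fun y => conj (y j - w j) * ((bmp (τ * sqn (y - w)) : ℝ) : ℂ)) j) := by
          unfold dbar
          have := (hη j).continuous_fderiv (by simp)
          exact (this.clm_apply continuous_const).add (continuous_const.mul (this.clm_apply continuous_const))
        exact hc.comp_continuousOn (H.holo.continuousOn.mono fun x hx => hx.1)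
      · rintro x ⟨hx, hx2⟩
        have hlt : ‖w‖ + s < ‖f x‖ := by
          by_contra hcon; exact hx2 ⟨hx, not_lt.1 hcon⟩
        have h0 : (fun y => conj (y j - w j) * ((bmp (τ * sqn (y - w)) : ℝ) : ℂ)) =ᶠ[𝓝 (f x)] fun _ => 0 := by
          filter_upwards [(isOpen_lt continuous_const continuous_norm).mem_nhds hlt] with y hy
          exact hη0 j y hy
        unfold dbar
        rw [h0.fderiv_eq]; simp
    rw [hL2]
    have : ∀ x, h x * ((‖(jacM f x).det‖ ^ 2 : ℝ) : ℂ) * fderiv ℝ (fun p => moll p (f x - w)) τ 1 =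
        ((τ ^ N / (2 * τ) : ℝ) : ℂ) * ∑ j, h x * ((‖(jacM f x).det‖ ^ 2 : ℝ) : ℂ) *
        dbar (fun y => conj (y j - w j) * ((bmp (τ * sqn (y - w)) : ℝ) : ℂ)) j (f x) := by
      intro x
      rw [← Finset.mul_sum, dbar_eta]
      have h1 := (moll_deriv_tau τ (f x - w)).hasFDerivAt.fderiv
      rw [h1]
      simp only [ContinuousLinearMap.toSpanSingleton_apply, one_smul]
      have h2 : (N : ℝ) * τ ^ (N - 1) = N * τ ^ N / τ := by
        rcases Nat.eq_zero_or_pos N with h0 | h0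
        · simp [h0]
        · rw [eq_div_iff hτ.ne', mul_assoc, ← pow_succ, Nat.sub_add_cancel h0]
      have hreal : ∀ A B C : ℝ, (N : ℝ) * τ ^ (N - 1) * A + τ ^ N * (B * C) =
          τ ^ N / (2 * τ) * (2 * N * A + 2 * τ * C * B) := by
        intro A B C
        rw [h2]
        field_simp
      rw [hreal, Complex.ofReal_mul]
      ring
    simp only [this]
    rw [integral_const_mul, integral_finsetSum _ (fun j _ => hi j)]
    rw [Finset.sum_eq_zero (fun j _ => hz j), mul_zero]
  have h1 := hL.hasDerivAt
  rw [hL1] at h1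
  exact h1

theorem trc_const {N : ℕ} {P : Set (Fin N → ℂ)} {f : (Fin N → ℂ) → (Fin N → ℂ)}
    (H : BrCov P f) {h : (Fin N → ℂ) → ℂ} (hh : DifferentiableOn ℂ h P) {τ τ' s : ℝ} (hs : 0 < s)
    (hτs : 1 < τ * s ^ 2) (hτs' : 1 < τ' * s ^ 2) {w : Fin N → ℂ} (hw : ‖w‖ + s < 1) :
    trc P f h τ w = trc P f h τ' w := by
  have hmem : ∀ t, 1 < t * s ^ 2 ↔ t ∈ Ioi (1 / s ^ 2) := fun t => by
    rw [mem_Ioi, div_lt_iff₀ (by positivity)]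
  have hd : ∀ t ∈ Ioi (1 / s ^ 2), HasDerivAt (fun τ => trc P f h τ w) 0 t := by
    intro t ht
    have h0 : 0 < t := lt_trans (by positivity) ht
    exact trc_deriv_tau H hh h0 hs.le ((hmem t).2 ht) hw
  exact isOpen_Ioi.is_const_of_deriv_eq_zero isPreconnected_Ioi
    (fun t ht => (hd t ht).differentiableAt.differentiableWithinAt) (fun t ht => (hd t ht).deriv)
    ((hmem τ).1 hτs) ((hmem τ').1 hτs')

end Part5

section Part6
open MeasureTheory ComplexConjugate

/-- real mollifier -/
def mollr {N : ℕ} (τ : ℝ) (v : Fin N → ℂ) : ℝ := τ ^ N * bmp (τ * sqn v)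

theorem moll_eq {N : ℕ} (τ : ℝ) (v : Fin N → ℂ) : moll τ v = (mollr τ v : ℂ) := rfl

theorem bmp_nonneg (t : ℝ) : 0 ≤ bmp t := Real.smoothTransition.nonneg _

theorem mollr_nonneg {N : ℕ} {τ : ℝ} (hτ : 0 < τ) (v : Fin N → ℂ) : 0 ≤ mollr τ v :=
  mul_nonneg (pow_pos hτ N).le (bmp_nonneg _)

theorem mollr_continuous {N : ℕ} (τ : ℝ) : Continuous (mollr (N := N) τ) := by
  unfold mollr
  exact continuous_const.mul ((bmp_contDiff (n := 0)).continuous.comp (continuous_const.mul (sqn_contDiff (n := 0)).continuous))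

theorem mollr_zero {N : ℕ} {τ : ℝ} (hτ : 0 < τ) {v : Fin N → ℂ} (hv : 1 ≤ τ * ‖v‖ ^ 2) : mollr τ v = 0 := by
  have := moll_zero hτ hv
  rw [moll_eq] at this
  exact_mod_cast this

theorem mollr_compact {N : ℕ} {τ : ℝ} (hτ : 0 < τ) : HasCompactSupport (mollr (N := N) τ) := by
  refine HasCompactSupport.intro (isCompact_closedBall (0 : Fin N → ℂ) (1 / τ + 1)) fun v hv => mollr_zero hτ ?_
  rw [mem_closedBall_zero_iff, not_le] at hv
  have h1 : 1 ≤ τ * ‖v‖ := by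
    have : τ * (1 / τ) ≤ τ * ‖v‖ := by gcongr; linarith
    rwa [mul_one_div_cancel hτ.ne'] at this
  have h2 : 1 ≤ ‖v‖ := by
    have : 0 < 1 / τ := by positivity
    linarith
  calc 1 ≤ τ * ‖v‖ * 1 := by linarith
    _ ≤ τ * ‖v‖ * ‖v‖ := by gcongr
    _ = _ := by ring

def kap (N : ℕ) : ℝ := ∫ v : Fin N → ℂ, mollr 1 v

theorem kap_pos (N : ℕ) : 0 < kap N := by
  refine (mollr_continuous 1).integral_pos_of_hasCompactSupport_nonneg_nonzero (mollr_compact one_pos)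
    (fun v => mollr_nonneg one_pos v) (x := 0) ?_
  simp [mollr, sqn, bmp, Real.smoothTransition.one]

theorem integral_mollr {N : ℕ} {τ : ℝ} (hτ : 0 < τ) : ∫ v : Fin N → ℂ, mollr τ v = kap N := by
  have h1 : ∀ v : Fin N → ℂ, mollr τ v = τ ^ N * mollr 1 (Real.sqrt τ • v) := by
    intro v
    have h2 : sqn (Real.sqrt τ • v) = τ * sqn v := by
      unfold sqn
      rw [Finset.mul_sum]
      refine Finset.sum_congr rfl fun j _ => ?_
      rw [Pi.smul_apply, Complex.real_smul, Complex.normSq_mul, Complex.normSq_ofReal, Real.mul_self_sqrt hτ.le]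
    unfold mollr
    rw [h2]; simp
  simp only [h1]
  rw [integral_const_mul, Measure.integral_comp_smul]
  have h3 : Module.finrank ℝ (Fin N → ℂ) = 2 * N := by simp [Module.finrank_pi_fintype, mul_comm]
  rw [h3, pow_mul, Real.sq_sqrt hτ.le, abs_of_pos (by positivity), smul_eq_mul, ← mul_assoc,
    mul_inv_cancel₀ (by positivity), one_mul]
  rfl

theorem integral_mollr_ball {N : ℕ} {τ ε : ℝ} (hτ : 0 < τ) (hε : 0 < ε) (h : 1 ≤ τ * ε ^ 2) (w : Fin N → ℂ) :
    ∫ u in Metric.ball w ε, mollr τ (u - w) = kap N := by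
  rw [setIntegral_eq_integral_of_forall_compl_eq_zero]
  · rw [integral_sub_right_eq_self (mollr τ) w, integral_mollr hτ]
  · intro u hu
    refine mollr_zero hτ (h.trans ?_)
    rw [Metric.mem_ball, dist_eq_norm, not_lt] at hu
    gcongr

theorem det_real_eq {N : ℕ} (f : (Fin N → ℂ) → (Fin N → ℂ)) (x : Fin N → ℂ) :
    ((fderiv ℂ f x).restrictScalars ℝ).det = ‖(jacM f x).det‖ ^ 2 := by
  have h1 : ((fderiv ℂ f x).restrictScalars ℝ).det = LinearMap.det ((fderiv ℂ f x : (Fin N → ℂ) →ₗ[ℂ] (Fin N → ℂ)).restrictScalars ℝ) := rfl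
  rw [h1, LinearMap.det_restrictScalars, Algebra.norm_complex_apply, ← Complex.normSq_eq_norm_sq]
  congr 1
  rw [← LinearMap.det_toMatrix']
  congr 1

theorem det_complex_eq {N : ℕ} (f : (Fin N → ℂ) → (Fin N → ℂ)) (x : Fin N → ℂ) :
    (fderiv ℂ f x).det = (jacM f x).det := by
  have h1 : (fderiv ℂ f x).det = LinearMap.det (fderiv ℂ f x : (Fin N → ℂ) →ₗ[ℂ] (Fin N → ℂ)) := rfl
  rw [h1, ← LinearMap.det_toMatrix']
  congr 1

/-- change of variables -/
theorem change_var {N : ℕ} {U : Set (Fin N → ℂ)} {f : (Fin N → ℂ) → (Fin N → ℂ)} (hU : IsOpen U)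
    (hf : DifferentiableOn ℂ f U) (hinj : InjOn f U) {w : Fin N → ℂ} {τ ε : ℝ} (hτ : 0 < τ) (hε : 0 < ε)
    (h : 1 ≤ τ * ε ^ 2) (hb : Metric.ball w ε ⊆ f '' U) :
    ∫ x in U ∩ f ⁻¹' Metric.ball w ε, ‖(jacM f x).det‖ ^ 2 * mollr τ (f x - w) = kap N := by
  have hs : IsOpen (U ∩ f ⁻¹' Metric.ball w ε) := hf.continuousOn.isOpen_inter_preimage hU Metric.isOpen_ball
  have h1 := integral_image_eq_integral_abs_det_fderiv_smul (F := ℝ) (volume) hs.measurableSet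
    (f := f) (f' := fun x => (fderiv ℂ f x).restrictScalars ℝ)
    (fun x hx => (((hf x hx.1).differentiableAt (hU.mem_nhds hx.1)).hasFDerivAt.restrictScalars ℝ).hasFDerivWithinAt)
    (hinj.mono inter_subset_left) (fun u => mollr τ (u - w))
  have h2 : f '' (U ∩ f ⁻¹' Metric.ball w ε) = Metric.ball w ε := by
    rw [image_inter_preimage, inter_eq_right.2 hb]
  rw [h2, integral_mollr_ball hτ hε h] at h1
  rw [h1]
  refine setIntegral_congr_fun hs.measurableSet fun x _ => ?_
  simp only [det_real_eq, smul_eq_mul]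
  rw [abs_of_nonneg (by positivity)]

theorem local_inv {N : ℕ} {P : Set (Fin N → ℂ)} {f : (Fin N → ℂ) → (Fin N → ℂ)} (hP : IsOpen P)
    (hf : DifferentiableOn ℂ f P) {x : Fin N → ℂ} (hx : x ∈ P) (hdet : (jacM f x).det ≠ 0) :
    ∃ U, IsOpen U ∧ x ∈ U ∧ U ⊆ P ∧ InjOn f U ∧ Filter.map f (𝓝 x) = 𝓝 (f x) := by
  have hc : ContDiffAt ℂ 1 f x := ((contDiffOn_holo hP hf 1) x hx).contDiffAt (hP.mem_nhds hx)
  have hd : (fderiv ℂ f x).det ≠ 0 := by rwa [det_complex_eq]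
  have hs : HasStrictFDerivAt f (((fderiv ℂ f x).toContinuousLinearEquivOfDetNeZero hd : (Fin N → ℂ) ≃L[ℂ] (Fin N → ℂ)) :
      (Fin N → ℂ) →L[ℂ] (Fin N → ℂ)) x := by
    have := hc.hasStrictFDerivAt (by simp)
    exact this
  have h1 := hs.eventually_left_inverse
  obtain ⟨U, hU, hUo, hxU⟩ := mem_nhds_iff.1 (Filter.inter_mem h1 (hP.mem_nhds hx))
  refine ⟨U, hUo, hxU, fun y hy => (hU hy).2, ?_, hs.map_nhds_eq_of_equiv⟩
  intro a ha b hb hab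
  have h2 := (hU ha).1
  have h3 := (hU hb).1
  simp only [mem_setOf_eq] at h2 h3
  rw [← h2, hab, h3]

def RegVal {N : ℕ} (P : Set (Fin N → ℂ)) (f : (Fin N → ℂ) → (Fin N → ℂ)) (w : Fin N → ℂ) : Prop :=
  ‖w‖ < 1 ∧ ∀ x ∈ P, f x = w → (jacM f x).det ≠ 0

theorem BrCov.fib_finite {N : ℕ} {P : Set (Fin N → ℂ)} {f : (Fin N → ℂ) → (Fin N → ℂ)}
    (H : BrCov P f) {w : Fin N → ℂ} (hw : RegVal P f w) : {x ∈ P | f x = w}.Finite := by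
  have hcpt : IsCompact {x ∈ P | f x = w} := by
    have h1 := H.proper ‖w‖ hw.1
    have h2 : ContinuousOn f {x | x ∈ P ∧ ‖f x‖ ≤ ‖w‖} := H.holo.continuousOn.mono fun x hx => hx.1
    have h3 := h2.preimage_isClosed_of_isClosed h1.isClosed (isClosed_singleton (x := w))
    refine h1.of_isClosed_subset (t := {x ∈ P | f x = w}) ?_ fun x hx => ⟨hx.1, by rw [hx.2]⟩
    convert h3 using 1
    ext x
    constructor
    · rintro ⟨h, h'⟩; exact ⟨⟨h, by rw [h']⟩, h'⟩
    · rintro ⟨h, h'⟩; exact ⟨h.1, h'⟩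
  refine hcpt.finite (isDiscrete_iff_discreteTopology.2 ?_)
  rw [discreteTopology_subtype_iff]
  rintro x ⟨hx, hxw⟩
  obtain ⟨U, hUo, hxU, hUP, hinj, -⟩ := local_inv H.isOpen H.holo hx (hw.2 x hx hxw)
  rw [← disjoint_iff, Filter.disjoint_principal_right]
  refine mem_nhdsWithin.2 ⟨U, hUo, hxU, ?_⟩
  rintro y ⟨hy, hyx⟩ ⟨hyP, hyw⟩
  exact hyx (hinj hy hxU (hyw.trans hxw.symm))

theorem BrCov.shrink {N : ℕ} {P : Set (Fin N → ℂ)} {f : (Fin N → ℂ) → (Fin N → ℂ)}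
    (H : BrCov P f) {w : Fin N → ℂ} (hw : ‖w‖ < 1) {W : Set (Fin N → ℂ)} (hW : IsOpen W)
    (hsub : {x ∈ P | f x = w} ⊆ W) : ∃ ε > 0, P ∩ f ⁻¹' Metric.ball w ε ⊆ W := by
  set r := (‖w‖ + 1) / 2 with hr
  have hr1 : r < 1 := by linarith
  have hC : IsCompact ({x | x ∈ P ∧ ‖f x‖ ≤ r} \ W) := (H.proper r hr1).diff hW
  have hfC : IsCompact (f '' ({x | x ∈ P ∧ ‖f x‖ ≤ r} \ W)) :=
    hC.image_of_continuousOn (H.holo.continuousOn.mono fun x hx => hx.1.1)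
  have hnw : w ∈ (f '' ({x | x ∈ P ∧ ‖f x‖ ≤ r} \ W))ᶜ := by
    rintro ⟨x, ⟨hx, hxW⟩, rfl⟩
    exact hxW (hsub ⟨hx.1, rfl⟩)
  obtain ⟨ε, hε, hball⟩ := Metric.isOpen_iff.1 hfC.isClosed.isOpen_compl w hnw
  refine ⟨min ε (r - ‖w‖), lt_min hε (by linarith), ?_⟩
  rintro x ⟨hx, hxw⟩
  by_contra hcon
  rw [mem_preimage, Metric.mem_ball] at hxw
  refine hball (lt_of_lt_of_le hxw (min_le_left _ _)) ⟨x, ⟨⟨hx, ?_⟩, hcon⟩, rfl⟩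
  have h1 := lt_of_lt_of_le hxw (min_le_right _ _)
  rw [dist_eq_norm] at h1
  have := norm_sub_norm_le (f x) w
  linarith

end Part6

section Part7
open MeasureTheory ComplexConjugate

theorem BrCov.trc_regular {N : ℕ} {P : Set (Fin N → ℂ)} {f : (Fin N → ℂ) → (Fin N → ℂ)}
    (H : BrCov P f) {h : (Fin N → ℂ) → ℂ} (hh : DifferentiableOn ℂ h P) {w : Fin N → ℂ} (hw : RegVal P f w)
    {τ s : ℝ} (hs : 0 < s) (hτs : 1 < τ * s ^ 2) (hws : ‖w‖ + s < 1) :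
    trc P f h τ w = kap N * ∑ x ∈ (H.fib_finite hw).toFinset, h x := by
  set F := (H.fib_finite hw).toFinset with hF
  have hmem : ∀ x, x ∈ F ↔ x ∈ P ∧ f x = w := fun x => by simp [hF]
  suffices key : ∀ δ > 0, ‖trc P f h τ w - kap N * ∑ x ∈ F, h x‖ ≤ δ * (F.card * kap N) by
    rw [← sub_eq_zero, ← norm_eq_zero]
    refine le_antisymm (le_of_forall_pos_le_add fun e he => ?_) (norm_nonneg _)
    have hk : 0 ≤ F.card * kap N := mul_nonneg (Nat.cast_nonneg _) (kap_pos N).le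
    have h1 := key (e / (F.card * kap N + 1)) (by positivity)
    refine h1.trans ?_
    rw [zero_add, div_mul_eq_mul_div, div_le_iff₀ (by positivity)]
    nlinarith
  intro δ hδ
  obtain ⟨D, hD, hDd⟩ := (H.fib_finite hw).t2_separation
  have hU : ∀ x ∈ F, ∃ U, IsOpen U ∧ x ∈ U ∧ U ⊆ P ∧ InjOn f U ∧ Filter.map f (𝓝 x) = 𝓝 w ∧ U ⊆ D x ∧
      ∀ y ∈ U, ‖h y - h x‖ ≤ δ := by
    intro x hx
    obtain ⟨hxP, hxw⟩ := (hmem x).1 hx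
    obtain ⟨U, hUo, hxU, hUP, hinj, hmap⟩ := local_inv H.isOpen H.holo hxP (hw.2 x hxP hxw)
    have hc : ContinuousAt h x := ((hh x hxP).differentiableAt (H.isOpen.mem_nhds hxP)).continuousAt
    have h1 : ∀ᶠ y in 𝓝 x, ‖h y - h x‖ < δ := by
      have := Metric.continuousAt_iff'.1 hc δ hδ
      simpa [dist_eq_norm] using this
    obtain ⟨O, hO, hOo, hxO⟩ := eventually_nhds_iff.1 h1
    refine ⟨U ∩ D x ∩ O, (hUo.inter (hD x).2).inter hOo, ⟨⟨hxU, (hD x).1⟩, hxO⟩, fun y hy => hUP hy.1.1,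
      hinj.mono fun y hy => hy.1.1, by rw [hmap, hxw], fun y hy => hy.1.2, fun y hy => (hO y hy.2).le⟩
  choose! U hUo hxU hUP hinj hmap hUD hUh using hU
  obtain ⟨ε₁, hε₁, hsub⟩ := H.shrink hw.1 (W := ⋃ x ∈ F, U x) (isOpen_biUnion fun x hx => hUo x hx) (by
    intro x hx
    exact mem_biUnion ((hmem x).2 hx) (hxU x ((hmem x).2 hx)))
  have hball : ∀ x ∈ F, ∃ e > 0, Metric.ball w e ⊆ f '' U x := by
    intro x hx
    have h1 : f '' U x ∈ 𝓝 w := by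
      rw [← hmap x hx]; exact Filter.image_mem_map ((hUo x hx).mem_nhds (hxU x hx))
    exact Metric.mem_nhds_iff.1 h1
  choose! e he hebl using hball
  obtain ⟨ε, hε, hεε, hεe⟩ : ∃ ε > 0, ε ≤ ε₁ ∧ ∀ x ∈ F, ε ≤ e x := by
    have h1 : ∀ᶠ t in 𝓝[>] (0:ℝ), ∀ x ∈ F, t ≤ e x := by
      rw [Filter.eventually_all_finset]
      intro x hx
      exact nhdsWithin_le_nhds (ge_mem_nhds (he x hx))
    have h2 : ∀ᶠ t in 𝓝[>] (0:ℝ), t ≤ ε₁ := nhdsWithin_le_nhds (ge_mem_nhds hε₁)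
    obtain ⟨t, ⟨h1, h2⟩, h3⟩ := ((h1.and h2).and self_mem_nhdsWithin).exists
    exact ⟨t, h3, h2, h1⟩
  set τ' := 1 / ε ^ 2 + 1 / s ^ 2 + 1 with hτ'
  have hτ0 : 0 < τ' := by positivity
  have hτε : 1 ≤ τ' * ε ^ 2 := by
    have : τ' * ε ^ 2 = 1 + (1 / s ^ 2 + 1) * ε ^ 2 := by rw [hτ']; field_simp; ring
    rw [this]; have : 0 ≤ (1 / s ^ 2 + 1) * ε ^ 2 := by positivity
    linarith
  have hτs' : 1 < τ' * s ^ 2 := by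
    have : τ' * s ^ 2 = 1 + (1 / ε ^ 2 + 1) * s ^ 2 := by rw [hτ']; field_simp; ring
    rw [this]; have : 0 < (1 / ε ^ 2 + 1) * s ^ 2 := by positivity
    linarith
  rw [trc_const H hh hs hτs hτs' hws]
  set T := fun x => U x ∩ f ⁻¹' Metric.ball w ε with hT
  have hTo : ∀ x ∈ F, IsOpen (T x) := fun x hx =>
    (H.holo.continuousOn.mono (hUP x hx)).isOpen_inter_preimage (hUo x hx) Metric.isOpen_ball
  have hcv : ∀ x ∈ F, ∫ y in T x, ‖(jacM f y).det‖ ^ 2 * mollr τ' (f y - w) = kap N := fun x hx =>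
    change_var (hUo x hx) (H.holo.mono (hUP x hx)) (hinj x hx) hτ0 hε hτε
      ((Metric.ball_subset_ball (hεe x hx)).trans (hebl x hx))
  set k : (Fin N → ℂ) → ℂ := fun y => h y * ((‖(jacM f y).det‖ ^ 2 : ℝ) : ℂ) * moll τ' (f y - w) with hk
  have hvan : ∀ y, ¬ (f y ∈ Metric.ball w ε) → mollr τ' (f y - w) = 0 := by
    intro y hy
    rw [Metric.mem_ball, dist_eq_norm, not_lt] at hy
    exact mollr_zero hτ0 (hτε.trans (by gcongr))
  have hTP : (⋃ x ∈ F, T x) ⊆ P := iUnion₂_subset fun x hx y hy => hUP x hx hy.1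
  -- integrability on P of continuous weight times mollifier
  have hIntg : ∀ q : (Fin N → ℂ) → ℂ, ContinuousOn q P →
      IntegrableOn (fun y => q y * moll τ' (f y - w)) P := by
    intro q hq
    refine IntegrableOn.of_forall_diff_eq_zero (s := {x ∈ P | ‖f x‖ ≤ ‖w‖ + s}) ?_ H.isOpen.measurableSet ?_
    · refine ContinuousOn.integrableOn_compact (H.proper _ hws) ?_
      refine (hq.mono fun x hx => hx.1).mul ?_
      have hm : Continuous (moll (N := N) τ') := Complex.continuous_ofReal.comp (mollr_continuous τ')
      exact hm.comp_continuousOn ((H.holo.continuousOn.mono fun x hx => hx.1).sub continuousOn_const)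
    · rintro x ⟨hx, hx2⟩
      have hlt : ‖w‖ + s < ‖f x‖ := by
        by_contra hcon; exact hx2 ⟨hx, not_lt.1 hcon⟩
      rw [moll_supp hτ0 hs.le hτs'.le hlt, mul_zero]
  have hkP : IntegrableOn k P := hIntg _ (H.continuousOn_weight hh)
  have h1P : IntegrableOn (fun y => ‖(jacM f y).det‖ ^ 2 * mollr τ' (f y - w)) P := by
    have := (hIntg _ (H.continuousOn_weight (differentiableOn_const (c := (1:ℂ))))).norm
    refine this.congr ?_
    refine Filter.Eventually.of_forall fun y => ?_
    simp only [one_mul, norm_mul, moll_eq, Complex.norm_real, Real.norm_eq_abs]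
    rw [abs_of_nonneg (mollr_nonneg hτ0 _), abs_of_nonneg (by positivity)]
  have e1 : trc P f h τ' w = ∑ x ∈ F, ∫ y in T x, k y := by
    unfold trc
    rw [setIntegral_eq_of_subset_of_forall_sdiff_eq_zero H.isOpen.measurableSet hTP,
      integral_biUnion_finset F (fun x hx => (hTo x hx).measurableSet) ?_
      (fun x hx => hkP.mono_set (fun y hy => hUP x hx hy.1))]
    · intro x hx y hy hxy
      have := hDd ((hmem x).1 hx) ((hmem y).1 hy) hxy
      exact this.mono (fun z hz => hUD x hx hz.1) (fun z hz => hUD y hy hz.1)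
    · rintro y ⟨hyP, hy⟩
      rw [moll_eq, hvan y, Complex.ofReal_zero, mul_zero]
      intro hcon
      have h1 := hsub ⟨hyP, Metric.ball_subset_ball hεε hcon⟩
      obtain ⟨x, hx, hyx⟩ := mem_iUnion₂.1 h1
      exact hy (mem_biUnion hx ⟨hyx, hcon⟩)
  rw [e1, Finset.mul_sum, ← Finset.sum_sub_distrib]
  refine (norm_sum_le _ _).trans ?_
  have hone : ∀ x ∈ F, ‖(∫ y in T x, k y) - kap N * h x‖ ≤ δ * kap N := by
    intro x hx
    have hTxP : T x ⊆ P := fun y hy => hUP x hx hy.1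
    have h2 : (kap N : ℂ) * h x = ∫ y in T x, h x * ((‖(jacM f y).det‖ ^ 2 * mollr τ' (f y - w) : ℝ) : ℂ) := by
      rw [integral_const_mul, integral_complex_ofReal, hcv x hx, mul_comm]
    have hI : IntegrableOn (fun y => h x * ((‖(jacM f y).det‖ ^ 2 * mollr τ' (f y - w) : ℝ) : ℂ)) (T x) :=
      Integrable.const_mul (Integrable.ofReal (𝕜 := ℂ) (h1P.mono_set hTxP)) (h x)
    rw [h2, ← integral_sub (hkP.mono_set hTxP) hI]
    have h3 : δ * kap N = ∫ y in T x, δ * (‖(jacM f y).det‖ ^ 2 * mollr τ' (f y - w)) := by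
      rw [integral_const_mul, hcv x hx]
    rw [h3]
    refine norm_integral_le_of_norm_le ((h1P.mono_set hTxP).const_mul _) ?_
    refine (ae_restrict_iff' (hTo x hx).measurableSet).2 (Filter.Eventually.of_forall fun y hy => ?_)
    have h4 : k y - h x * ((‖(jacM f y).det‖ ^ 2 * mollr τ' (f y - w) : ℝ) : ℂ) =
        (h y - h x) * ((‖(jacM f y).det‖ ^ 2 * mollr τ' (f y - w) : ℝ) : ℂ) := by
      simp only [hk, moll_eq]; push_cast; ring
    rw [h4, norm_mul, Complex.norm_real, Real.norm_eq_abs,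
      abs_of_nonneg (mul_nonneg (by positivity) (mollr_nonneg hτ0 _))]
    refine mul_le_mul_of_nonneg_right (hUh x hx y hy.1) (mul_nonneg (by positivity) (mollr_nonneg hτ0 _))
  refine (Finset.sum_le_sum hone).trans (le_of_eq ?_)
  rw [Finset.sum_const, nsmul_eq_mul]; ring

/-- trace of `h` : holomorphic function on the unit polydisc -/
def trH {N : ℕ} (P : Set (Fin N → ℂ)) (f : (Fin N → ℂ) → (Fin N → ℂ)) (h : (Fin N → ℂ) → ℂ)
    (w : Fin N → ℂ) : ℂ := trc P f h (2 / ((1 - ‖w‖) / 2) ^ 2) w / kap N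

theorem BrCov.trH_regular {N : ℕ} {P : Set (Fin N → ℂ)} {f : (Fin N → ℂ) → (Fin N → ℂ)}
    (H : BrCov P f) {h : (Fin N → ℂ) → ℂ} (hh : DifferentiableOn ℂ h P) {w : Fin N → ℂ} (hw : RegVal P f w) :
    trH P f h w = ∑ x ∈ (H.fib_finite hw).toFinset, h x := by
  have h1 : 0 < (1 - ‖w‖) / 2 := by linarith [hw.1]
  unfold trH
  rw [H.trc_regular hh hw h1 (by rw [div_mul_cancel₀ _ (by positivity)]; norm_num) (by linarith)]
  have : (kap N : ℂ) ≠ 0 := by exact_mod_cast (kap_pos N).ne'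
  field_simp

theorem BrCov.trH_holo {N : ℕ} {P : Set (Fin N → ℂ)} {f : (Fin N → ℂ) → (Fin N → ℂ)}
    (H : BrCov P f) {h : (Fin N → ℂ) → ℂ} (hh : DifferentiableOn ℂ h P) :
    DifferentiableOn ℂ (trH P f h) (Metric.ball 0 1) := by
  intro w hw
  rw [mem_ball_zero_iff] at hw
  set s := (1 - ‖w‖) / 3 with hs
  have hs0 : 0 < s := by rw [hs]; linarith
  have h1 : DifferentiableAt ℂ (trc P f h (2 / s ^ 2)) w :=
    trc_holo H hh (by positivity) hs0.le (by rw [div_mul_cancel₀ _ (by positivity)]; norm_num) (by linarith)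
  have h1' : DifferentiableAt ℂ (fun u => trc P f h (2 / s ^ 2) u / (kap N : ℂ)) w := by
    simp only [div_eq_mul_inv]
    exact h1.mul_const _
  refine (h1'.congr_of_eventuallyEq ?_).differentiableWithinAt
  have h2 : ∀ᶠ u in 𝓝 w, ‖u‖ + s < 1 := by
    refine (continuous_norm.add continuous_const).continuousAt.eventually_lt continuousAt_const ?_
    show ‖w‖ + s < 1
    linarith
  filter_upwards [h2] with u hu
  unfold trH
  congr 1
  set s' := (1 - ‖u‖) / 2 with hs'
  have hs'0 : 0 < s' := by rw [hs']; linarith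
  -- use the smaller of the two radii at both scales through a common large parameter
  set τ'' := 2 / s ^ 2 + 2 / s' ^ 2
  have e1 : trc P f h (2 / s' ^ 2) u = trc P f h τ'' u := by
    refine trc_const H hh hs'0 (by rw [div_mul_cancel₀ _ (by positivity)]; norm_num) ?_ (by linarith)
    have : τ'' * s' ^ 2 = 2 + 2 / s ^ 2 * s' ^ 2 := by simp only [τ'']; field_simp; ring
    rw [this]
    have : 0 ≤ 2 / s ^ 2 * s' ^ 2 := by positivity
    linarith
  have e2 : trc P f h (2 / s ^ 2) u = trc P f h τ'' u := by
    refine trc_const H hh hs0 (by rw [div_mul_cancel₀ _ (by positivity)]; norm_num) ?_ (by linarith)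
    have : τ'' * s ^ 2 = 2 + 2 / s' ^ 2 * s ^ 2 := by simp only [τ'']; field_simp
    rw [this]
    have : 0 ≤ 2 / s' ^ 2 * s ^ 2 := by positivity
    linarith
  rw [e1, e2]

end Part7

section Part8
open MeasureTheory ComplexConjugate

theorem BrCov.reg_of_open {N : ℕ} {P : Set (Fin N → ℂ)} {f : (Fin N → ℂ) → (Fin N → ℂ)}
    (H : BrCov P f) {O : Set (Fin N → ℂ)} (hO : IsOpen O) (hne : O.Nonempty) (hsub : O ⊆ Metric.ball 0 1) :
    ∃ w ∈ O, RegVal P f w := by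
  have h1 : volume (f '' {x ∈ P | (jacM f x).det = 0}) = 0 := by
    refine addHaar_image_eq_zero_of_det_fderivWithin_eq_zero volume
      (f' := fun x => (fderiv ℂ f x).restrictScalars ℝ) ?_ ?_
    · intro x hx
      exact (((H.holo x hx.1).differentiableAt (H.isOpen.mem_nhds hx.1)).hasFDerivAt.restrictScalars ℝ).hasFDerivWithinAt
    · intro x hx
      rw [det_real_eq, hx.2]; simp
  have h2 : ¬ O ⊆ f '' {x ∈ P | (jacM f x).det = 0} := by
    intro hcon
    have := measure_mono_null hcon h1
    exact (hO.measure_pos volume hne).ne' this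
  obtain ⟨w, hwO, hw⟩ := not_subset.1 h2
  refine ⟨w, hwO, by simpa using hsub hwO, fun x hx hxw hdet => hw ⟨x, ⟨hx, hdet⟩, hxw⟩⟩

theorem BrCov.reg_dense {N : ℕ} {P : Set (Fin N → ℂ)} {f : (Fin N → ℂ) → (Fin N → ℂ)}
    (H : BrCov P f) : Metric.ball 0 1 ⊆ closure {w | RegVal P f w} := by
  intro w hw
  rw [mem_closure_iff]
  intro O hO hwO
  obtain ⟨u, hu, hur⟩ := H.reg_of_open (hO.inter Metric.isOpen_ball) ⟨w, hwO, hw⟩ inter_subset_right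
  exact ⟨u, hu.1, hur⟩

theorem BrCov.reg_fib_dense {N : ℕ} {P : Set (Fin N → ℂ)} {f : (Fin N → ℂ) → (Fin N → ℂ)}
    (H : BrCov P f) : P ⊆ closure {x ∈ P | RegVal P f (f x)} := by
  intro x hx
  rw [mem_closure_iff]
  intro O hO hxO
  obtain ⟨y, hy, hyP, hdet⟩ := mem_closure_iff.1 (H.dense hx) O hO hxO
  obtain ⟨U, -, -, -, -, hmap⟩ := local_inv H.isOpen H.holo hyP hdet
  have h1 : f '' (O ∩ P) ∈ 𝓝 (f y) := by
    rw [← hmap]; exact Filter.image_mem_map ((hO.inter H.isOpen).mem_nhds ⟨hy, hyP⟩)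
  obtain ⟨W, hW, hWo, hyW⟩ := mem_nhds_iff.1 h1
  obtain ⟨w, hwW, hw⟩ := H.reg_of_open (hWo.inter Metric.isOpen_ball)
    ⟨f y, hyW, by simpa using H.lt_one y hyP⟩ inter_subset_right
  obtain ⟨z, hz, rfl⟩ := hW hwW.1
  exact ⟨z, hz.1, hz.2, hw⟩

theorem BrCov.degree {N : ℕ} {P : Set (Fin N → ℂ)} {f : (Fin N → ℂ) → (Fin N → ℂ)}
    (H : BrCov P f) : ∃ d : ℕ, ∀ w (hw : RegVal P f w), (H.fib_finite hw).toFinset.card = d := by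
  have hone : DifferentiableOn ℂ (fun _ : Fin N → ℂ => (1 : ℂ)) P := differentiableOn_const (c := (1:ℂ))
  have hcont := (H.trH_holo hone).continuousOn
  have emb : IsClosedEmbedding (fun n : ℤ => (((n : ℝ)) : ℂ)) :=
    Complex.isometry_ofReal.isClosedEmbedding.comp Int.isClosedEmbedding_coe_real
  have hreg : ∀ w (hw : RegVal P f w), trH P f (fun _ => 1) w = ((H.fib_finite hw).toFinset.card : ℂ) := by
    intro w hw
    rw [H.trH_regular hone hw]; simp
  set T := range (fun n : ℤ => (((n : ℝ)) : ℂ)) with hT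
  have hmaps : MapsTo (trH P f (fun _ => 1)) (Metric.ball 0 1) T := by
    intro w hw
    have hw' : w ∈ closure (Metric.ball 0 1 ∩ {w | RegVal P f w}) := by
      have := Metric.isOpen_ball.inter_closure (t := {w | RegVal P f w}) ⟨hw, H.reg_dense hw⟩
      exact this
    have h1 : trH P f (fun _ => 1) w ∈ closure (trH P f (fun _ => 1) '' (Metric.ball 0 1 ∩ {w | RegVal P f w})) :=
      ((hcont w hw).mono inter_subset_left).mem_closure_image hw'
    have h2 : closure (trH P f (fun _ => 1) '' (Metric.ball 0 1 ∩ {w | RegVal P f w})) ⊆ T := by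
      refine closure_minimal ?_ emb.isClosed_range
      rintro _ ⟨u, ⟨-, hu⟩, rfl⟩
      rw [hreg u hu]
      exact ⟨(H.fib_finite hu).toFinset.card, by simp⟩
    exact h2 h1
  haveI : DiscreteTopology T := emb.isEmbedding.toHomeomorph.symm.isEmbedding.discreteTopology
  obtain ⟨y, hy, hyeq⟩ := (convex_ball (0 : Fin N → ℂ) 1).isPreconnected.eqOn_const_of_mapsTo (isDiscrete_iff_discreteTopology.2 this) hcont hmaps ⟨_, ⟨0, rfl⟩⟩
  by_cases hex : ∃ w, RegVal P f w
  · obtain ⟨w₀, hw₀⟩ := hex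
    refine ⟨(H.fib_finite hw₀).toFinset.card, fun w hw => ?_⟩
    have h1 := hreg w hw
    have h2 := hreg w₀ hw₀
    have h3 := hyeq (show w ∈ Metric.ball 0 1 by simpa using hw.1)
    have h4 := hyeq (show w₀ ∈ Metric.ball 0 1 by simpa using hw₀.1)
    rw [h1] at h3; rw [h2] at h4
    exact_mod_cast h3.trans h4.symm
  · exact ⟨0, fun w hw => absurd ⟨w, hw⟩ hex⟩

theorem newton_finset {α : Type*} (F : Finset α) (h : α → ℂ) (k : ℕ) :
    (k : ℂ) * (F.val.map h).esymm k = (-1) ^ (k + 1) *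
      ∑ a ∈ Finset.HasAntidiagonal.antidiagonal k with a.1 < k, (-1) ^ a.1 * (F.val.map h).esymm a.1 * ∑ x ∈ F, h x ^ a.2 := by
  have h1 := congrArg (MvPolynomial.aeval (fun x : F => h x)) (MvPolynomial.mul_esymm_eq_sum F ℂ k)
  have h2 : ∀ j, MvPolynomial.aeval (fun x : F => h x) (MvPolynomial.esymm F ℂ j) = (F.val.map h).esymm j := by
    intro j
    rw [MvPolynomial.aeval_esymm_eq_multiset_esymm]
    congr 1
    have : (Finset.univ : Finset F).val.map (fun x : F => (x : α)) = F.val := by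
      have := congrArg Finset.val (Finset.attach_map_val (s := F))
      simpa using this
    conv_rhs => rw [← this, Multiset.map_map]
    rfl
  have h3 : ∀ j, MvPolynomial.aeval (fun x : F => h x) (MvPolynomial.psum F ℂ j) = ∑ x ∈ F, h x ^ j := by
    intro j
    simp only [MvPolynomial.psum, map_sum, map_pow, MvPolynomial.aeval_X]
    exact Finset.sum_coe_sort F (fun x => h x ^ j)
  simpa only [map_mul, map_sum, map_pow, map_neg, map_one, map_natCast, h2, h3] using h1

theorem BrCov.esymm_holo {N : ℕ} {P : Set (Fin N → ℂ)} {f : (Fin N → ℂ) → (Fin N → ℂ)}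
    (H : BrCov P f) {h : (Fin N → ℂ) → ℂ} (hh : DifferentiableOn ℂ h P) (k : ℕ) :
    ∃ E : (Fin N → ℂ) → ℂ, DifferentiableOn ℂ E (Metric.ball 0 1) ∧
      ∀ w (hw : RegVal P f w), E w = ((H.fib_finite hw).toFinset.val.map h).esymm k := by
  induction k using Nat.strong_induction_on with
  | _ k ih =>
    rcases Nat.eq_zero_or_pos k with rfl | hk
    · refine ⟨fun _ => 1, differentiableOn_const (c := (1:ℂ)), fun w hw => ?_⟩
      simp [Multiset.esymm]
    choose! E hE hEr using ih
    refine ⟨fun w => (k : ℂ)⁻¹ * ((-1) ^ (k + 1) *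
      ∑ a ∈ Finset.HasAntidiagonal.antidiagonal k with a.1 < k, (-1) ^ a.1 * E a.1 w * trH P f (fun x => h x ^ a.2) w), ?_, ?_⟩
    · refine DifferentiableOn.const_mul (DifferentiableOn.const_mul (DifferentiableOn.fun_sum fun a ha => ?_) _) _
      exact ((hE a.1 (Finset.mem_filter.1 ha).2).const_mul _).mul (H.trH_holo (hh.pow _))
    · intro w hw
      have h1 := newton_finset (H.fib_finite hw).toFinset h k
      have hk' : (k : ℂ) ≠ 0 := by exact_mod_cast hk.ne'
      rw [eq_comm, eq_inv_mul_iff_mul_eq₀ hk', h1]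
      congr 1
      refine Finset.sum_congr rfl fun a ha => ?_
      rw [hEr a.1 (Finset.mem_filter.1 ha).2 w hw, H.trH_regular (h := fun x => h x ^ a.2) (hh.pow _) hw]

end Part8

section Part9
theorem multilin_poly {N n : ℕ} (m : ContinuousMultilinearMap ℂ (fun _ : Fin n => (Fin N → ℂ)) ℂ) :
    ∃ p : MvPolynomial (Fin N) ℂ, ∀ w, m (fun _ => w) = MvPolynomial.eval w p := by
  refine ⟨∑ r : Fin n → Fin N, MvPolynomial.C (m fun i => Pi.single (r i) 1) * ∏ i, MvPolynomial.X (r i), fun w => ?_⟩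
  have h1 : w = ∑ j, w j • (Pi.single j (1:ℂ) : Fin N → ℂ) := by
    conv_lhs => rw [pi_eq_sum_univ' w]
  conv_lhs => rw [h1]
  have h2 := m.toMultilinearMap.map_sum (fun (_ : Fin n) (j : Fin N) => w j • (Pi.single j (1:ℂ) : Fin N → ℂ))
  refine h2.trans ?_
  rw [map_sum]
  refine Finset.sum_congr rfl fun r _ => ?_
  have h3 := m.toMultilinearMap.map_smul_univ (fun i => w (r i)) (fun i => (Pi.single (r i) (1:ℂ) : Fin N → ℂ))
  refine h3.trans ?_
  simp [mul_comm]

theorem poly_approx {N : ℕ} {E : (Fin N → ℂ) → ℂ} (hE : DifferentiableOn ℂ E (Metric.ball 0 1))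
    {a : ℝ} (ha0 : 0 ≤ a) (ha : a < 1) {ε : ℝ} (hε : 0 < ε) :
    ∃ p : MvPolynomial (Fin N) ℂ, ∀ w, ‖w‖ ≤ a → ‖E w - MvPolynomial.eval w p‖ < ε := by
  set ρ : ℝ := 2 / (1 + a) with hρ
  have hρ1 : 1 < ρ := by rw [hρ, lt_div_iff₀ (by linarith)]; linarith
  have hρ0 : 0 < ρ := by linarith
  have haρ : ρ * a < 1 := by rw [hρ, div_mul_eq_mul_div, div_lt_one (by linarith)]; linarith
  obtain ⟨M, hM⟩ : ∃ M, ∀ w ∈ Metric.closedBall (0 : Fin N → ℂ) (ρ * a), ‖E w‖ ≤ M :=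
    (isCompact_closedBall 0 (ρ * a)).exists_bound_of_continuousOn
      (hE.continuousOn.mono (Metric.closedBall_subset_ball haρ))
  set m := fun n => iteratedFDeriv ℂ n E 0 with hm
  have key : ∀ w : Fin N → ℂ, ‖w‖ ≤ a →
      HasSum (fun n : ℕ => ((n.factorial : ℂ))⁻¹ • (m n (fun _ => w))) (E w) ∧
      ∀ n, ‖((n.factorial : ℂ))⁻¹ • (m n (fun _ => w))‖ ≤ M * (ρ⁻¹) ^ n := by
    intro w hw
    set L : ℂ →L[ℂ] (Fin N → ℂ) := ContinuousLinearMap.toSpanSingleton ℂ w with hL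
    have hLt : ∀ t, L t = t • w := fun t => rfl
    have hsub : Metric.closedBall (0:ℂ) ρ ⊆ L ⁻¹' Metric.ball 0 1 := by
      intro t ht
      rw [mem_closedBall_zero_iff] at ht
      rw [mem_preimage, mem_ball_zero_iff, hLt, norm_smul]
      exact lt_of_le_of_lt (by gcongr) haρ
    have hg : DifferentiableOn ℂ (E ∘ L) (L ⁻¹' Metric.ball 0 1) :=
      hE.comp L.differentiable.differentiableOn (mapsTo_preimage _ _)
    have hopen : IsOpen (L ⁻¹' Metric.ball 0 1) := Metric.isOpen_ball.preimage L.continuous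
    have h0 : (0:ℂ) ∈ L ⁻¹' Metric.ball 0 1 := hsub (by simp [hρ0.le])
    have hder : ∀ n, iteratedDeriv n (E ∘ L) 0 = m n (fun _ => w) := by
      intro n
      rw [iteratedDeriv_eq_iteratedFDeriv, ← iteratedFDerivWithin_of_isOpen n hopen h0,
        L.iteratedFDerivWithin_comp_right (contDiffOn_holo Metric.isOpen_ball hE n) Metric.isOpen_ball.uniqueDiffOn
          hopen.uniqueDiffOn h0 le_rfl, map_zero, iteratedFDerivWithin_of_isOpen n Metric.isOpen_ball (by simp)]
      rw [ContinuousMultilinearMap.compContinuousLinearMap_apply]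
      congr 1
      funext i; rw [hLt, one_smul]
    constructor
    · have := Complex.hasSum_taylorSeries_on_ball (hg.mono (Metric.ball_subset_closedBall.trans hsub))
        (show (1:ℂ) ∈ Metric.ball 0 ρ by simpa using hρ1)
      simp only [hder, sub_zero, one_pow, one_smul, Function.comp_apply, hLt] at this
      exact this
    · intro n
      have h1 := Complex.norm_iteratedDeriv_le_of_forall_mem_sphere_norm_le (C := M) n hρ0
        (hg.diffContOnCl_ball hsub) (by
          intro t ht
          refine hM _ ?_
          rw [mem_sphere_zero_iff_norm] at ht
          rw [mem_closedBall_zero_iff, hLt, norm_smul, ht]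
          gcongr)
      rw [hder] at h1
      rw [norm_smul, norm_inv, Complex.norm_natCast]
      have hf : (0:ℝ) < n.factorial := by exact_mod_cast n.factorial_pos
      rw [inv_mul_le_iff₀ hf]
      calc _ ≤ _ := h1
        _ = _ := by rw [inv_pow]; field_simp
  have hsum : Summable fun n => M * (ρ⁻¹) ^ n :=
    (summable_geometric_of_lt_one (by positivity) (inv_lt_one_of_one_lt₀ hρ1)).mul_left M
  have hu := tendstoUniformlyOn_tsum_nat hsum (s := {w | ‖w‖ ≤ a}) (f := fun n w => ((n.factorial : ℂ))⁻¹ • (m n (fun _ => w)))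
    (fun n w hw => (key w hw).2 n)
  obtain ⟨n, hn⟩ := (Metric.tendstoUniformlyOn_iff.1 hu ε hε).exists
  choose p hp using fun n => multilin_poly (m n)
  refine ⟨∑ k ∈ Finset.range n, MvPolynomial.C ((k.factorial : ℂ))⁻¹ * p k, fun w hw => ?_⟩
  have h1 := hn w hw
  rw [(key w hw).1.tsum_eq, dist_eq_norm] at h1
  have h2 : MvPolynomial.eval w (∑ k ∈ Finset.range n, MvPolynomial.C ((k.factorial : ℂ))⁻¹ * p k) =
      ∑ k ∈ Finset.range n, ((k.factorial : ℂ))⁻¹ • (m k (fun _ => w)) := by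
    rw [map_sum]
    refine Finset.sum_congr rfl fun k _ => ?_
    rw [map_mul, MvPolynomial.eval_C, ← hp, smul_eq_mul]
  rw [h2]
  exact h1

end Part9

section Part10
/-- the algebra of holomorphic functions on `Ω` -/
def holA {N : ℕ} (Ω : Set (Fin N → ℂ)) : Subalgebra ℂ ((Fin N → ℂ) → ℂ) where
  carrier := {f | DifferentiableOn ℂ f Ω}
  mul_mem' := fun ha hb => DifferentiableOn.mul ha hb
  add_mem' := fun ha hb => DifferentiableOn.add ha hb
  algebraMap_mem' := fun c => differentiableOn_const (c := c)

theorem holA_aeval {N n : ℕ} {Ω : Set (Fin N → ℂ)} (F : Fin n → holA Ω) (p : MvPolynomial (Fin n) ℂ) (x : Fin N → ℂ) :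
    ((MvPolynomial.aeval F p : holA Ω) : (Fin N → ℂ) → ℂ) x = MvPolynomial.eval (fun i => (F i : (Fin N → ℂ) → ℂ) x) p := by
  let ev : holA Ω →ₐ[ℂ] ℂ := (Pi.evalAlgHom ℂ (fun _ : Fin N → ℂ => ℂ) x).comp (holA Ω).val
  have h1 : ev (MvPolynomial.aeval F p) = MvPolynomial.aeval (fun i => ev (F i)) p := by
    rw [← AlgHom.comp_apply, MvPolynomial.comp_aeval]
  rw [← MvPolynomial.coe_aeval_eq_eval]
  exact h1

def chiP (E : ℕ → ℂ) (d : ℕ) (T : ℂ) : ℂ := ∑ j ∈ Finset.range (d + 1), (-1) ^ j * (E j * T ^ (d - j))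

theorem chiP_prod (s : Multiset ℂ) {d : ℕ} (hd : s.card = d) (T : ℂ) :
    chiP (fun j => s.esymm j) d T = (s.map fun t => T - t).prod := by
  have h1 := congrArg (Polynomial.eval T) (Multiset.prod_X_sub_X_eq_sum_esymm s)
  rw [Polynomial.eval_multiset_prod, Multiset.map_map] at h1
  simp only [Function.comp_def, Polynomial.eval_sub, Polynomial.eval_X, Polynomial.eval_C, Polynomial.eval_finset_sum,
    Polynomial.eval_mul, Polynomial.eval_pow, Polynomial.eval_neg, Polynomial.eval_one] at h1
  rw [h1, hd]; rfl

theorem char_of_brcov {N : ℕ} {Ω S P : Set (Fin N → ℂ)} (hS : IsCompact S) 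
    (F : Fin N → holA Ω) (H : BrCov P (fun x i => (F i : (Fin N → ℂ) → ℂ) x)) (hPΩ : P ⊆ Ω) (hSP : S ⊆ P)
    (φ : holA Ω →ₐ[ℂ] ℂ)
    (hφ : ∀ (h : holA Ω) (C : ℝ), (∀ x ∈ S, ‖(h : (Fin N → ℂ) → ℂ) x‖ ≤ C) → ‖φ h‖ ≤ C) :
    ∃ x ∈ P, ∀ h : holA Ω, φ h = (h : (Fin N → ℂ) → ℂ) x := by
  set f : (Fin N → ℂ) → (Fin N → ℂ) := fun x i => (F i : (Fin N → ℂ) → ℂ) x with hf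
  obtain ⟨a, ha0, ha1, ha⟩ : ∃ a : ℝ, 0 ≤ a ∧ a < 1 ∧ ∀ x ∈ S, ‖f x‖ ≤ a := by
    rcases S.eq_empty_or_nonempty with h0 | h0
    · exact ⟨0, le_rfl, one_pos, by simp [h0]⟩
    · obtain ⟨x, hx, hmax⟩ := hS.exists_isMaxOn h0 (H.holo.continuousOn.mono hSP).norm
      exact ⟨‖f x‖, norm_nonneg _, H.lt_one x (hSP hx), fun y hy => hmax hy⟩
  set q : Fin N → ℂ := fun i => φ (F i) with hq
  have hqa : ‖q‖ ≤ a := by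
    refine (pi_norm_le_iff_of_nonneg ha0).2 fun i => hφ _ _ fun x hx => ?_
    exact (norm_le_pi_norm (f x) i).trans (ha x hx)
  have hq1 : ‖q‖ < 1 := lt_of_le_of_lt hqa ha1
  have hhol : ∀ h : holA Ω, DifferentiableOn ℂ (h : (Fin N → ℂ) → ℂ) P := fun h => h.2.mono hPΩ
  obtain ⟨d, hd⟩ := H.degree
  -- limiting fibre
  set r := (‖q‖ + 1) / 2 with hr
  have hqr : ‖q‖ < r := by linarith
  have hr1 : r < 1 := by linarith
  have hqcl : q ∈ closure (Metric.ball 0 r ∩ {w | RegVal P f w}) :=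
    Metric.isOpen_ball.inter_closure ⟨by simpa using hqr, H.reg_dense (by simpa using hq1)⟩
  obtain ⟨w, hw, hwq⟩ := mem_closure_iff_seq_limit.1 hqcl
  have hwr : ∀ n, RegVal P f (w n) := fun n => (hw n).2
  let e : ∀ n, ↥(H.fib_finite (hwr n)).toFinset ≃ Fin d := fun n => Finset.equivFinOfCardEq (hd _ (hwr n))
  let X : ℕ → Fin d → (Fin N → ℂ) := fun n j => ((e n).symm j : Fin N → ℂ)
  have hXfib : ∀ n j, X n j ∈ P ∧ f (X n j) = w n := fun n j => by
    have := ((e n).symm j).2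
    rwa [Set.Finite.mem_toFinset] at this
  have hXprod : ∀ n (g : (Fin N → ℂ) → ℂ) (T : ℂ),
      (((H.fib_finite (hwr n)).toFinset.val.map g).map fun t => T - t).prod = ∏ j, (T - g (X n j)) := by
    intro n g T
    rw [Multiset.map_map]
    change ∏ x ∈ (H.fib_finite (hwr n)).toFinset, (T - g x) = _
    rw [← Finset.prod_coe_sort]
    exact Fintype.prod_equiv (e n) _ _ (fun x => by simp [X])
  have hXK : ∀ n, X n ∈ Set.pi univ (fun _ : Fin d => {x | x ∈ P ∧ ‖f x‖ ≤ r}) := by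
    intro n j _
    refine ⟨(hXfib n j).1, ?_⟩
    rw [(hXfib n j).2]
    have := (hw n).1
    rw [mem_ball_zero_iff] at this
    exact this.le
  obtain ⟨y, hyK, ψ, hψ, hlim⟩ := (isCompact_univ_pi (fun _ : Fin d => H.proper r hr1)).tendsto_subseq hXK
  have hyP : ∀ j, y j ∈ P := fun j => (hyK j (mem_univ j)).1
  -- the key identity
  have key : ∀ h : holA Ω, ∃ j, φ h = (h : (Fin N → ℂ) → ℂ) (y j) := by
    intro h
    choose E hE hEr using H.esymm_holo (hhol h)
    have hEc : ∀ j, ContinuousOn (E j) (Metric.ball 0 1) := fun j => (hE j).continuousOn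
    have hreg : ∀ u (hu : RegVal P f u) T, chiP (fun j => E j u) d T =
        (((H.fib_finite hu).toFinset.val.map (h : (Fin N → ℂ) → ℂ)).map fun t => T - t).prod := by
      intro u hu T
      rw [← chiP_prod (d := d)]
      · congr 1; funext j; exact hEr j u hu
      · rw [Multiset.card_map]; exact hd u hu
    have hprod : ∀ T, chiP (fun j => E j q) d T = ∏ j, (T - (h : (Fin N → ℂ) → ℂ) (y j)) := by
      intro T
      have l1 : Filter.Tendsto (fun n => chiP (fun j => E j (w (ψ n))) d T) Filter.atTop (𝓝 (chiP (fun j => E j q) d T)) := by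
        unfold chiP
        refine tendsto_finset_sum _ fun j _ => Filter.Tendsto.const_mul _ (Filter.Tendsto.mul_const _ ?_)
        have hc : ContinuousAt (E j) q := (hEc j).continuousAt (Metric.isOpen_ball.mem_nhds (by simpa using hq1))
        exact hc.tendsto.comp (hwq.comp hψ.tendsto_atTop)
      have l2 : Filter.Tendsto (fun n => ∏ j, (T - (h : (Fin N → ℂ) → ℂ) (X (ψ n) j))) Filter.atTop
          (𝓝 (∏ j, (T - (h : (Fin N → ℂ) → ℂ) (y j)))) := by
        refine tendsto_finset_prod _ fun j _ => Filter.Tendsto.const_sub _ ?_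
        have hc : ContinuousAt (h : (Fin N → ℂ) → ℂ) (y j) :=
          (hhol h).continuousOn.continuousAt (H.isOpen.mem_nhds (hyP j))
        exact hc.tendsto.comp ((tendsto_pi_nhds.1 hlim) j)
      refine tendsto_nhds_unique l1 (l2.congr fun n => ?_)
      rw [hreg _ (hwr _), hXprod]
    have hzero : ∀ x ∈ P, chiP (fun j => E j (f x)) d ((h : (Fin N → ℂ) → ℂ) x) = 0 := by
      have hc : ContinuousOn (fun x => chiP (fun j => E j (f x)) d ((h : (Fin N → ℂ) → ℂ) x)) P := by
        unfold chiP
        refine continuousOn_finsetSum _ fun j _ => continuousOn_const.mul (ContinuousOn.mul ?_ ((hhol h).continuousOn.pow _))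
        exact (hEc j).comp H.holo.continuousOn fun x hx => by simpa using H.lt_one x hx
      intro x hx
      have hx' := H.reg_fib_dense hx
      have h1 := ((hc x hx).mono (fun z hz => hz.1)).mem_closure_image hx'
      have h2 : closure ((fun x => chiP (fun j => E j (f x)) d ((h : (Fin N → ℂ) → ℂ) x)) '' {x ∈ P | RegVal P f (f x)}) ⊆ {0} := by
        refine closure_minimal ?_ isClosed_singleton
        rintro _ ⟨z, ⟨hz, hzr⟩, rfl⟩
        rw [mem_singleton_iff]
        simp only
        rw [hreg _ hzr]
        refine Multiset.prod_eq_zero ?_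
        rw [Multiset.map_map]
        refine Multiset.mem_map.2 ⟨z, ?_, by simp⟩
        show z ∈ (H.fib_finite hzr).toFinset
        rw [Set.Finite.mem_toFinset]; exact ⟨hz, rfl⟩
      exact h2 h1
    have hφ0 : chiP (fun j => E j q) d (φ h) = 0 := by
      obtain ⟨B, hB⟩ := hS.exists_bound_of_continuousOn ((hhol h).continuousOn.mono hSP)
      set B' := max B ‖φ h‖ with hB'
      have hB'0 : 0 ≤ B' := le_max_of_le_right (norm_nonneg _)
      set C₀ : ℝ := ∑ j ∈ Finset.range (d + 1), B' ^ (d - j) with hC₀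
      have hC₀0 : 0 ≤ C₀ := Finset.sum_nonneg fun j _ => pow_nonneg hB'0 _
      have hest : ∀ ε > 0, ‖chiP (fun j => E j q) d (φ h)‖ ≤ ε * (2 * C₀) := by
        intro ε hε
        choose p hp using fun j => poly_approx (hE j) ha0 ha1 hε
        have hdiff : ∀ (u : Fin N → ℂ) (T : ℂ), ‖u‖ ≤ a → ‖T‖ ≤ B' →
            ‖chiP (fun j => E j u) d T - chiP (fun j => MvPolynomial.eval u (p j)) d T‖ ≤ ε * C₀ := by
          intro u T hu hT
          unfold chiP
          rw [← Finset.sum_sub_distrib, hC₀, Finset.mul_sum]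
          refine (norm_sum_le _ _).trans (Finset.sum_le_sum fun j _ => ?_)
          rw [← mul_sub, ← sub_mul, norm_mul, norm_mul, norm_pow, norm_pow, norm_neg, norm_one, one_pow, one_mul]
          gcongr
          exact (hp j u hu).le
        let G : holA Ω := ∑ j ∈ Finset.range (d + 1), (-1) ^ j * (MvPolynomial.aeval F (p j) * h ^ (d - j))
        have hG : ∀ x, (G : (Fin N → ℂ) → ℂ) x = chiP (fun j => MvPolynomial.eval (f x) (p j)) d ((h : (Fin N → ℂ) → ℂ) x) := by
          intro x
          simp only [G, chiP, AddSubmonoidClass.coe_finset_sum, Finset.sum_apply, MulMemClass.coe_mul, Pi.mul_apply,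
            SubmonoidClass.coe_pow, Pi.pow_apply, holA_aeval]
          rfl
        have hφG : φ G = chiP (fun j => MvPolynomial.eval q (p j)) d (φ h) := by
          simp only [G, chiP, map_sum, map_mul, map_pow, map_neg, map_one]
          refine Finset.sum_congr rfl fun j _ => ?_
          congr 2
          rw [← AlgHom.comp_apply, MvPolynomial.comp_aeval, ← MvPolynomial.coe_aeval_eq_eval]
          rfl
        have h1 : ‖φ G‖ ≤ ε * C₀ := by
          refine hφ _ _ fun x hx => ?_
          rw [hG x]
          have := hdiff (f x) ((h : (Fin N → ℂ) → ℂ) x) (ha x hx) ((hB x hx).trans (le_max_left _ _))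
          rw [hzero x (hSP hx), zero_sub, norm_neg] at this
          exact this
        rw [hφG] at h1
        have h2 := hdiff q (φ h) hqa (le_max_right _ _)
        calc _ = ‖(chiP (fun j => E j q) d (φ h) - chiP (fun j => MvPolynomial.eval q (p j)) d (φ h)) +
              chiP (fun j => MvPolynomial.eval q (p j)) d (φ h)‖ := by rw [sub_add_cancel]
          _ ≤ _ := norm_add_le _ _
          _ ≤ ε * (2 * C₀) := by linarith
      rw [← norm_eq_zero]
      refine le_antisymm (le_of_forall_pos_le_add fun e he => ?_) (norm_nonneg _)
      refine (hest (e / (2 * C₀ + 1)) (by positivity)).trans ?_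
      rw [zero_add, div_mul_eq_mul_div, div_le_iff₀ (by positivity)]
      nlinarith
    rw [hprod] at hφ0
    obtain ⟨j, -, hj⟩ := Finset.prod_eq_zero_iff.1 hφ0
    exact ⟨j, sub_eq_zero.1 hj⟩
  let V : Fin d → Submodule ℂ (holA Ω) := fun j =>
    LinearMap.ker (φ.toLinearMap - ((Pi.evalAlgHom ℂ (fun _ : Fin N → ℂ => ℂ) (y j)).comp (holA Ω).val).toLinearMap)
  have hV : ∀ j h, h ∈ V j ↔ φ h = (h : (Fin N → ℂ) → ℂ) (y j) := by
    intro j h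
    simp only [V, LinearMap.mem_ker, LinearMap.sub_apply, sub_eq_zero]
    rfl
  obtain ⟨j, hj⟩ := Subspace.exists_eq_top_of_iUnion_eq_univ (p := V) (by
    rw [eq_univ_iff_forall]
    intro h
    obtain ⟨j, hj⟩ := key h
    exact mem_iUnion.2 ⟨j, (hV j h).2 hj⟩)
  exact ⟨y j, hyP j, fun h => (hV j h).1 (by rw [hj]; trivial)⟩

end Part10

section Part11
def fv {N m : ℕ} {Ω : Set (Fin N → ℂ)} (F : Fin m → holA Ω) (x : Fin N → ℂ) : Fin m → ℂ :=
  fun i => (F i : (Fin N → ℂ) → ℂ) x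

structure ShellD {N m : ℕ} (Ω S : Set (Fin N → ℂ)) (F : Fin m → holA Ω) (W L : Set (Fin N → ℂ)) : Prop where
  isOpen : IsOpen W
  isCompact : IsCompact L
  subS : S ⊆ W
  subW : W ⊆ L
  subL : L ⊆ Ω
  lt : ∀ x ∈ S, ‖fv F x‖ < 1
  gt : ∀ x ∈ L \ W, 1 < ‖fv F x‖

theorem fv_differentiableOn {N m : ℕ} {Ω : Set (Fin N → ℂ)} (F : Fin m → holA Ω) :
    DifferentiableOn ℂ (fv F) Ω := differentiableOn_pi.2 fun i => (F i).2

theorem exists_lt_bound {X : Type*} [TopologicalSpace X] {K : Set X} (hK : IsCompact K) {u : X → ℝ} (hu : ContinuousOn u K)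
    {c : ℝ} (h : ∀ x ∈ K, u x < c) : ∃ a < c, ∀ x ∈ K, u x ≤ a := by
  rcases K.eq_empty_or_nonempty with h0 | h0
  · exact ⟨c - 1, by linarith, by simp [h0]⟩
  · obtain ⟨x, hx, hmax⟩ := hK.exists_isMaxOn h0 hu
    exact ⟨u x, h x hx, fun y hy => hmax hy⟩

theorem exists_gt_bound {X : Type*} [TopologicalSpace X] {K : Set X} (hK : IsCompact K) {u : X → ℝ} (hu : ContinuousOn u K)
    {c : ℝ} (h : ∀ x ∈ K, c < u x) : ∃ a > c, ∀ x ∈ K, a ≤ u x := by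
  obtain ⟨a, ha, hb⟩ := exists_lt_bound hK hu.neg (c := -c) (fun x hx => neg_lt_neg (h x hx))
  exact ⟨-a, by linarith, fun x hx => by have := hb x hx; simp only [Pi.neg_apply] at this; linarith⟩

theorem ShellD.perturb {N m : ℕ} {Ω S : Set (Fin N → ℂ)} {F : Fin m → holA Ω} {W L : Set (Fin N → ℂ)}
    (hS : IsCompact S) (D : ShellD Ω S F W L) :
    ∃ δ > 0, ∀ F' : Fin m → holA Ω, (∀ x ∈ L, ‖fv F' x - fv F x‖ ≤ δ) → ShellD Ω S F' W L := by
  have hc : ContinuousOn (fun x => ‖fv F x‖) L := ((fv_differentiableOn F).continuousOn.mono D.subL).norm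
  obtain ⟨a, ha, ha2⟩ := exists_lt_bound hS (hc.mono (D.subS.trans D.subW)) D.lt
  obtain ⟨b, hb, hb2⟩ := exists_gt_bound (D.isCompact.diff D.isOpen) (hc.mono diff_subset) D.gt
  refine ⟨min (1 - a) (b - 1) / 2, by have : 0 < min (1 - a) (b - 1) := lt_min (by linarith) (by linarith); linarith, ?_⟩
  intro F' hF'
  have hm1 := min_le_left (1 - a) (b - 1)
  have hm2 := min_le_right (1 - a) (b - 1)
  have hm0 : 0 < min (1 - a) (b - 1) := lt_min (by linarith) (by linarith)
  refine ⟨D.isOpen, D.isCompact, D.subS, D.subW, D.subL, fun x hx => ?_, fun x hx => ?_⟩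
  · have h1 := hF' x (D.subW (D.subS hx))
    have h2 := norm_sub_norm_le (fv F' x) (fv F x)
    have h3 := ha2 x hx
    linarith
  · have h1 := hF' x hx.1
    have h2 := norm_sub_norm_le (fv F x) (fv F' x)
    rw [norm_sub_rev] at h2
    have h3 := hb2 x hx
    linarith

/-- coordinate functions -/
def coordA {N : ℕ} (Ω : Set (Fin N → ℂ)) (j : Fin N) : holA Ω :=
  ⟨fun x => x j, (ContinuousLinearMap.proj (R := ℂ) (φ := fun _ : Fin N => ℂ) j).differentiable.differentiableOn⟩

theorem det_poly_finite {N : ℕ} (M : Matrix (Fin N) (Fin N) ℂ) : {t : ℂ | (M + t • (1 : Matrix (Fin N) (Fin N) ℂ)).det = 0}.Finite := by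
  have h1 : ∀ t : ℂ, (M + t • (1 : Matrix (Fin N) (Fin N) ℂ)).det = ((-M).charpoly).eval t := by
    intro t
    rw [Matrix.eval_charpoly]
    congr 1
    rw [sub_neg_eq_add, add_comm]
    congr 1
    ext i j; simp [Matrix.scalar_apply, Matrix.one_apply, Matrix.diagonal_apply]
  have h2 : {t : ℂ | (M + t • (1 : Matrix (Fin N) (Fin N) ℂ)).det = 0} ⊆ ↑((-M).charpoly.roots.toFinset) := by
    intro t ht
    rw [mem_setOf_eq, h1] at ht
    simp only [Finset.mem_coe, Multiset.mem_toFinset]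
    exact (Polynomial.mem_roots (Matrix.charpoly_monic _).ne_zero).2 ht
  exact (Finset.finite_toSet _).subset h2

theorem ShellD.toBrCov {N : ℕ} {Ω S : Set (Fin N → ℂ)} (hΩ : IsOpen Ω) {F : Fin N → holA Ω} {W L : Set (Fin N → ℂ)}
    (hS : IsCompact S) (D : ShellD Ω S F W L) :
    ∃ (F' : Fin N → holA Ω) (P : Set (Fin N → ℂ)), BrCov P (fv F') ∧ P ⊆ Ω ∧ S ⊆ P := by
  obtain ⟨δ, hδ, hpert⟩ := D.perturb hS
  obtain ⟨R, hR⟩ := D.isCompact.exists_bound_of_continuousOn (f := fun x => x) continuousOn_id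
  have hWΩ : W ⊆ Ω := D.subW.trans D.subL
  obtain ⟨c, hcc, hcd⟩ := TopologicalSpace.exists_countable_dense (Fin N → ℂ)
  have hbad : (⋃ x ∈ c, {t : ℂ | (jacM (fv F) x + t • (1 : Matrix (Fin N) (Fin N) ℂ)).det = 0}).Countable :=
    hcc.biUnion fun x _ => (det_poly_finite _).countable
  have hdense := hbad.dense_compl ℝ
  obtain ⟨t, ht1, ht2⟩ := hdense.exists_dist_lt 0 (show 0 < δ / (|R| + 1) by positivity)
  have htn : ‖t‖ * |R| ≤ δ := by
    rw [dist_comm, dist_zero_right, lt_div_iff₀ (by positivity)] at ht2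
    nlinarith [norm_nonneg t]
  set F' : Fin N → holA Ω := fun i => F i + t • coordA Ω i with hF'
  have hfv : ∀ x, fv F' x = fv F x + t • x := by
    intro x; ext i; simp [fv, hF', coordA]
  have D' : ShellD Ω S F' W L := by
    apply hpert
    intro x hx
    rw [hfv, add_sub_cancel_left, norm_smul]
    have := hR x hx
    have h2 := le_abs_self R
    nlinarith [norm_nonneg t, norm_nonneg x]
  have hjac : ∀ x ∈ Ω, jacM (fv F') x = jacM (fv F) x + t • (1 : Matrix (Fin N) (Fin N) ℂ) := by
    intro x hx
    have h1 : DifferentiableAt ℂ (fv F) x := (fv_differentiableOn F).differentiableAt (hΩ.mem_nhds hx)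
    have h2 : HasFDerivAt (fv F') (fderiv ℂ (fv F) x + t • ContinuousLinearMap.id ℂ (Fin N → ℂ)) x := by
      have := h1.hasFDerivAt.add ((hasFDerivAt_id (𝕜 := ℂ) x).const_smul t)
      have e : fv F' = fv F + t • id := by funext y; rw [hfv]; rfl
      rw [e]; exact this
    ext a b
    simp only [jacM, Matrix.of_apply, h2.fderiv, Matrix.add_apply, Matrix.smul_apply, Matrix.one_apply]
    simp [Pi.single_apply]
  have hcont : ContinuousOn (fv F') Ω := (fv_differentiableOn F').continuousOn
  refine ⟨F', {x ∈ W | ‖fv F' x‖ < 1}, ?_, fun x hx => hWΩ hx.1, fun x hx => ⟨D.subS hx, D'.lt x hx⟩⟩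
  have hPo : IsOpen {x ∈ W | ‖fv F' x‖ < 1} := by
    have := (hcont.mono hWΩ).norm.isOpen_inter_preimage D.isOpen (isOpen_Iio (a := (1:ℝ)))
    exact this
  refine ⟨hPo, (fv_differentiableOn F').mono fun x hx => hWΩ hx.1, ?_, ?_, fun x hx => hx.2⟩
  · intro r hr
    have : {x | x ∈ {x ∈ W | ‖fv F' x‖ < 1} ∧ ‖fv F' x‖ ≤ r} = L ∩ (fun x => ‖fv F' x‖) ⁻¹' Iic r := by
      ext x
      constructor
      · rintro ⟨h1, h2⟩; exact ⟨D.subW h1.1, h2⟩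
      · rintro ⟨h1, h2⟩
        have h2' : ‖fv F' x‖ ≤ r := h2
        refine ⟨⟨?_, by linarith⟩, h2⟩
        by_contra h
        have := D'.gt x ⟨h1, h⟩
        linarith
    rw [this]
    exact D.isCompact.of_isClosed_subset
      ((hcont.mono D.subL).norm.preimage_isClosed_of_isClosed D.isCompact.isClosed isClosed_Iic) inter_subset_left
  · intro x hx
    have h1 := hcd.open_subset_closure_inter hPo hx
    refine closure_mono ?_ h1
    rintro y ⟨hy1, hy2⟩
    refine ⟨hy1, ?_⟩
    rw [hjac y (hWΩ hy1.1)]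
    intro h0
    exact ht1 (mem_biUnion hy2 h0)

end Part11

section Part12
/-- polynomial perturbation with parameters -/
def pertA {N : ℕ} (a : Fin N → Fin (2 * N + 1) → Fin N → ℂ) (x : Fin N → ℂ) : Fin N → ℂ :=
  fun i => ∑ j, ∑ s : Fin (2 * N + 1), x j ^ (s : ℕ) * a j s i

theorem contDiffAt_det_real {E : Type*} [NormedAddCommGroup E] [NormedSpace ℝ E] {k : ℕ}
    {M : E → Matrix (Fin k) (Fin k) ℂ} {p : E} (hM : ∀ a b, ContDiffAt ℝ 1 (fun q => M q a b) p) :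
    ContDiffAt ℝ 1 (fun q => (M q).det) p := by
  simp only [Matrix.det_apply]
  refine ContDiffAt.sum fun σ _ => ?_
  refine ContDiffAt.const_smul _ ?_
  exact contDiffAt_prod fun i _ => hM _ _

theorem contDiffAt_inv_real {E : Type*} [NormedAddCommGroup E] [NormedSpace ℝ E] {k : ℕ}
    {M : E → Matrix (Fin k) (Fin k) ℂ} {p : E} (hM : ∀ a b, ContDiffAt ℝ 1 (fun q => M q a b) p)
    (h0 : (M p).det ≠ 0) (a b : Fin k) :
    ContDiffAt ℝ 1 (fun q => (M q)⁻¹ a b) p := by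
  simp only [Matrix.inv_def, Matrix.smul_apply, Ring.inverse_eq_inv', smul_eq_mul, Matrix.adjugate_apply]
  refine ContDiffAt.mul ((contDiffAt_det_real hM).inv h0) (contDiffAt_det_real fun c d => ?_)
  simp only [Matrix.updateRow_apply]
  split_ifs
  · exact contDiffAt_const
  · exact hM _ _

section bad
variable {N : ℕ} (h : (Fin N → ℂ) → (Fin N → ℂ)) (j : Fin N) (l : ℂ →L[ℝ] ℝ) (e : ℂ)
  (t : Fin (2 * N + 1) → ℝ)

def kerL : Submodule ℝ (Fin N → ℂ) :=
  LinearMap.ker (l.toLinearMap ∘ₗ (LinearMap.proj j : (Fin N → ℂ) →ₗ[ℝ] ℂ))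

abbrev SrcE := (Fin (2 * N + 1) → kerL j l) × (Fin N → ℂ) × ({j' : Fin N // j' ≠ j} → Fin (2 * N + 1) → Fin N → ℂ)

def srcX (p : SrcE j l) (r : Fin (2 * N + 1)) : Fin N → ℂ :=
  (Pi.single j (t r • e) : Fin N → ℂ) + (p.1 r : Fin N → ℂ)

def srcV (p : SrcE j l) : Matrix (Fin (2 * N + 1)) (Fin (2 * N + 1)) ℂ :=
  Matrix.vandermonde fun r => srcX j l e t p r j

def srcPhi (p : SrcE j l) : Fin N → Fin (2 * N + 1) → Fin N → ℂ := fun j' s i =>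
  if hj : j' ≠ j then p.2.2 ⟨j', hj⟩ s i else
    ∑ r, (srcV j l e t p)⁻¹ s r * (p.2.1 i - h (srcX j l e t p r) i
      - ∑ j'' : {j' : Fin N // j' ≠ j}, ∑ s : Fin (2 * N + 1), srcX j l e t p r j'' ^ (s : ℕ) * p.2.2 j'' s i)

theorem srcX_contDiff (r : Fin (2 * N + 1)) : ContDiff ℝ 1 (fun p => srcX j l e t p r) := by
  unfold srcX
  refine contDiff_const.add ?_
  have : ContDiff ℝ 1 (fun p : SrcE j l => p.1 r) :=
    (contDiff_pi.1 contDiff_fst) r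
  exact (kerL j l).subtypeL.contDiff.comp this

theorem srcPhi_contDiffAt {Ω : Set (Fin N → ℂ)} (hΩ : IsOpen Ω) (hh : DifferentiableOn ℂ h Ω) (p : SrcE j l)
    (hp : ∀ r, srcX j l e t p r ∈ Ω) (hV : (srcV j l e t p).det ≠ 0) :
    ContDiffAt ℝ 1 (srcPhi h j l e t) p := by
  have hx : ∀ r, ContDiffAt ℝ 1 (fun p => srcX j l e t p r) p := fun r => (srcX_contDiff j l e t r).contDiffAt
  have hxj : ∀ r j', ContDiffAt ℝ 1 (fun p => srcX j l e t p r j') p := fun r j' => contDiffAt_pi.1 (hx r) j'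
  have hb : ∀ j'' s i, ContDiffAt ℝ 1 (fun p : SrcE j l => p.2.2 j'' s i) p := by
    intro j'' s i
    have h1 : ContDiffAt ℝ 1 (fun p : SrcE j l => p.2.2) p := contDiffAt_snd.snd
    exact contDiffAt_pi.1 (contDiffAt_pi.1 (contDiffAt_pi.1 h1 j'') s) i
  have hv : ∀ i, ContDiffAt ℝ 1 (fun p : SrcE j l => p.2.1 i) p := by
    intro i
    have h1 : ContDiffAt ℝ 1 (fun p : SrcE j l => p.2.1) p := contDiffAt_snd.fst
    exact contDiffAt_pi.1 h1 i
  refine contDiffAt_pi.2 fun j' => contDiffAt_pi.2 fun s => contDiffAt_pi.2 fun i => ?_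
  unfold srcPhi
  by_cases hj : j' ≠ j
  · simp only [hj, ne_eq, not_false_eq_true, dif_pos]
    exact hb _ _ _
  · simp only [hj, dif_neg, not_false_eq_true]
    refine ContDiffAt.sum fun r _ => ?_
    refine ContDiffAt.mul ?_ (ContDiffAt.sub (ContDiffAt.sub (hv i) ?_) ?_)
    · refine contDiffAt_inv_real (M := srcV j l e t) (fun a b => ?_) hV s r
      simp only [srcV, Matrix.vandermonde_apply]
      exact (hxj a j).pow _
    · have h1 : ContDiffAt ℝ 1 h (srcX j l e t p r) :=
        (contDiffOn_real_holo hΩ hh).contDiffAt (hΩ.mem_nhds (hp r))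
      exact contDiffAt_pi.1 (ContDiffAt.comp p h1 (hx r)) i
    · refine ContDiffAt.sum fun j'' _ => ContDiffAt.sum fun s _ => ?_
      exact ((hxj r j'').pow _).mul (hb _ _ _)

def badSet (Ω : Set (Fin N → ℂ)) : Set (Fin N → Fin (2 * N + 1) → Fin N → ℂ) :=
  {a | ∃ (x : Fin (2 * N + 1) → (Fin N → ℂ)) (v : Fin N → ℂ), ∀ r, x r ∈ Ω ∧ l (x r j) = t r ∧ h (x r) + pertA a (x r) = v}

def srcD (Ω : Set (Fin N → ℂ)) : Set (SrcE j l) := {p | ∀ r, srcX j l e t p r ∈ Ω}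

theorem kerL_finrank (he : l e = 1) : Module.finrank ℝ (kerL j l) + 1 = 2 * N := by
  have h1 := LinearMap.finrank_range_add_finrank_ker (l.toLinearMap ∘ₗ (LinearMap.proj j : (Fin N → ℂ) →ₗ[ℝ] ℂ))
  have h2 : LinearMap.range (l.toLinearMap ∘ₗ (LinearMap.proj j : (Fin N → ℂ) →ₗ[ℝ] ℂ)) = ⊤ := by
    rw [LinearMap.range_eq_top]
    intro c
    refine ⟨Pi.single j (c • e), ?_⟩
    simp [he, -Complex.real_smul]
  rw [h2, finrank_top, Module.finrank_self, Module.finrank_pi_fintype] at h1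
  simp only [Complex.finrank_real_complex, Finset.sum_const, Finset.card_univ, Fintype.card_fin, smul_eq_mul] at h1
  unfold kerL
  linarith

theorem srcV_det (he : l e = 1) (ht : Function.Injective t) (p : SrcE j l) : (srcV j l e t p).det ≠ 0 := by
  rw [srcV, Matrix.det_vandermonde_ne_zero_iff]
  intro r r' hr
  apply ht
  have h1 : ∀ r, l (srcX j l e t p r j) = t r := by
    intro r
    have : l ((p.1 r : Fin N → ℂ) j) = 0 := (p.1 r).2
    simp [srcX, this, he, -Complex.real_smul]
  rw [← h1 r, ← h1 r']
  exact congrArg l hr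

theorem badSet_subset (he : l e = 1) (ht : Function.Injective t) (Ω : Set (Fin N → ℂ)) :
    badSet h j l t Ω ⊆ srcPhi h j l e t '' srcD j l e t Ω := by
  rintro a ⟨x, v, hx⟩
  have hk : ∀ r, x r - Pi.single j (t r • e) ∈ kerL j l := by
    intro r
    have := (hx r).2.1
    simp [kerL, he, this, -Complex.real_smul]
  let p : SrcE j l := (fun r => ⟨x r - Pi.single j (t r • e), hk r⟩, v, fun j' s i => a j' s i)
  have hpx : ∀ r, srcX j l e t p r = x r := by intro r; simp [srcX, p]
  refine ⟨p, fun r => by rw [hpx]; exact (hx r).1, ?_⟩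
  funext j' s i
  unfold srcPhi
  by_cases hj : j' ≠ j
  · simp [hj, p]
  · simp only [hj, dif_neg, not_false_eq_true]
    push Not at hj
    subst hj
    have hV := srcV_det j' l e t he ht p
    have h1 : ∀ r, (p.2.1 i - h (srcX j' l e t p r) i
      - ∑ j'' : {j'' : Fin N // j'' ≠ j'}, ∑ s : Fin (2 * N + 1), srcX j' l e t p r j'' ^ (s : ℕ) * p.2.2 j'' s i)
        = (srcV j' l e t p).mulVec (fun s => a j' s i) r := by
      intro r
      have h2 := congrFun (hx r).2.2 i
      simp only [Pi.add_apply, pertA] at h2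
      rw [Fintype.sum_eq_add_sum_subtype_ne _ j'] at h2
      simp only [Matrix.mulVec, dotProduct, srcV, Matrix.vandermonde_apply, hpx, p]
      rw [← h2]; ring
    simp_rw [h1]
    have h3 : (srcV j' l e t p)⁻¹.mulVec ((srcV j' l e t p).mulVec (fun s => a j' s i)) = fun s => a j' s i := by
      rw [Matrix.mulVec_mulVec, Matrix.nonsing_inv_mul _ (isUnit_iff_ne_zero.2 hV), Matrix.one_mulVec]
    exact congrFun h3 s

theorem badSet_dimH (he : l e = 1) (ht : Function.Injective t) {Ω : Set (Fin N → ℂ)} (hΩ : IsOpen Ω)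
    (hh : DifferentiableOn ℂ h Ω) :
    dimH (badSet h j l t Ω) ≤ (Module.finrank ℝ (SrcE j l) : ENNReal) := by
  refine (dimH_mono (badSet_subset h j l e t he ht Ω)).trans ?_
  refine (dimH_image_le_of_locally_lipschitzOn fun p hp => ?_).trans ?_
  · obtain ⟨K, u, hu, hL⟩ := (srcPhi_contDiffAt h j l e t hΩ hh p hp (srcV_det j l e t he ht p)).exists_lipschitzOnWith
    exact ⟨K, u, mem_nhdsWithin_of_mem_nhds hu, hL⟩
  · refine (dimH_mono (subset_univ _)).trans ?_
    rw [Real.dimH_univ_eq_finrank]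

theorem srcE_finrank (he : l e = 1) :
    Module.finrank ℝ (SrcE j l) < Module.finrank ℝ (Fin N → Fin (2 * N + 1) → Fin N → ℂ) := by
  have hk := kerL_finrank j l e he
  have hN : 1 ≤ N := by have := j.2; omega
  simp only [Module.finrank_prod, Module.finrank_pi_fintype, Complex.finrank_real_complex, Finset.sum_const,
    Finset.card_univ, Fintype.card_fin, smul_eq_mul, Fintype.card_subtype_compl, Fintype.card_unique, ne_eq]
  obtain ⟨n, rfl⟩ : ∃ n, N = n + 1 := ⟨N - 1, by omega⟩
  have : Module.finrank ℝ (kerL j l) = 2 * n + 1 := by omega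
  rw [this]
  simp only [Nat.add_sub_cancel]
  nlinarith
end bad

theorem exists_rat_inj (k : ℕ) {a b : ℝ} (hab : a < b) :
    ∃ t : Fin k → ℚ, Function.Injective t ∧ ∀ r, (t r : ℝ) ∈ Ioo a b := by
  obtain ⟨p, hp1, hp2⟩ := exists_rat_btwn hab
  obtain ⟨q, hq1, hq2⟩ := exists_rat_btwn hp2
  have hpq : p < q := by exact_mod_cast hq1
  have hinf : (Ioo p q).Infinite := Ioo_infinite hpq
  let emb := hinf.natEmbedding
  refine ⟨fun r => (emb (r : ℕ) : ℚ), fun r r' hr => ?_, fun r => ?_⟩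
  · exact Fin.ext (emb.injective (Subtype.ext hr))
  · have h1 := (emb (r : ℕ)).2
    have h2 : (p : ℝ) < ((emb (r : ℕ) : ℚ) : ℝ) := by exact_mod_cast h1.1
    have h3 : ((emb (r : ℕ) : ℚ) : ℝ) < q := by exact_mod_cast h1.2
    exact ⟨hp1.trans h2, h3.trans hq2⟩

theorem conn_bad {N : ℕ} (h : (Fin N → ℂ) → (Fin N → ℂ)) (j : Fin N) (l : ℂ →L[ℝ] ℝ) {Ω C : Set (Fin N → ℂ)}
    (a : Fin N → Fin (2 * N + 1) → Fin N → ℂ) (v : Fin N → ℂ) (hC : IsPreconnected C) (hCΩ : C ⊆ Ω)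
    (hv : ∀ x ∈ C, h x + pertA a x = v) {x y : Fin N → ℂ} (hx : x ∈ C) (hy : y ∈ C) (hxy : l (x j) < l (y j)) :
    ∃ t : Fin (2 * N + 1) → ℚ, Function.Injective t ∧ a ∈ badSet h j l (fun r => (t r : ℝ)) Ω := by
  obtain ⟨t, ht, ht2⟩ := exists_rat_inj (2 * N + 1) hxy
  have hc : ContinuousOn (fun z : Fin N → ℂ => l (z j)) C := by fun_prop
  have h1 := hC.intermediate_value hx hy hc
  have h2 : ∀ r, ∃ z ∈ C, l (z j) = t r := fun r => h1 (Ioo_subset_Icc_self (ht2 r))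
  choose z hz hz2 using h2
  exact ⟨t, ht, z, v, fun r => ⟨hCΩ (hz r), hz2 r, hv _ (hz r)⟩⟩

theorem exists_good_pert {N : ℕ} (h : (Fin N → ℂ) → (Fin N → ℂ)) {Ω : Set (Fin N → ℂ)} (hΩ : IsOpen Ω)
    (hh : DifferentiableOn ℂ h Ω) {ε : ℝ} (hε : 0 < ε) :
    ∃ a : Fin N → Fin (2 * N + 1) → Fin N → ℂ, ‖a‖ < ε ∧ ∀ (v : Fin N → ℂ) (C : Set (Fin N → ℂ)),
      IsPreconnected C → C ⊆ Ω → (∀ x ∈ C, h x + pertA a x = v) → C.Subsingleton := by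
  set d := Module.finrank ℝ (Fin N → Fin (2 * N + 1) → Fin N → ℂ) with hd
  set T := {t : Fin (2 * N + 1) → ℚ // Function.Injective t}
  set B : Set (Fin N → Fin (2 * N + 1) → Fin N → ℂ) :=
    ⋃ q : Fin N × T, badSet h q.1 Complex.reCLM (fun r => (q.2.1 r : ℝ)) Ω ∪ badSet h q.1 Complex.imCLM (fun r => (q.2.1 r : ℝ)) Ω with hB
  have hdim : dimH B ≤ ((d - 1 : ℕ) : ENNReal) := by
    rw [hB, dimH_iUnion]
    refine iSup_le fun q => ?_
    have hinj : Function.Injective (fun r => (q.2.1 r : ℝ)) := fun r r' hr => q.2.2 (Rat.cast_injective (α := ℝ) hr)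
    rw [dimH_union]
    refine max_le ?_ ?_
    · refine (badSet_dimH h q.1 Complex.reCLM 1 _ (by simp) hinj hΩ hh).trans ?_
      have := srcE_finrank q.1 Complex.reCLM 1 (by simp)
      exact_mod_cast (by omega)
    · refine (badSet_dimH h q.1 Complex.imCLM Complex.I _ (by simp) hinj hΩ hh).trans ?_
      have := srcE_finrank q.1 Complex.imCLM Complex.I (by simp)
      exact_mod_cast (by omega)
  rcases Nat.eq_zero_or_pos N with hN | hN
  · subst hN
    exact ⟨0, by rw [norm_zero]; exact hε, fun v C _ _ _ => fun x _ y _ => Subsingleton.elim _ _⟩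
  have hdpos : 0 < d := by
    rw [hd]
    have := srcE_finrank (⟨0, hN⟩ : Fin N) Complex.reCLM 1 (by simp)
    omega
  have hlt : dimH B < (d : ENNReal) := hdim.trans_lt (by exact_mod_cast (by omega))
  obtain ⟨a, ha1, ha2⟩ := (dense_compl_of_dimH_lt_finrank hlt).exists_dist_lt 0 hε
  refine ⟨a, by rwa [dist_comm, dist_zero_right] at ha2, fun v C hC hCΩ hv x hx y hy => ?_⟩
  have key : ∀ (j : Fin N) (l : ℂ →L[ℝ] ℝ), (∀ t : Fin (2 * N + 1) → ℚ, Function.Injective t → a ∉ badSet h j l (fun r => (t r : ℝ)) Ω) →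
      l (x j) = l (y j) := by
    intro j l hl
    rcases lt_trichotomy (l (x j)) (l (y j)) with h1 | h1 | h1
    · obtain ⟨t, ht, ht2⟩ := conn_bad h j l a v hC hCΩ hv hx hy h1
      exact absurd ht2 (hl t ht)
    · exact h1
    · obtain ⟨t, ht, ht2⟩ := conn_bad h j l a v hC hCΩ hv hy hx h1
      exact absurd ht2 (hl t ht)
  funext j
  apply Complex.ext
  · exact key j Complex.reCLM fun t ht hb => ha1 (mem_iUnion.2 ⟨(j, ⟨t, ht⟩), Or.inl hb⟩)
  · exact key j Complex.imCLM fun t ht hb => ha1 (mem_iUnion.2 ⟨(j, ⟨t, ht⟩), Or.inr hb⟩)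

end Part12

section Part13
theorem clopen_sep {X : Type*} [TopologicalSpace X] [CompactSpace X] [T2Space X] {A B : Set X}
    (hA : IsClosed A) (hB : IsClosed B)
    (h : ∀ C : Set X, IsPreconnected C → (C ∩ A).Nonempty → (C ∩ B).Nonempty → False) :
    ∃ Z : Set X, IsClopen Z ∧ A ⊆ Z ∧ Disjoint Z B := by
  have h1 : ∀ a ∈ A, ∀ b ∈ B, ∃ Z : Set X, IsClopen Z ∧ a ∈ Z ∧ b ∉ Z := by
    intro a ha b hb
    by_contra hcon
    push Not at hcon
    have : b ∈ connectedComponent a := by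
      rw [connectedComponent_eq_iInter_isClopen]
      exact mem_iInter.2 fun s => hcon s.1 s.2.1 s.2.2
    exact h _ isPreconnected_connectedComponent ⟨a, mem_connectedComponent, ha⟩ ⟨b, this, hb⟩
  have h2 : ∀ a ∈ A, ∃ Z : Set X, IsClopen Z ∧ a ∈ Z ∧ Disjoint Z B := by
    intro a ha
    refine hB.isCompact.induction_on (p := fun B' => ∃ Z : Set X, IsClopen Z ∧ a ∈ Z ∧ Disjoint Z B')
      ⟨univ, isClopen_univ, mem_univ _, disjoint_empty _⟩ ?_ ?_ ?_
    · rintro s t hst ⟨Z, h1, h2, h3⟩; exact ⟨Z, h1, h2, h3.mono_right hst⟩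
    · rintro s t ⟨Z, h1, h2, h3⟩ ⟨Z', h1', h2', h3'⟩
      exact ⟨Z ∩ Z', h1.inter h1', ⟨h2, h2'⟩, disjoint_union_right.2
        ⟨h3.mono_left inter_subset_left, h3'.mono_left inter_subset_right⟩⟩
    · intro b hb
      obtain ⟨Z, hZ, hZa, hZb⟩ := h1 a ha b hb
      exact ⟨Zᶜ, mem_nhdsWithin_of_mem_nhds (hZ.compl.isOpen.mem_nhds hZb), Z, hZ, hZa, disjoint_compl_right⟩
  refine hA.isCompact.induction_on (p := fun A' => ∃ Z : Set X, IsClopen Z ∧ A' ⊆ Z ∧ Disjoint Z B)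
      ⟨∅, isClopen_empty, empty_subset _, empty_disjoint _⟩ ?_ ?_ ?_
  · rintro s t hst ⟨Z, h1, h2, h3⟩; exact ⟨Z, h1, hst.trans h2, h3⟩
  · rintro s t ⟨Z, h1, h2, h3⟩ ⟨Z', h1', h2', h3'⟩
    exact ⟨Z ∪ Z', h1.union h1', union_subset_union h2 h2', disjoint_union_left.2 ⟨h3, h3'⟩⟩
  · intro a ha
    obtain ⟨Z, hZ, hZa, hZb⟩ := h2 a ha
    exact ⟨Z, mem_nhdsWithin_of_mem_nhds (hZ.isOpen.mem_nhds hZa), Z, hZ, Subset.rfl, hZb⟩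

theorem compact_sep {X : Type*} [TopologicalSpace X] [T2Space X] {T A B : Set X}
    (hT : IsCompact T) (hA : IsClosed A) (hB : IsClosed B)
    (h : ∀ C : Set X, IsPreconnected C → C ⊆ T → (C ∩ A).Nonempty → (C ∩ B).Nonempty → False) :
    ∃ E₁ E₂ : Set X, IsCompact E₁ ∧ IsCompact E₂ ∧ Disjoint E₁ E₂ ∧ T = E₁ ∪ E₂ ∧ T ∩ A ⊆ E₁ ∧ T ∩ B ⊆ E₂ := by
  haveI : CompactSpace T := isCompact_iff_compactSpace.1 hT
  obtain ⟨Z, hZ, hZA, hZB⟩ := clopen_sep (X := T) (hA.preimage continuous_subtype_val) (hB.preimage continuous_subtype_val)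
    (by
      rintro C hC ⟨a, ha, ha'⟩ ⟨b, hb, hb'⟩
      exact h (Subtype.val '' C) (hC.image _ continuous_subtype_val.continuousOn) (by rintro _ ⟨x, _, rfl⟩; exact x.2)
        ⟨a, ⟨a, ha, rfl⟩, ha'⟩ ⟨b, ⟨b, hb, rfl⟩, hb'⟩)
  refine ⟨Subtype.val '' Z, Subtype.val '' Zᶜ, hZ.isClosed.isCompact.image continuous_subtype_val,
    hZ.compl.isClosed.isCompact.image continuous_subtype_val, ?_, ?_, ?_, ?_⟩
  · exact (disjoint_image_iff Subtype.val_injective).2 disjoint_compl_right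
  · rw [← image_union, union_compl_self, image_univ, Subtype.range_val]
  · rintro x ⟨hx, hxA⟩
    exact ⟨⟨x, hx⟩, hZA hxA, rfl⟩
  · rintro x ⟨hx, hxB⟩
    exact ⟨⟨x, hx⟩, fun hz => (disjoint_left.1 hZB) hz hxB, rfl⟩

theorem fibre_sep {X Y : Type*} [TopologicalSpace X] [T2Space X] [MetricSpace Y] {E A B : Set X} {K : Set Y} (hK : IsCompact K)
    {G : X → Y} (hE : IsCompact E) (hG : ContinuousOn G E) (hA : IsClosed A) (hB : IsClosed B) (hAB : Disjoint A B)
    (hfib : ∀ (v : Y) (C : Set X), IsPreconnected C → C ⊆ E → (∀ x ∈ C, G x = v) → C.Subsingleton) :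
    ∃ η > 0, ∀ v ∈ K, ∀ C : Set X, IsPreconnected C → C ⊆ E → (∀ x ∈ C, dist (G x) v < η) →
      (C ∩ A).Nonempty → (C ∩ B).Nonempty → False := by
  have h1 : ∀ v : Y, ∃ η > 0, ∀ C : Set X, IsPreconnected C → C ⊆ E → (∀ x ∈ C, dist (G x) v < η) →
      (C ∩ A).Nonempty → (C ∩ B).Nonempty → False := by
    intro v
    have hT : IsCompact (E ∩ G ⁻¹' {v}) :=
      hE.of_isClosed_subset (hG.preimage_isClosed_of_isClosed hE.isClosed isClosed_singleton) inter_subset_left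
    obtain ⟨E₁, E₂, hE1, hE2, hd, hU, hA1, hB2⟩ := compact_sep hT hA hB (by
      rintro C hC hCT ⟨a, ha, ha'⟩ ⟨b, hb, hb'⟩
      have := hfib v C hC (hCT.trans inter_subset_left) (fun x hx => (hCT hx).2) ha hb
      subst this
      exact disjoint_left.1 hAB ha' hb')
    obtain ⟨O₁, O₂, hO1, hO2, h11, h22, hdO⟩ := SeparatedNhds.of_isCompact_isCompact hE1 hE2 hd
    set U₁ := O₁ \ B
    set U₂ := O₂ \ A
    have hU1 : IsOpen U₁ := hO1.sdiff hB
    have hU2 : IsOpen U₂ := hO2.sdiff hA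
    have hR : IsCompact (E \ (U₁ ∪ U₂)) := hE.diff (hU1.union hU2)
    have hpos : ∀ x ∈ E \ (U₁ ∪ U₂), 0 < dist (G x) v := by
      rintro x ⟨hx, hx2⟩
      rw [dist_pos]
      intro hv
      apply hx2
      have hxT : x ∈ E ∩ G ⁻¹' {v} := ⟨hx, hv⟩
      have hxT' := hxT
      rw [hU] at hxT'
      rcases hxT' with h | h
      · exact Or.inl ⟨h11 h, fun hb => disjoint_left.1 hd h (hB2 ⟨hxT, hb⟩)⟩
      · exact Or.inr ⟨h22 h, fun hb => disjoint_left.1 hd (hA1 ⟨hxT, hb⟩) h⟩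
    have hcont : ContinuousOn (fun x => dist (G x) v) (E \ (U₁ ∪ U₂)) :=
      (continuous_id.dist continuous_const).comp_continuousOn (hG.mono diff_subset)
    obtain ⟨η, hη, hη2⟩ := exists_gt_bound hR hcont hpos
    refine ⟨η, hη, ?_⟩
    rintro C hC hCE hCη ⟨a, ha, ha'⟩ ⟨b, hb, hb'⟩
    have hsub : C ⊆ U₁ ∪ U₂ := by
      intro x hx
      by_contra hx2
      exact absurd (hη2 x ⟨hCE hx, hx2⟩) (not_le.2 (hCη x hx))
    obtain ⟨y, hy, hy1, hy2⟩ := hC U₁ U₂ hU1 hU2 hsub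
      ⟨a, ha, (hsub ha).resolve_right fun h => h.2 ha'⟩ ⟨b, hb, (hsub hb).resolve_left fun h => h.2 hb'⟩
    exact disjoint_left.1 hdO hy1.1 hy2.1
  choose η hη hη2 using h1
  obtain ⟨δ, hδ, hδ2⟩ := lebesgue_number_lemma_of_metric hK (c := fun v : Y => Metric.ball v (η v))
    (fun v => Metric.isOpen_ball) (fun v _ => mem_iUnion.2 ⟨v, Metric.mem_ball_self (hη v)⟩)
  refine ⟨δ, hδ, fun v hv C hC hCE hCv => ?_⟩
  obtain ⟨w, hw⟩ := hδ2 v hv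
  exact hη2 w C hC hCE fun x hx => hw (hCv x hx)

theorem root_const {X : Type*} [TopologicalSpace X] {η : ℝ} (hη : 0 < η) {n : ℕ} (hn : 2 / η < n) {C : Set X}
    (hC : IsPreconnected C) {G : X → ℂ} (hG : ContinuousOn G C) (h : ∀ x ∈ C, ‖G x ^ n - 1‖ ≤ 1 / 2) :
    ∃ ζ : ℂ, ‖ζ‖ = 1 ∧ ∀ x ∈ C, ‖G x - ζ‖ < η := by
  rcases C.eq_empty_or_nonempty with h0 | ⟨x₀, hx₀⟩
  · exact ⟨1, by simp, by simp [h0]⟩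
  have hnpos : (0 : ℝ) < n := lt_trans (by positivity) hn
  have hn0 : n ≠ 0 := by rintro rfl; simp at hnpos
  have hnC : (n : ℂ) ≠ 0 := by exact_mod_cast hn0
  set τ : X → ℂ := fun x => Complex.exp (Complex.log (G x ^ n) / n) with hτ
  have hlog : ∀ x ∈ C, ‖Complex.log (G x ^ n)‖ ≤ 3 / 4 := by
    intro x hx
    have h1 := Complex.norm_log_one_add_half_le_self (h x hx)
    rw [add_sub_cancel] at h1
    have := h x hx
    linarith
  have hslit : ∀ x ∈ C, G x ^ n ∈ Complex.slitPlane := by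
    intro x hx
    have h1 := h x hx
    have h2 := (abs_le.1 ((Complex.abs_re_le_norm (G x ^ n - 1)).trans h1)).1
    rw [Complex.sub_re, Complex.one_re] at h2
    exact Or.inl (by linarith)
  have hne : ∀ x ∈ C, G x ^ n ≠ 0 := fun x hx => Complex.slitPlane_ne_zero (hslit x hx)
  have hτn : ∀ x ∈ C, τ x ^ n = G x ^ n := by
    intro x hx
    rw [hτ, ← Complex.exp_nat_mul, mul_div_cancel₀ _ hnC, Complex.exp_log (hne x hx)]
  have hτ1 : ∀ x ∈ C, ‖τ x - 1‖ < η := by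
    intro x hx
    have hb : ‖Complex.log (G x ^ n) / n‖ ≤ 3 / 4 / n := by
      rw [norm_div, Complex.norm_natCast]
      exact div_le_div_of_nonneg_right (hlog x hx) hnpos.le
    have hn1 : (1 : ℝ) ≤ n := by exact_mod_cast Nat.one_le_iff_ne_zero.2 hn0
    have hb1 : (3 : ℝ) / 4 / n ≤ 1 := by rw [div_le_one hnpos]; linarith
    have h1 := Complex.norm_exp_sub_one_le (hb.trans hb1)
    have h2 : 2 * (3 / 4 / (n : ℝ)) < η := by
      rw [div_lt_iff₀ hη] at hn
      rw [← mul_div_assoc, div_lt_iff₀ hnpos]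
      linarith
    linarith
  have hτ0 : ∀ x, τ x ≠ 0 := fun x => Complex.exp_ne_zero _
  have hσc : ContinuousOn (fun x => G x / τ x) C := by
    refine hG.div ?_ fun x _ => hτ0 x
    exact ((ContinuousOn.clog (hG.pow n) hslit).div_const _).cexp
  have hσ : MapsTo (fun x => G x / τ x) C {z : ℂ | z ^ n = 1} := by
    intro x hx
    simp only [mem_setOf_eq, div_pow, hτn x hx]
    exact div_self (hne x hx)
  have hfin : {z : ℂ | z ^ n = 1}.Finite := by
    refine ((Polynomial.nthRootsFinset n (1 : ℂ)).finite_toSet).subset fun z hz => ?_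
    exact (Polynomial.mem_nthRootsFinset (Nat.pos_of_ne_zero hn0) 1).2 hz
  have hconst : ∀ x ∈ C, G x / τ x = G x₀ / τ x₀ := by
    intro x hx
    exact hC.constant_of_mapsTo hfin.isDiscrete hσc hσ hx hx₀
  refine ⟨G x₀ / τ x₀, Complex.norm_eq_one_of_pow_eq_one (hσ hx₀) hn0, fun x hx => ?_⟩
  have h1 : G x = (G x₀ / τ x₀) * τ x := by rw [← hconst x hx, div_mul_cancel₀ _ (hτ0 x)]
  have h2 : G x - G x₀ / τ x₀ = (G x₀ / τ x₀) * (τ x - 1) := by rw [mul_sub, ← h1, mul_one]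
  rw [h2, norm_mul, Complex.norm_eq_one_of_pow_eq_one (hσ hx₀) hn0, one_mul]
  exact hτ1 x hx

end Part13

section Part14
theorem ShellD.reduce_core {N m : ℕ} {Ω S : Set (Fin N → ℂ)} (hNm : N ≤ m) {F : Fin (m + 1) → holA Ω}
    {W L : Set (Fin N → ℂ)} (hS : IsCompact S) (D : ShellD Ω S F W L)
    (hfib : ∀ (v : Fin N → ℂ) (C : Set (Fin N → ℂ)), IsPreconnected C → C ⊆ {x ∈ Ω | fv F x (Fin.last m) ≠ 0} →
      (∀ x ∈ C, (fun i : Fin N => fv F x (Fin.castLE hNm i).castSucc / fv F x (Fin.last m)) = v) → C.Subsingleton) :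
    ∃ (F' : Fin m → holA Ω) (W' L' : Set (Fin N → ℂ)), ShellD Ω S F' W' L' := by
  have hcF : ContinuousOn (fv F) L := (fv_differentiableOn F).continuousOn.mono D.subL
  have hcFi : ∀ i, ContinuousOn (fun x => fv F x i) L := fun i => continuousOn_pi.1 hcF i
  have hcu : ContinuousOn (fun x => ‖fv F x‖) L := hcF.norm
  obtain ⟨a, ha, ha2⟩ := exists_lt_bound hS (hcu.mono (D.subS.trans D.subW)) D.lt
  obtain ⟨b, hb, hb2⟩ := exists_gt_bound (D.isCompact.diff D.isOpen) (hcu.mono diff_subset) D.gt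
  obtain ⟨c, hc1, hcb⟩ := exists_between hb
  have hLc := D.isCompact
  have hLcl := hLc.isClosed
  set G : (Fin N → ℂ) → (Fin N → ℂ) := fun x i => fv F x (Fin.castLE hNm i).castSucc / fv F x (Fin.last m) with hG
  set E : Set (Fin N → ℂ) := {x ∈ L | c ≤ ‖fv F x‖ ∧ 1 ≤ ‖fv F x (Fin.last m)‖} with hEdef
  have hEeq : E = (L ∩ (fun x => ‖fv F x‖) ⁻¹' Ici c) ∩ (L ∩ (fun x => ‖fv F x (Fin.last m)‖) ⁻¹' Ici 1) := by
    ext x; simp only [hEdef, mem_setOf_eq, mem_inter_iff, mem_preimage, mem_Ici]; tauto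
  have hEL : E ⊆ L := fun x hx => hx.1
  have hEc : IsCompact E := by
    refine hLc.of_isClosed_subset ?_ hEL
    rw [hEeq]
    exact (hcu.preimage_isClosed_of_isClosed hLcl isClosed_Ici).inter
      ((hcFi _).norm.preimage_isClosed_of_isClosed hLcl isClosed_Ici)
  have hE0 : ∀ x ∈ E, fv F x (Fin.last m) ≠ 0 := by
    intro x hx h0
    have := hx.2.2
    rw [h0, norm_zero] at this
    linarith
  have hGc : ContinuousOn G E := by
    refine continuousOn_pi.2 fun i => ?_
    exact ((hcFi _).mono hEL).div ((hcFi _).mono hEL) hE0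
  set A : Set (Fin N → ℂ) := L ∩ (fun x => ‖fv F x‖) ⁻¹' Iic c with hA
  have hAcl : IsClosed A := hcu.preimage_isClosed_of_isClosed hLcl isClosed_Iic
  have hBcl : IsClosed (L \ W) := (hLc.diff D.isOpen).isClosed
  have hAB : Disjoint A (L \ W) := by
    rw [disjoint_left]
    rintro x ⟨_, hx⟩ hx2
    have h1 : ‖fv F x‖ ≤ c := hx
    have := hb2 x hx2
    linarith
  obtain ⟨η, hη, hη2⟩ := fibre_sep (isCompact_closedBall (0 : Fin N → ℂ) 1) hEc hGc hAcl hBcl hAB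
    (fun v C hC hCE hCv => hfib v C hC (fun x hx => ⟨D.subL (hEL (hCE hx)), hE0 x (hCE hx)⟩) hCv)
  -- choice of the exponent
  have ha' : max a 0 < 1 := max_lt ha one_pos
  have e1 : ∀ᶠ n : ℕ in Filter.atTop, max a 0 ^ n < 1 / 2 :=
    (tendsto_pow_atTop_nhds_zero_of_lt_one (le_max_right a 0) ha').eventually_lt_const (by norm_num)
  have e2 : ∀ᶠ n : ℕ in Filter.atTop, 3 ≤ c ^ n :=
    (tendsto_pow_atTop_atTop_of_one_lt hc1).eventually_ge_atTop 3
  have e3 : ∀ᶠ n : ℕ in Filter.atTop, 2 / η < (n : ℝ) :=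
    tendsto_natCast_atTop_atTop.eventually_gt_atTop _
  obtain ⟨n, hn1, hn2, hn3⟩ := (e1.and (e2.and e3)).exists
  have hn0 : n ≠ 0 := by rintro rfl; norm_num at hn2
  set F' : Fin m → holA Ω := fun i => F i.castSucc ^ n - F (Fin.last m) ^ n with hF'
  have hF'v : ∀ x i, fv F' x i = fv F x i.castSucc ^ n - fv F x (Fin.last m) ^ n := by
    intro x i; simp [fv, hF']
  have hcF' : ContinuousOn (fun x => ‖fv F' x‖) L := ((fv_differentiableOn F').continuousOn.mono D.subL).norm
  have hS' : ∀ x ∈ S, ‖fv F' x‖ < 1 := by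
    intro x hx
    rw [pi_norm_lt_iff one_pos]
    intro i
    have h1 : ∀ i, ‖fv F x i ^ n‖ < 1 / 2 := by
      intro i
      rw [norm_pow]
      have h2 : ‖fv F x i‖ ≤ max a 0 := ((norm_le_pi_norm _ i).trans (ha2 x hx)).trans (le_max_left _ _)
      exact (pow_le_pow_left₀ (norm_nonneg _) h2 n).trans_lt hn1
    rw [hF'v]
    have := norm_sub_le (fv F x i.castSucc ^ n) (fv F x (Fin.last m) ^ n)
    have h2 := h1 i.castSucc
    have h3 := h1 (Fin.last m)
    linarith
  set T : Set (Fin N → ℂ) := L ∩ (fun x => ‖fv F' x‖) ⁻¹' Iic 1 with hT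
  have hTcl : IsClosed T := hcF'.preimage_isClosed_of_isClosed hLcl isClosed_Iic
  set T₁ : Set (Fin N → ℂ) := T ∩ (L ∩ (fun x => ‖fv F x‖) ⁻¹' Ici c) with hT1
  have hT1c : IsCompact T₁ := hLc.of_isClosed_subset
    (hTcl.inter (hcu.preimage_isClosed_of_isClosed hLcl isClosed_Ici)) fun x hx => hx.1.1
  have hgn : ∀ x ∈ T₁, 2 ≤ ‖fv F x (Fin.last m) ^ n‖ := by
    rintro x ⟨⟨hxL, hxT⟩, _, hxc⟩
    have hxT' : ‖fv F' x‖ ≤ 1 := hxT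
    have hxc' : c ≤ ‖fv F x‖ := hxc
    have hex : ∃ i, c ≤ ‖fv F x i‖ := by
      by_contra hcon
      push Not at hcon
      have := (pi_norm_lt_iff (x := fv F x) (by linarith : (0:ℝ) < c)).2 hcon
      linarith
    obtain ⟨i, hi⟩ := hex
    have hi2 : 3 ≤ ‖fv F x i ^ n‖ := by
      rw [norm_pow]
      exact hn2.trans (pow_le_pow_left₀ (by linarith) hi n)
    induction i using Fin.lastCases with
    | last => linarith
    | cast i =>
      have h1 := (norm_le_pi_norm (fv F' x) i).trans hxT'
      rw [hF'v] at h1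
      have h2 := norm_sub_norm_le (fv F x i.castSucc ^ n) (fv F x (Fin.last m) ^ n)
      linarith
  have hT1E : T₁ ⊆ E := by
    intro x hx
    refine ⟨hx.1.1, hx.2.2, ?_⟩
    have h1 := hgn x hx
    by_contra hcon
    push Not at hcon
    rw [norm_pow] at h1
    have := pow_le_one₀ (n := n) (norm_nonneg _) hcon.le
    linarith
  have hGn : ∀ x ∈ T₁, ∀ i, ‖G x i ^ n - 1‖ ≤ 1 / 2 := by
    intro x hx i
    have h1 := hgn x hx
    have hxT' : ‖fv F' x‖ ≤ 1 := hx.1.2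
    have h2 := (norm_le_pi_norm (fv F' x) (Fin.castLE hNm i)).trans hxT'
    rw [hF'v] at h2
    have h0 : fv F x (Fin.last m) ^ n ≠ 0 := pow_ne_zero _ (hE0 x (hT1E hx))
    have h3 : G x i ^ n - 1 = (fv F x (Fin.castLE hNm i).castSucc ^ n - fv F x (Fin.last m) ^ n) / fv F x (Fin.last m) ^ n := by
      rw [sub_div, div_self h0, hG, div_pow]
    rw [h3, norm_div, div_le_iff₀ (by linarith)]
    linarith
  obtain ⟨E₁, E₂, hE1, hE2, hd, hU, hA1, hB2⟩ := compact_sep hT1c hAcl hBcl (by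
    intro C hC hCT hCA hCB
    have h1 : ∀ i, ∃ ζ : ℂ, ‖ζ‖ = 1 ∧ ∀ x ∈ C, ‖G x i - ζ‖ < η := fun i =>
      root_const hη hn3 hC (continuousOn_pi.1 (hGc.mono (hCT.trans hT1E)) i) fun x hx => hGn x (hCT hx) i
    choose ζ hζ hζ2 using h1
    refine hη2 ζ ?_ C hC (hCT.trans hT1E) (fun x hx => ?_) hCA hCB
    · rw [mem_closedBall_zero_iff, pi_norm_le_iff_of_nonneg zero_le_one]
      exact fun i => (hζ i).le
    · rw [dist_eq_norm, pi_norm_lt_iff hη]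
      exact fun i => hζ2 i x hx)
  set L' : Set (Fin N → ℂ) := (T ∩ A) ∪ E₁ with hL'
  have hE1T : E₁ ⊆ T₁ := hU ▸ subset_union_left
  have hE2T : E₂ ⊆ T₁ := hU ▸ subset_union_right
  have hL'c : IsCompact L' := (hLc.of_isClosed_subset (hTcl.inter hAcl) fun x hx => hx.2.1).union hE1
  have hL'W : L' ⊆ W \ E₂ := by
    rintro x (⟨hxT, hxA⟩ | hx)
    · refine ⟨?_, fun hx2 => ?_⟩
      · by_contra hW
        exact disjoint_left.1 hAB hxA ⟨hxT.1, hW⟩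
      · exact disjoint_left.1 hd (hA1 ⟨hE2T hx2, hxA⟩) hx2
    · refine ⟨?_, fun hx2 => disjoint_left.1 hd hx hx2⟩
      by_contra hW
      exact disjoint_left.1 hd hx (hB2 ⟨hE1T hx, (hE1T hx).1.1, hW⟩)
  have hTsub : T ⊆ L' ∪ E₂ := by
    intro x hx
    rcases le_total ‖fv F x‖ c with h | h
    · exact Or.inl (Or.inl ⟨hx, hx.1, h⟩)
    · have : x ∈ T₁ := ⟨hx, hx.1, h⟩
      rw [hU] at this
      rcases this with h | h
      · exact Or.inl (Or.inr h)
      · exact Or.inr h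
  have hSL' : S ⊆ L' := by
    intro x hx
    have hxL := D.subW (D.subS hx)
    refine Or.inl ⟨⟨hxL, (hS' x hx).le⟩, hxL, ?_⟩
    have := D.lt x hx
    show ‖fv F x‖ ≤ c
    linarith
  obtain ⟨M, hM, hM1, hM2⟩ := exists_compact_between hL'c (D.isOpen.sdiff hE2.isClosed) hL'W
  refine ⟨F', interior M, M, isOpen_interior, hM, hSL'.trans hM1, interior_subset,
    fun x hx => D.subL (D.subW (hM2 hx).1), hS', ?_⟩
  rintro x ⟨hxM, hxi⟩
  by_contra hcon
  push Not at hcon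
  rcases hTsub ⟨D.subW (hM2 hxM).1, hcon⟩ with h | h
  · exact hxi (hM1 h)
  · exact (hM2 hxM).2 h

end Part14

section Part15
def pertAA {N : ℕ} (Ω : Set (Fin N → ℂ)) (a : Fin N → Fin (2 * N + 1) → Fin N → ℂ) (i : Fin N) : holA Ω :=
  ∑ j, ∑ s : Fin (2 * N + 1), a j s i • coordA Ω j ^ (s : ℕ)

theorem pertAA_apply {N : ℕ} (Ω : Set (Fin N → ℂ)) (a : Fin N → Fin (2 * N + 1) → Fin N → ℂ) (i : Fin N) (x : Fin N → ℂ) :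
    (pertAA Ω a i : (Fin N → ℂ) → ℂ) x = pertA a x i := by
  simp only [pertAA, pertA, AddSubmonoidClass.coe_finset_sum, Finset.sum_apply]
  refine Finset.sum_congr rfl fun j _ => Finset.sum_congr rfl fun s _ => ?_
  simp [coordA, mul_comm]

theorem pertA_bound {N : ℕ} (a : Fin N → Fin (2 * N + 1) → Fin N → ℂ) (x : Fin N → ℂ) (i : Fin N) {R : ℝ} (hR : 1 ≤ R)
    (hx : ‖x‖ ≤ R) : ‖pertA a x i‖ ≤ N * ((2 * N + 1 : ℕ) * (R ^ (2 * N) * ‖a‖)) := by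
  unfold pertA
  refine (norm_sum_le_of_le (f := fun j => ∑ s : Fin (2 * N + 1), x j ^ (s : ℕ) * a j s i) (n := fun _ => (2 * N + 1 : ℕ) * (R ^ (2 * N) * ‖a‖)) _ fun j _ => ?_).trans (by simp)
  refine (norm_sum_le_of_le (n := fun _ => R ^ (2 * N) * ‖a‖) _ fun s _ => ?_).trans (by simp)
  rw [norm_mul, norm_pow]
  have h1 : ‖x j‖ ^ (s : ℕ) ≤ R ^ (2 * N) :=
    (pow_le_pow_left₀ (norm_nonneg _) ((norm_le_pi_norm x j).trans hx) _).trans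
      (pow_le_pow_right₀ hR (by have := s.2; omega))
  have h2 : ‖a j s i‖ ≤ ‖a‖ := (norm_le_pi_norm (a j s) i).trans ((norm_le_pi_norm (a j) s).trans (norm_le_pi_norm a j))
  exact mul_le_mul h1 h2 (norm_nonneg _) (by positivity)

theorem ShellD.reduce {N m : ℕ} {Ω S : Set (Fin N → ℂ)} (hΩ : IsOpen Ω) (hNm : N ≤ m) {F : Fin (m + 1) → holA Ω}
    {W L : Set (Fin N → ℂ)} (hS : IsCompact S) (D : ShellD Ω S F W L) :
    ∃ (F' : Fin m → holA Ω) (W' L' : Set (Fin N → ℂ)), ShellD Ω S F' W' L' := by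
  obtain ⟨δ, hδ, hpert⟩ := D.perturb hS
  obtain ⟨R₀, hR₀⟩ := D.isCompact.exists_bound_of_continuousOn (f := fun x => x) continuousOn_id
  have hcF : ContinuousOn (fv F) Ω := (fv_differentiableOn F).continuousOn
  obtain ⟨Q₀, hQ₀⟩ := D.isCompact.exists_bound_of_continuousOn (hcF.mono D.subL)
  set R := max R₀ 1
  set Q := max Q₀ 1
  set Z : ℝ := N * ((2 * N + 1 : ℕ) * R ^ (2 * N)) with hZ
  have hZ0 : 0 ≤ Z := by positivity
  have hQ0 : 0 < Q := lt_max_of_lt_right one_pos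
  set Ω₀ : Set (Fin N → ℂ) := {x ∈ Ω | fv F x (Fin.last m) ≠ 0} with hΩ₀
  have hΩ₀o : IsOpen Ω₀ := by
    have := (continuousOn_pi.1 hcF (Fin.last m)).isOpen_inter_preimage hΩ (isOpen_compl_singleton (x := (0:ℂ)))
    exact this
  set h : (Fin N → ℂ) → (Fin N → ℂ) := fun x i => fv F x (Fin.castLE hNm i).castSucc / fv F x (Fin.last m) with hh
  have hhd : DifferentiableOn ℂ h Ω₀ := by
    refine differentiableOn_pi.2 fun i => ?_
    have h1 : ∀ k, DifferentiableOn ℂ (fun x => fv F x k) Ω₀ := fun k => (F k).2.mono fun x hx => hx.1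
    have h2 : DifferentiableOn ℂ (fun x => (fv F x (Fin.last m))⁻¹) Ω₀ :=
      (h1 (Fin.last m)).fun_inv (fun x hx => hx.2)
    have h3 : (fun x => h x i) = fun x => fv F x (Fin.castLE hNm i).castSucc * (fv F x (Fin.last m))⁻¹ := by
      funext x; exact div_eq_mul_inv _ _
    rw [h3]
    exact (h1 (Fin.castLE hNm i).castSucc).mul h2
  obtain ⟨a, ha, hafib⟩ := exists_good_pert h hΩ₀o hhd (ε := δ / (Q * (Z + 1))) (by positivity)
  set F' : Fin (m + 1) → holA Ω := fun k => F k + (if hk : k.1 < N then F (Fin.last m) * pertAA Ω a ⟨k.1, hk⟩ else 0) with hF'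
  have hlast : ∀ x, fv F' x (Fin.last m) = fv F x (Fin.last m) := by
    intro x
    simp [fv, hF', not_lt.2 hNm]
  have hother : ∀ x (i : Fin N), fv F' x (Fin.castLE hNm i).castSucc
      = fv F x (Fin.castLE hNm i).castSucc + fv F x (Fin.last m) * pertA a x i := by
    intro x i
    simp [fv, hF', pertAA_apply]
  have D' : ShellD Ω S F' W L := by
    apply hpert
    intro x hx
    rw [pi_norm_le_iff_of_nonneg hδ.le]
    intro k
    by_cases hk : k.1 < N
    · have h1 : (fv F' x - fv F x) k = fv F x (Fin.last m) * pertA a x ⟨k.1, hk⟩ := by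
        simp [fv, hF', hk, pertAA_apply]
      rw [h1, norm_mul]
      have h2 : ‖fv F x (Fin.last m)‖ ≤ Q := (norm_le_pi_norm _ _).trans ((hQ₀ x hx).trans (le_max_left _ _))
      have h3 := pertA_bound a x ⟨k.1, hk⟩ (le_max_right R₀ 1) ((hR₀ x hx).trans (le_max_left _ _))
      have h4 : ‖pertA a x ⟨k.1, hk⟩‖ ≤ Z * ‖a‖ := h3.trans (le_of_eq (by rw [hZ]; ring))
      have h5 : ‖a‖ * (Q * (Z + 1)) < δ := by rwa [lt_div_iff₀ (by positivity)] at ha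
      calc _ ≤ Q * (Z * ‖a‖) := mul_le_mul h2 h4 (norm_nonneg _) hQ0.le
        _ ≤ ‖a‖ * (Q * (Z + 1)) := by nlinarith [mul_nonneg (norm_nonneg a) hQ0.le]
        _ ≤ δ := h5.le
    · have h1 : (fv F' x - fv F x) k = 0 := by simp [fv, hF', hk]
      rw [h1, norm_zero]; exact hδ.le
  refine D'.reduce_core hNm hS fun v C hC hCΩ hCv => ?_
  have hCΩ' : C ⊆ Ω₀ := fun x hx => ⟨(hCΩ hx).1, by have := (hCΩ hx).2; rwa [hlast] at this⟩
  refine hafib v C hC hCΩ' fun x hx => ?_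
  rw [← hCv x hx]
  funext i
  have h0 := (hCΩ' hx).2
  simp only [hother, hlast, Pi.add_apply, hh]
  field_simp

theorem ShellD.reduce_all {N : ℕ} {Ω S : Set (Fin N → ℂ)} (hΩ : IsOpen Ω) (hS : IsCompact S) (k : ℕ) :
    ∀ {F : Fin (N + k) → holA Ω} {W L : Set (Fin N → ℂ)} (_ : ShellD Ω S F W L),
    ∃ (F' : Fin N → holA Ω) (W' L' : Set (Fin N → ℂ)), ShellD Ω S F' W' L' := by
  induction k with
  | zero => intro F W L D; exact ⟨F, W, L, D⟩
  | succ k ih =>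
    intro F W L D
    obtain ⟨F', W', L', D'⟩ := ShellD.reduce (m := N + k) hΩ (Nat.le_add_right _ _) hS D
    exact ih D'

theorem exists_shell {N : ℕ} {Ω S : Set (Fin N → ℂ)} (hΩ : IsOpen Ω) (hS : IsCompact S) (hSΩ : S ⊆ Ω)
    (hconv : ∀ x ∈ Ω \ S, ∃ f : holA Ω, (∀ y ∈ S, ‖(f : (Fin N → ℂ) → ℂ) y‖ < 1) ∧ 1 < ‖(f : (Fin N → ℂ) → ℂ) x‖) :
    ∃ (k : ℕ) (F : Fin (N + k) → holA Ω) (W L : Set (Fin N → ℂ)), ShellD Ω S F W L := by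
  obtain ⟨L, hL, hL1, hL2⟩ := exists_compact_between hS hΩ hSΩ
  choose! f hf1 hf2 using hconv
  have hcpt : IsCompact (L \ interior L) := hL.diff isOpen_interior
  have hsub : ∀ x ∈ L \ interior L, x ∈ Ω \ S := fun x hx => ⟨hL2 hx.1, fun h => hx.2 (hL1 h)⟩
  obtain ⟨t, ht, htc⟩ := hcpt.elim_nhds_subcover (fun x => {y ∈ Ω | 1 < ‖(f x : (Fin N → ℂ) → ℂ) y‖}) (by
    intro x hx
    refine IsOpen.mem_nhds ?_ ⟨(hsub x hx).1, hf2 x (hsub x hx)⟩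
    have := ((f x).2.continuousOn.norm).isOpen_inter_preimage hΩ (isOpen_Ioi (a := (1:ℝ)))
    exact this)
  set e := t.equivFin
  refine ⟨t.card, Fin.append (fun _ : Fin N => (0 : holA Ω)) (fun i => f (e.symm i)), interior L, L,
    isOpen_interior, hL, hL1, interior_subset, hL2, fun x hx => ?_, fun x hx => ?_⟩
  · rw [pi_norm_lt_iff one_pos]
    intro i
    induction i using Fin.addCases with
    | left i => simp [fv]
    | right i =>
      simp only [fv, Fin.append_right]
      exact hf1 _ (hsub _ (ht _ (e.symm i).2)) x hx
  · obtain ⟨y, hy, hy2⟩ := mem_iUnion₂.1 (htc hx)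
    have h1 : 1 < ‖(f y : (Fin N → ℂ) → ℂ) x‖ := hy2.2
    refine h1.trans_le ?_
    have h2 := norm_le_pi_norm (fv (Fin.append (fun _ : Fin N => (0 : holA Ω)) (fun i => f (e.symm i))) x) (Fin.natAdd N (e ⟨y, hy⟩))
    simpa [fv] using h2

theorem char_eq_eval {N : ℕ} {Ω S : Set (Fin N → ℂ)} (hΩ : IsOpen Ω) (hS : IsCompact S) (hSΩ : S ⊆ Ω)
    (hconv : ∀ x ∈ Ω \ S, ∃ f : holA Ω, (∀ y ∈ S, ‖(f : (Fin N → ℂ) → ℂ) y‖ < 1) ∧ 1 < ‖(f : (Fin N → ℂ) → ℂ) x‖)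
    (φ : holA Ω →ₐ[ℂ] ℂ)
    (hφ : ∀ (h : holA Ω) (C : ℝ), (∀ x ∈ S, ‖(h : (Fin N → ℂ) → ℂ) x‖ ≤ C) → ‖φ h‖ ≤ C) :
    ∃ x ∈ S, ∀ h : holA Ω, φ h = (h : (Fin N → ℂ) → ℂ) x := by
  obtain ⟨k, F, W, L, D⟩ := exists_shell hΩ hS hSΩ hconv
  obtain ⟨F', W', L', D'⟩ := ShellD.reduce_all hΩ hS k D
  obtain ⟨F'', P, H, hPΩ, hSP⟩ := D'.toBrCov hΩ hS
  obtain ⟨x, hx, hx2⟩ := char_of_brcov hS F'' H hPΩ hSP φ hφ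
  refine ⟨x, ?_, hx2⟩
  by_contra hxS
  obtain ⟨f, hf1, hf2⟩ := hconv x ⟨hPΩ hx, hxS⟩
  have := hφ f 1 fun y hy => (hf1 y hy).le
  rw [hx2 f] at this
  linarith

end Part15

section Part16
theorem banach_power {A : Type*} [NormedCommRing A] [NormedAlgebra ℂ A] [CompleteSpace A] (I : Ideal A)
    (hI : IsClosed (I : Set A)) (f : A) {c : ℝ} (hc : c < 1) 
    (h : ∀ φ : A →ₐ[ℂ] ℂ, (∀ y ∈ I, φ y = 0) → ‖φ f‖ ≤ c) {ε : ℝ} (hε : 0 < ε) :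
    ∀ᶠ n : ℕ in Filter.atTop, ∃ y ∈ I, ‖f ^ n - y‖ < ε := by
  haveI := hI
  set a : A ⧸ I := Ideal.Quotient.mk I f with ha
  have hρ : spectralRadius ℂ a ≤ ENNReal.ofReal c := by
    unfold spectralRadius
    refine iSup₂_le fun z hz => ?_
    obtain ⟨χ, hχ⟩ := WeakDual.CharacterSpace.mem_spectrum_iff_exists.1 hz
    set ψ : A ⧸ I →ₐ[ℂ] ℂ := WeakDual.CharacterSpace.equivAlgHom χ with hψ
    have h1 := h (ψ.comp (Ideal.Quotient.mkₐ ℂ I)) (by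
      intro y hy
      simp only [AlgHom.comp_apply, Ideal.Quotient.mkₐ_eq_mk, Ideal.Quotient.eq_zero_iff_mem.2 hy, map_zero])
    have h2 : (ψ.comp (Ideal.Quotient.mkₐ ℂ I)) f = z := hχ
    rw [h2] at h1
    have h3 : (‖z‖₊ : ENNReal) = ENNReal.ofReal ‖z‖ := (ofReal_norm z).symm
    rw [h3]
    exact ENNReal.ofReal_le_ofReal h1
  set q : ℝ := (max c 0 + 1) / 2 with hq
  have hm : max c 0 < 1 := max_lt hc one_pos
  have hm0 := le_max_right c 0
  have hq0 : 0 < q := by rw [hq]; linarith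
  have hq1 : q < 1 := by rw [hq]; linarith
  have hlt : spectralRadius ℂ a < ENNReal.ofReal q := by
    refine hρ.trans_lt ?_
    rw [ENNReal.ofReal_lt_ofReal_iff hq0]
    have := le_max_left c 0
    rw [hq]; linarith
  have e1 := (spectrum.pow_norm_pow_one_div_tendsto_nhds_spectralRadius a).eventually_lt_const hlt
  have e2 : ∀ᶠ n : ℕ in Filter.atTop, q ^ n < ε / 2 :=
    (tendsto_pow_atTop_nhds_zero_of_lt_one hq0.le hq1).eventually_lt_const (by linarith)
  filter_upwards [e1, e2, Filter.eventually_gt_atTop 0] with n hn1 hn2 hn0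
  rw [ENNReal.ofReal_lt_ofReal_iff hq0] at hn1
  have h1 : ‖a ^ n‖ ≤ q ^ n := by
    have h2 := pow_le_pow_left₀ (Real.rpow_nonneg (norm_nonneg (a ^ n)) _) hn1.le n
    rwa [one_div, Real.rpow_inv_natCast_pow (norm_nonneg _) hn0.ne'] at h2
  obtain ⟨m, hm1, hm2⟩ := Submodule.Quotient.norm_mk_lt (S := I) (a ^ n) (ε := ε / 2) (by linarith)
  refine ⟨f ^ n - m, ?_, ?_⟩
  · rw [← Ideal.Quotient.eq_zero_iff_mem, map_sub, map_pow, ← ha, sub_eq_zero]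
    exact hm1.symm
  · rw [sub_sub_cancel]
    linarith

def resA {N : ℕ} {Ω S : Set (Fin N → ℂ)} (hSΩ : S ⊆ Ω) : holA Ω →ₐ[ℂ] C(S, ℂ) where
  toFun f := ⟨fun x => (f : (Fin N → ℂ) → ℂ) x, by
    have := f.2.continuousOn.mono hSΩ
    exact continuousOn_iff_continuous_restrict.1 this⟩
  map_one' := rfl
  map_mul' _ _ := rfl
  map_zero' := rfl
  map_add' _ _ := rfl
  commutes' _ := rfl

theorem power_approx {N r : ℕ} {Ω S : Set (Fin N → ℂ)} (hΩ : IsOpen Ω) (hS : IsCompact S) (hSΩ : S ⊆ Ω)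
    (hconv : ∀ x ∈ Ω \ S, ∃ f : holA Ω, (∀ y ∈ S, ‖(f : (Fin N → ℂ) → ℂ) y‖ < 1) ∧ 1 < ‖(f : (Fin N → ℂ) → ℂ) x‖)
    (g : Fin r → holA Ω) (f : holA Ω) {c : ℝ} (hc : c < 1)
    (hf : ∀ x ∈ S, (∀ i, (g i : (Fin N → ℂ) → ℂ) x = 0) → ‖(f : (Fin N → ℂ) → ℂ) x‖ ≤ c) :
    ∀ᶠ n : ℕ in Filter.atTop, ∃ p : Fin r → holA Ω, ∀ x ∈ S,
      ‖((f ^ n - ∑ i, p i * g i : holA Ω) : (Fin N → ℂ) → ℂ) x‖ ≤ 1 / 2 := by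
  haveI : CompactSpace S := isCompact_iff_compactSpace.1 hS
  set A : Subalgebra ℂ C(S, ℂ) := (resA hSΩ).range.topologicalClosure with hA
  haveI : CompleteSpace A := (Subalgebra.isClosed_topologicalClosure _).completeSpace_coe
  set ρ : holA Ω →ₐ[ℂ] A := (resA hSΩ).codRestrict A
    (fun x => Subalgebra.le_topologicalClosure _ ((resA hSΩ).mem_range_self x)) with hρ
  have hρd : DenseRange ρ := by
    intro y
    rw [closure_subtype]
    have h1 : (y : C(S, ℂ)) ∈ closure ((resA hSΩ).range : Set C(S, ℂ)) := y.2
    refine closure_mono ?_ h1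
    rintro _ ⟨w, rfl⟩
    exact ⟨ρ w, ⟨w, rfl⟩, rfl⟩
  have hρn : ∀ (h : holA Ω) (C : ℝ), 0 ≤ C → (∀ x ∈ S, ‖(h : (Fin N → ℂ) → ℂ) x‖ ≤ C) → ‖ρ h‖ ≤ C := by
    intro h C hC hx
    exact (ContinuousMap.norm_le (resA hSΩ h) hC).2 fun x => hx x x.2
  set J : Ideal A := Ideal.span (range fun i => ρ (g i)) with hJ
  have key := banach_power J.closure (by rw [Ideal.coe_closure]; exact isClosed_closure) (ρ f) hc (by
    intro φ hφ
    have hne : S.Nonempty := by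
      by_contra hne
      rw [not_nonempty_iff_eq_empty] at hne
      haveI : IsEmpty S := by rw [hne]; infer_instance
      have h1 : (1 : A) = 0 := Subtype.ext (ContinuousMap.ext fun x => isEmptyElim x)
      have := congrArg φ h1
      simp at this
    obtain ⟨x, hx, hx2⟩ := char_eq_eval hΩ hS hSΩ hconv (φ.comp ρ) (by
      intro h C hC
      obtain ⟨x, hx⟩ := hne
      have hC0 : 0 ≤ C := (norm_nonneg _).trans (hC x hx)
      have h1 : ‖φ (ρ h)‖ ≤ ‖ρ h‖ * ‖(1 : A)‖ := AlgHom.norm_apply_le_self_mul_norm_one φ (ρ h)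
      have h2 := hρn h C hC0 hC
      have h3 : ‖(1 : A)‖ ≤ 1 := by
        rw [← map_one ρ]
        refine hρn 1 1 zero_le_one fun x _ => ?_
        simp
      show ‖φ (ρ h)‖ ≤ C
      nlinarith [norm_nonneg (ρ h)])
    have h4 : φ (ρ f) = (f : (Fin N → ℂ) → ℂ) x := hx2 f
    rw [h4]
    refine hf x hx fun i => ?_
    rw [← hx2 (g i)]
    refine hφ _ ?_
    have : ρ (g i) ∈ (J : Set A) := Ideal.subset_span ⟨i, rfl⟩
    exact subset_closure this) (ε := 1 / 8) (by norm_num)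
  filter_upwards [key] with n hn
  obtain ⟨y, hy, hyn⟩ := hn
  have hy' : y ∈ closure (J : Set A) := hy
  obtain ⟨y', hy'J, hyy'⟩ := Metric.mem_closure_iff.1 hy' (1 / 8) (by norm_num)
  obtain ⟨b, hb⟩ := Ideal.mem_span_range_iff_exists_fun.1 hy'J
  have hpi : DenseRange (fun (p : Fin r → holA Ω) i => ρ (p i)) := DenseRange.piMap fun _ => hρd
  have hcont : Continuous fun b : Fin r → A => ∑ i, b i * ρ (g i) := by fun_prop
  have hopen : IsOpen {b : Fin r → A | dist (∑ i, b i * ρ (g i)) y' < 1 / 8} :=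
    isOpen_lt (hcont.dist continuous_const) continuous_const
  obtain ⟨p, hp⟩ := hpi.exists_mem_open hopen ⟨b, by simp [hb]⟩
  refine ⟨p, fun x hx => ?_⟩
  have h1 : ‖ρ (f ^ n - ∑ i, p i * g i)‖ ≤ 1 / 2 := by
    have e : ρ (f ^ n - ∑ i, p i * g i) = (ρ f ^ n - y) + (y - y') + (y' - ∑ i, ρ (p i) * ρ (g i)) := by
      simp only [map_sub, map_pow, map_sum, map_mul]; ring
    rw [e]
    have h2 : ‖y - y'‖ < 1 / 8 := by rwa [← dist_eq_norm]
    have h3 : ‖y' - ∑ i, ρ (p i) * ρ (g i)‖ < 1 / 8 := by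
      rw [← dist_eq_norm, dist_comm]; exact hp
    have := norm_add₃_le (a := ρ f ^ n - y) (b := y - y') (c := y' - ∑ i, ρ (p i) * ρ (g i))
    linarith
  have h2 : ‖resA hSΩ (f ^ n - ∑ i, p i * g i)‖ ≤ 1 / 2 := h1
  exact (ContinuousMap.norm_le _ (by norm_num)).1 h2 ⟨x, hx⟩

end Part16

theorem le_hull_sup {E : Type*} [NormedAddCommGroup E] [NormedSpace ℂ E] {Ω K : Set E}
    (hK : IsCompact K) (hKΩ : K ⊆ Ω) {f : E → ℂ} (hf : DifferentiableOn ℂ f Ω) {w : E} (hw : w ∈ K) :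
    ‖f w‖ ≤ ⨆ w ∈ K, ‖f w‖ := by
  obtain ⟨C, hC⟩ := hK.exists_bound_of_continuousOn (hf.continuousOn.mono hKΩ)
  have hC0 : 0 ≤ C := (norm_nonneg _).trans (hC w hw)
  have hb : BddAbove (range fun w => ⨆ (_ : w ∈ K), ‖f w‖) := by
    refine ⟨C, ?_⟩
    rintro _ ⟨x, rfl⟩
    exact Real.iSup_le (fun hx => hC x hx) hC0
  refine le_ciSup_of_le hb w ?_
  rw [ciSup_pos hw]

theorem subset_hullO {E : Type*} [NormedAddCommGroup E] [NormedSpace ℂ E] {Ω K : Set E}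
    (hK : IsCompact K) (hKΩ : K ⊆ Ω) : K ⊆ hullO Ω K :=
  fun _ hw => ⟨hKΩ hw, fun _ hf => le_hull_sup hK hKΩ hf hw⟩

theorem hullO_bound {E : Type*} [NormedAddCommGroup E] [NormedSpace ℂ E] {Ω K : Set E}
    {z : E} (hz : z ∈ hullO Ω K) {f : E → ℂ} (hf : DifferentiableOn ℂ f Ω) {C : ℝ} (hC : 0 ≤ C)
    (h : ∀ w ∈ K, ‖f w‖ ≤ C) : ‖f z‖ ≤ C :=
  (hz.2 f hf).trans (Real.iSup_le (fun w => Real.iSup_le (fun hw => h w hw) hC) hC)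

theorem hullO_sep {E : Type*} [NormedAddCommGroup E] [NormedSpace ℂ E] {Ω K : Set E}
    (hK : IsCompact K) (hKΩ : K ⊆ Ω) {z : E} (hz : z ∈ Ω) (hzK : z ∉ hullO Ω K) :
    ∃ f : E → ℂ, DifferentiableOn ℂ f Ω ∧ f z = 1 ∧ ∃ c : ℝ, 0 ≤ c ∧ c < 1 ∧ ∀ w ∈ K, ‖f w‖ ≤ c := by
  have : ∃ f : E → ℂ, DifferentiableOn ℂ f Ω ∧ (⨆ w ∈ K, ‖f w‖) < ‖f z‖ := by
    by_contra! hcon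
    exact hzK ⟨hz, hcon⟩
  obtain ⟨f, hf, hlt⟩ := this
  have h0 : 0 ≤ ⨆ w ∈ K, ‖f w‖ :=
    Real.iSup_nonneg fun w => Real.iSup_nonneg fun _ => norm_nonneg _
  have hpos : 0 < ‖f z‖ := h0.trans_lt hlt
  refine ⟨fun w => f w / f z, by simpa only [div_eq_mul_inv] using hf.mul_const (f z)⁻¹, div_self (norm_pos_iff.1 hpos),
    (⨆ w ∈ K, ‖f w‖) / ‖f z‖, by positivity, (div_lt_one hpos).2 hlt, fun w hw => ?_⟩
  rw [norm_div]
  exact div_le_div_of_nonneg_right (le_hull_sup hK hKΩ hf hw) hpos.le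

theorem union_convex_aux {N r : ℕ}
    (Ω : Set (EuclideanSpace ℂ (Fin N))) (hΩ : IsOpen Ω)
    (g : EuclideanSpace ℂ (Fin N) → EuclideanSpace ℂ (Fin r))
    (hg : DifferentiableOn ℂ g Ω)
    (S : Set (EuclideanSpace ℂ (Fin N))) (hScpt : IsCompact S) (hSΩ : S ⊆ Ω)
    (hSconv : hullO Ω S = S)
    (f : EuclideanSpace ℂ (Fin N) → ℂ) (hf : DifferentiableOn ℂ f Ω) {c : ℝ} (hc : c < 1)
    (hfc : ∀ x ∈ S, g x = 0 → ‖f x‖ ≤ c) :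
    ∀ᶠ n : ℕ in Filter.atTop, ∃ q : EuclideanSpace ℂ (Fin N) → ℂ, DifferentiableOn ℂ q Ω ∧
      (∀ x ∈ Ω, g x = 0 → q x = 0) ∧ ∀ x ∈ S, ‖f x ^ n - q x‖ ≤ 1 / 2 := by
  let e := EuclideanSpace.equiv (Fin N) ℂ
  have tr : ∀ {h : EuclideanSpace ℂ (Fin N) → ℂ}, DifferentiableOn ℂ h Ω →
      DifferentiableOn ℂ (fun x => h (e.symm x)) (e.symm ⁻¹' Ω) := fun hh =>
    hh.comp e.symm.differentiable.differentiableOn (fun x hx => hx)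
  have hgi : ∀ i, DifferentiableOn ℂ (fun x => g x i) Ω := fun i =>
    (differentiableOn_euclidean.1 hg) i
  have hS' : IsCompact (e.symm ⁻¹' S) := by
    have : e.symm ⁻¹' S = e '' S := (e.image_eq_preimage_symm S).symm
    rw [this]
    exact hScpt.image e.continuous
  have key := power_approx (Ω := e.symm ⁻¹' Ω) (S := e.symm ⁻¹' S) (r := r)
    (hΩ.preimage e.symm.continuous) hS' (preimage_mono hSΩ) (by
      rintro x ⟨hx, hxS⟩
      obtain ⟨u, hu, hu1, d, hd0, hd1, hud⟩ := hullO_sep hScpt hSΩ (z := e.symm x) hx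
        (by rw [hSconv]; exact hxS)
      have hd2 : (0 : ℝ) < (d + 1) / 2 := by linarith
      refine ⟨⟨fun y => u (e.symm y) / (((d + 1) / 2 : ℝ) : ℂ), by
        change DifferentiableOn ℂ _ _
        simpa only [div_eq_mul_inv] using (tr hu).mul_const (((d + 1) / 2 : ℝ) : ℂ)⁻¹⟩, ?_, ?_⟩
      · intro y hy
        change ‖u (e.symm y) / (((d + 1) / 2 : ℝ) : ℂ)‖ < 1
        rw [norm_div, Complex.norm_real, Real.norm_of_nonneg hd2.le, div_lt_one hd2]
        have := hud _ hy
        linarith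
      · change 1 < ‖u (e.symm x) / (((d + 1) / 2 : ℝ) : ℂ)‖
        rw [norm_div, Complex.norm_real, Real.norm_of_nonneg hd2.le, one_lt_div hd2, hu1, norm_one]
        linarith)
    (fun i => ⟨fun y => g (e.symm y) i, tr (hgi i)⟩) ⟨fun y => f (e.symm y), tr hf⟩ hc (by
      intro x hx h0
      refine hfc _ hx ?_
      ext i
      exact h0 i)
  filter_upwards [key] with n hn
  obtain ⟨p, hp⟩ := hn
  refine ⟨fun x => ∑ i, (p i : (Fin N → ℂ) → ℂ) (e x) * g x i, ?_, ?_, ?_⟩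
  · refine DifferentiableOn.fun_sum fun i _ => DifferentiableOn.mul ?_ (hgi i)
    have h1 : DifferentiableOn ℂ (p i : (Fin N → ℂ) → ℂ) (e.symm ⁻¹' Ω) := (p i).2
    refine h1.comp e.differentiable.differentiableOn (fun x hx => ?_)
    simpa using hx
  · intro x _ hx
    simp [hx]
  · intro x hx
    have := hp (e x) (by simpa using hx)
    simpa [Finset.sum_apply] using this

/-- Lemma 2.5 (a consequence of Rossi's local maximum modulus principle): if `V` is a
closed complex subvariety of a Stein open set `Ω` (here the zero set of a holomorphic map
`g`), `S ⊆ Ω` is compact and `𝒪(Ω)`-convex, `K ⊆ V` is compact and `𝒪(V)`-convex, and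
`S ∩ V ⊆ K`, then `K ∪ S` is `𝒪(Ω)`-convex. -/
theorem union_with_subvariety_convex {N r : ℕ}
    (Ω : Set (EuclideanSpace ℂ (Fin N))) (hΩ : IsSteinOpen Ω)
    (g : EuclideanSpace ℂ (Fin N) → EuclideanSpace ℂ (Fin r))
    (hg : DifferentiableOn ℂ g Ω)
    (S : Set (EuclideanSpace ℂ (Fin N))) (hScpt : IsCompact S) (hSΩ : S ⊆ Ω)
    (hSconv : hullO Ω S = S)
    (K : Set (EuclideanSpace ℂ (Fin N))) (hKcpt : IsCompact K)
    (hKV : K ⊆ {z ∈ Ω | g z = 0})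
    (hKconv : K = hullO Ω K ∩ {z ∈ Ω | g z = 0})
    (hSVK : S ∩ {z ∈ Ω | g z = 0} ⊆ K) :
    hullO Ω (K ∪ S) = K ∪ S := by
  have hKΩ : K ⊆ Ω := fun x hx => (hKV hx).1
  refine Subset.antisymm ?_ (subset_hullO (hKcpt.union hScpt) (union_subset hKΩ hSΩ))
  intro z hz
  by_contra hzn
  rw [mem_union, not_or] at hzn
  obtain ⟨hzK, hzS⟩ := hzn
  by_cases hgz : g z = 0
  · have hzh : z ∉ hullO Ω K := fun h => hzK (by rw [hKconv]; exact ⟨h, hz.1, hgz⟩)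
    obtain ⟨f, hf, hf1, c, hc0, hc1, hfc⟩ := hullO_sep hKcpt hKΩ hz.1 hzh
    have h1 := union_convex_aux Ω hΩ.1 g hg S hScpt hSΩ hSconv f hf hc1
      (fun x hx hx0 => hfc x (hSVK ⟨hx, hSΩ hx, hx0⟩))
    have h2 := (tendsto_pow_atTop_nhds_zero_of_lt_one hc0 hc1).eventually
      (gt_mem_nhds (show (0 : ℝ) < 1 / 2 by norm_num))
    obtain ⟨n, ⟨q, hq, hq0, hqS⟩, hn⟩ := (h1.and h2).exists
    have hb := hullO_bound hz (f := fun x => f x ^ n - q x) ((hf.pow n).sub hq)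
      (C := 1 / 2) (by norm_num) (by
        rintro w (hw | hw)
        · change ‖f w ^ n - q w‖ ≤ 1 / 2
          rw [hq0 w (hKΩ hw) (hKV hw).2, sub_zero, norm_pow]
          exact (pow_le_pow_left₀ (norm_nonneg _) (hfc w hw) n).trans hn.le
        · exact hqS w hw)
    have hb' : ‖f z ^ n - q z‖ ≤ 1 / 2 := hb
    rw [hq0 z hz.1 hgz, hf1, one_pow, sub_zero, norm_one] at hb'
    norm_num at hb'
  · obtain ⟨j, hj⟩ : ∃ j, g z j ≠ 0 := by
      by_contra! hcon
      exact hgz (by ext j; exact hcon j)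
    have hgj : DifferentiableOn ℂ (fun x => g x j) Ω := (differentiableOn_euclidean.1 hg) j
    obtain ⟨f, hf, hf1, c, hc0, hc1, hfc⟩ := hullO_sep hScpt hSΩ hz.1 (by rw [hSconv]; exact hzS)
    obtain ⟨C, hC⟩ := hScpt.exists_bound_of_continuousOn (hgj.continuousOn.mono hSΩ)
    have h3 : Filter.Tendsto (fun n : ℕ => c ^ n * |C|) Filter.atTop (𝓝 0) := by
      simpa using (tendsto_pow_atTop_nhds_zero_of_lt_one hc0 hc1).mul_const |C|
    obtain ⟨n, hn⟩ := (h3.eventually (gt_mem_nhds (norm_pos_iff.2 hj))).exists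
    have hb := hullO_bound hz (f := fun x => f x ^ n * g x j) ((hf.pow n).mul hgj)
      (C := c ^ n * |C|) (by positivity) (by
        rintro w (hw | hw)
        · change ‖f w ^ n * g w j‖ ≤ _
          rw [(hKV hw).2]
          simp only [PiLp.zero_apply, mul_zero, norm_zero]
          positivity
        · change ‖f w ^ n * g w j‖ ≤ _
          rw [norm_mul, norm_pow]
          exact mul_le_mul (pow_le_pow_left₀ (norm_nonneg _) (hfc w hw) n)
            ((hC w hw).trans (le_abs_self _)) (norm_nonneg _) (by positivity))
    have hb' : ‖f z ^ n * g z j‖ ≤ c ^ n * |C| := hb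
    rw [hf1, one_pow, one_mul] at hb'
    linarith
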